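/- arXiv:2311.01668 — 2 statements merged into one kernel-verified Lean document; each statement's English description precedes it below -/
import Mathlib

section
/- Let F(X) be a free group of finite rank and let H be a finitely generated subgroup of F(X). Then H is contained in a proper free factor of F(X) if and only if every minimal automorphic image of the Stallings graph S_X(H) omits some letter of X from its set of edge labels. -/
/-- An `X`-digraph: a finite directed graph with edges labeled by elements of `X`. -/
structure XDigraph (X : Type) where
  V : Type
  E : Type
  [fintypeV : Fintype V]
  [fintypeE : Fintype E]
  [decV : DecidableEq V]
  [decE : DecidableEq E]
  init : E → V
  term : E → V
  lab : E → X

attribute [instance] XDigraph.fintypeV XDigraph.fintypeE XDigraph.decV XDigraph.decE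

namespace XDigraph

variable {X : Type} (S : XDigraph X)

/-- A dart is an edge together with a direction (`true` = forward). -/
abbrev Dart := S.E × Bool

def dInit (d : S.Dart) : S.V := if d.2 then S.init d.1 else S.term d.1

def dTerm (d : S.Dart) : S.V := if d.2 then S.term d.1 else S.init d.1

/-- The label of a dart, as an element of `X ∪ X⁻¹` (encoded as `X × Bool`). -/
def dLab (d : S.Dart) : X × Bool := (S.lab d.1, d.2)

def dRev (d : S.Dart) : S.Dart := (d.1, !d.2)

/-- The degree of a vertex: the number of darts pointing into it. -/
def degree (v : S.V) : ℕ := (Finset.univ.filter (fun d : S.Dart => S.dTerm d = v)).card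

/-- The hyperlink of a vertex: the set of labels of darts pointing into it. -/
def hyperlink (v : S.V) : Set (X × Bool) := {p | ∃ d : S.Dart, S.dTerm d = v ∧ S.dLab d = p}

/-- `S` is folded if darts into the same vertex have distinct labels. -/
def Folded : Prop := ∀ v : S.V, Set.InjOn S.dLab {d : S.Dart | S.dTerm d = v}

def Adj (u v : S.V) : Prop := ∃ d : S.Dart, S.dInit d = u ∧ S.dTerm d = v

def Connected : Prop := Nonempty S.V ∧ ∀ u v : S.V, Relation.EqvGen S.Adj u v

/-- A cyclically reduced graph has no leaves (vertices of degree one). -/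
def NoLeaf : Prop := ∀ v : S.V, S.degree v ≠ 1

def IsPath (p : List S.Dart) : Prop := p.Chain' (fun d d' => S.dTerm d = S.dInit d')

/-- A path is immersed if no dart is immediately followed by its reverse. -/
def Immersed (p : List S.Dart) : Prop := p.Chain' (fun d d' => d' ≠ S.dRev d)

def IsLoopAt (p : List S.Dart) (v : S.V) : Prop :=
  S.IsPath p ∧ ∀ h : p ≠ [], S.dInit (p.head h) = v ∧ S.dTerm (p.getLast h) = v

def pathLab (p : List S.Dart) : List (X × Bool) := p.map S.dLab

/-- Adjacency using only edges satisfying `P`. -/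
def AdjOn (P : S.E → Prop) (u v : S.V) : Prop :=
  ∃ e : S.E, P e ∧ ((S.init e = u ∧ S.term e = v) ∨ (S.init e = v ∧ S.term e = u))

end XDigraph

section Defs

variable {X : Type} [DecidableEq X]

/-- A list of letters in `X ∪ X⁻¹` is freely reduced: no `x x⁻¹` or `x⁻¹ x` subword. -/
def ReducedList (l : List (X × Bool)) : Prop :=
  List.Chain' (fun p q : X × Bool => p.1 ≠ q.1 ∨ p.2 = q.2) l

/-- `w` is cyclically reduced: every cyclic permutation of its reduced word is freely reduced. -/
def CyclRed (w : FreeGroup X) : Prop :=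
  ∀ l : List (X × Bool), w.toWord.IsRotated l → ReducedList l

/-- `w` is readable as the label of an immersed loop of `S` based at `v`. -/
def Reads (S : XDigraph X) (v : S.V) (w : FreeGroup X) : Prop :=
  ∃ p : List S.Dart, S.Immersed p ∧ S.IsLoopAt p v ∧ S.pathLab p = w.toWord

/-- `S`, with basepoint `base`, is the Stallings graph of the subgroup `H`:
a folded connected core graph whose immersed loops at `base` read exactly the elements of `H`. -/
def PRep (S : XDigraph X) (base : S.V) (H : Subgroup (FreeGroup X)) : Prop :=
  S.Folded ∧ S.Connected ∧ (∀ v : S.V, v ≠ base → 2 ≤ S.degree v) ∧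
    ∀ w : FreeGroup X, w ∈ H ↔ Reads S base w

/-- `S` is the cyclically reduced Stallings graph representing the conjugacy class of `H`:
a folded, connected, cyclically reduced graph whose immersed loops read exactly the
cyclically reduced elements of `F(X)` that are conjugate into `H`. -/
def CRep (S : XDigraph X) (H : Subgroup (FreeGroup X)) : Prop :=
  S.Folded ∧ S.Connected ∧ S.NoLeaf ∧
    ∀ w : FreeGroup X, CyclRed w →
      ((∃ v : S.V, Reads S v w) ↔ ∃ c : FreeGroup X, c * w * c⁻¹ ∈ H)

/-- The element of `F(X)` given by a single letter of `X ∪ X⁻¹`. -/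
def iota (p : X × Bool) : FreeGroup X :=
  if p.2 then FreeGroup.of p.1 else (FreeGroup.of p.1)⁻¹

/-- `φ` is the type II Whitehead automorphism with cut `C` and multiplier `m`. -/
def IsWhiteheadII (φ : FreeGroup X ≃* FreeGroup X) (C : Finset (X × Bool)) (m : X × Bool) :
    Prop :=
  m ∈ C ∧ (m.1, !m.2) ∉ C ∧
    ∀ x : X, φ (FreeGroup.of x) =
      if x = m.1 then FreeGroup.of x
      else (if (x, false) ∈ C then (iota m)⁻¹ else 1) * FreeGroup.of x *
           (if (x, true) ∈ C then iota m else 1)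

/-- The number of edges of `S` labeled `x`. -/
def edgeCount (S : XDigraph X) (x : X) : ℕ :=
  (Finset.univ.filter (fun e : S.E => S.lab e = x)).card

/-- The hyperlink of a vertex, as a finset. -/
def hyperlinkF (S : XDigraph X) (v : S.V) : Finset (X × Bool) :=
  (Finset.univ.filter (fun d : S.Dart => S.dTerm d = v)).image S.dLab

/-- The capacity of the cut `C` in the Whitehead hypergraph of `S`: the number of vertices
whose hyperlink meets both `C` and its complement. -/
def cap (S : XDigraph X) (C : Finset (X × Bool)) : ℕ :=
  (Finset.univ.filter
    (fun v : S.V => (hyperlinkF S v ∩ C).Nonempty ∧ (hyperlinkF S v \ C).Nonempty)).card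

/-- The degree of the letter `m` in the Whitehead hypergraph of `S`: the number of vertices
whose hyperlink contains `m`. -/
def wdeg (S : XDigraph X) (m : X × Bool) : ℕ :=
  (Finset.univ.filter (fun v : S.V => m ∈ hyperlinkF S v)).card

/-- The number of connected components of the subgraph of `S` spanned by the edges
satisfying `P`, on the vertex set `{v | W v}`. -/
noncomputable def componentsCount (S : XDigraph X) (P : S.E → Prop) (W : S.V → Prop) : ℕ :=
  Nat.card (Quotient (Setoid.comap (Subtype.val : {v : S.V // W v} → S.V)
    (Relation.EqvGen.setoid (S.AdjOn P))))

/-- The connected component of `u` in `S - e₀` has rank one (first Betti number one),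
i.e. it has as many edges as vertices. -/
def ComponentRankOne (S : XDigraph X) (e₀ : S.E) (u : S.V) : Prop :=
  Nat.card {e : S.E // e ≠ e₀ ∧ Relation.EqvGen (S.AdjOn (· ≠ e₀)) u (S.init e)} =
    Nat.card {v : S.V // Relation.EqvGen (S.AdjOn (· ≠ e₀)) u v}

/-- Property (L): `S` has a unique `v`-labeled edge `e₀`, and `S - e₀` has exactly two
connected components, at least one of which has rank one. -/
def PropertyL (S : XDigraph X) (v : X) : Prop :=
  ∃ e₀ : S.E, S.lab e₀ = v ∧ (∀ e : S.E, S.lab e = v → e = e₀) ∧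
    componentsCount S (· ≠ e₀) (fun _ => True) = 2 ∧
    ∃ u : S.V, ComponentRankOne S e₀ u

/-- Property (S) for the partition `X = A ⊔ Aᶜ`: `S` is connected and cyclically reduced,
the `A`-edges form a bouquet of single-edge loops at one vertex, and the subgraph spanned
by the remaining edges is connected of rank one. -/
def PropertyS (S : XDigraph X) (A : Set X) : Prop :=
  S.Connected ∧ S.NoLeaf ∧
    (∃ v₀ : S.V, ∀ e : S.E, S.lab e ∈ A → S.init e = v₀ ∧ S.term e = v₀) ∧
    Nat.card {e : S.E // S.lab e ∉ A} =
      Nat.card {w : S.V // ∃ e : S.E, S.lab e ∉ A ∧ (S.init e = w ∨ S.term e = w)} ∧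
    ∀ u w : S.V, (∃ e : S.E, S.lab e ∉ A ∧ (S.init e = u ∨ S.term e = u)) →
      (∃ e : S.E, S.lab e ∉ A ∧ (S.init e = w ∨ S.term e = w)) →
      Relation.EqvGen (S.AdjOn (fun e => S.lab e ∉ A)) u w

/-- An immersion of `X`-digraphs: a label- and orientation-preserving graph map which is
locally injective on links. -/
structure Immersion (S T : XDigraph X) where
  onV : S.V → T.V
  onE : S.E → T.E
  map_init : ∀ e : S.E, T.init (onE e) = onV (S.init e)
  map_term : ∀ e : S.E, T.term (onE e) = onV (S.term e)
  map_lab : ∀ e : S.E, T.lab (onE e) = S.lab e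
  locInj : ∀ (v : S.V) (d d' : S.Dart), S.dTerm d = v → S.dTerm d' = v →
    ((onE d.1, d.2) : T.Dart) = (onE d'.1, d'.2) → d = d'

/-- `K` is a proper free factor of `F(X)`: there is a nontrivial `L` with `F(X) = K ∗ L`. -/
def IsProperFreeFactor (K : Subgroup (FreeGroup X)) : Prop :=
  ∃ L : Subgroup (FreeGroup X), L ≠ ⊥ ∧
    Function.Bijective (Monoid.Coprod.lift K.subtype L.subtype)

end Defs

/-- The inverse of a letter of `X ∪ X⁻¹`. -/
def letterInv {X : Type} (p : X × Bool) : X × Bool := (p.1, !p.2)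

@[simp] theorem letterInv_letterInv {X : Type} (p : X × Bool) : letterInv (letterInv p) = p := by
  simp [letterInv]

theorem letterInv_ne {X : Type} (p : X × Bool) : letterInv p ≠ p := by
  intro h
  have := congrArg Prod.snd h
  simp [letterInv] at this

theorem iota_eq_mk {X : Type} (p : X × Bool) : iota p = FreeGroup.mk [p] := by
  obtain ⟨x, b⟩ := p
  cases b <;> simp [iota, FreeGroup.of, FreeGroup.invRev]

theorem iota_letterInv {X : Type} (p : X × Bool) : iota (letterInv p) = (iota p)⁻¹ := by
  obtain ⟨x, b⟩ := p
  cases b <;> simp [iota, letterInv]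

theorem isReduced_iff_ne_letterInv {X : Type} (l : List (X × Bool)) :
    FreeGroup.IsReduced l ↔ l.IsChain (fun a b => b ≠ letterInv a) := by
  have : (fun a b : X × Bool => a.1 = b.1 → a.2 = b.2) = fun a b => b ≠ letterInv a := by
    funext ⟨x, b⟩ ⟨y, c⟩
    simp only [letterInv, ne_eq, Prod.mk.injEq, not_and, eq_iff_iff]
    cases b <;> cases c <;> simp [eq_comm]
  rw [FreeGroup.IsReduced, this]

theorem reducedList_iff {X : Type} (l : List (X × Bool)) :
    ReducedList l ↔ FreeGroup.IsReduced l := by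
  have : (fun p q : X × Bool => p.1 ≠ q.1 ∨ p.2 = q.2) = fun a b => a.1 = b.1 → a.2 = b.2 := by
    funext a b
    simp only [eq_iff_iff]; tauto
  rw [ReducedList, FreeGroup.IsReduced, this]
  rfl

theorem invRev_cons_eq {X : Type} (z : X × Bool) (l : List (X × Bool)) :
    FreeGroup.invRev (z :: l) = FreeGroup.invRev l ++ [letterInv z] := by
  simp [FreeGroup.invRev, letterInv]

theorem isReduced_invRev {X : Type} {l : List (X × Bool)} (h : FreeGroup.IsReduced l) :
    FreeGroup.IsReduced (FreeGroup.invRev l) := by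
  classical
  rw [FreeGroup.isReduced_iff_reduce_eq, FreeGroup.reduce_invRev, h.reduce_eq]

namespace XDigraph

variable {X : Type} {S : XDigraph X}

@[simp] theorem dInit_dRev (d : S.Dart) : S.dInit (S.dRev d) = S.dTerm d := by
  obtain ⟨e, b⟩ := d
  cases b <;> simp [dInit, dTerm, dRev]

@[simp] theorem dTerm_dRev (d : S.Dart) : S.dTerm (S.dRev d) = S.dInit d := by
  obtain ⟨e, b⟩ := d
  cases b <;> simp [dInit, dTerm, dRev]

@[simp] theorem dRev_dRev (d : S.Dart) : S.dRev (S.dRev d) = d := by simp [dRev]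

@[simp] theorem dLab_dRev (d : S.Dart) : S.dLab (S.dRev d) = letterInv (S.dLab d) := rfl

theorem dRev_ne (d : S.Dart) : S.dRev d ≠ d := by
  intro h
  have := congrArg Prod.snd h
  simp [dRev] at this

theorem Folded.eq_of_dTerm (hS : S.Folded) {d d' : S.Dart} (h : S.dTerm d = S.dTerm d')
    (hl : S.dLab d = S.dLab d') : d = d' :=
  hS (S.dTerm d') (by simpa using h) rfl hl

theorem Folded.eq_of_dInit (hS : S.Folded) {d d' : S.Dart} (h : S.dInit d = S.dInit d')
    (hl : S.dLab d = S.dLab d') : d = d' := by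
  have := hS.eq_of_dTerm (d := S.dRev d) (d' := S.dRev d') (by simpa using h) (by simp [hl])
  simpa using congrArg S.dRev this

/-- `S.Run u l v` says that the word `l` labels a (not necessarily immersed) path of `S`
from `u` to `v`. -/
def Run (S : XDigraph X) : S.V → List (X × Bool) → S.V → Prop
  | u, [], v => u = v
  | u, z :: l, v => ∃ d : S.Dart, S.dInit d = u ∧ S.dLab d = z ∧ Run S (S.dTerm d) l v

theorem run_append {u v : S.V} {l₁ l₂ : List (X × Bool)} :
    S.Run u (l₁ ++ l₂) v ↔ ∃ w, S.Run u l₁ w ∧ S.Run w l₂ v := by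
  induction l₁ generalizing u with
  | nil => simp [Run]
  | cons z l ih =>
    simp only [List.cons_append, Run, ih]
    constructor
    · rintro ⟨d, h1, h2, w, h3, h4⟩
      exact ⟨w, ⟨d, h1, h2, h3⟩, h4⟩
    · rintro ⟨w, ⟨d, h1, h2, h3⟩, h4⟩
      exact ⟨d, h1, h2, w, h3, h4⟩

theorem run_dart (d : S.Dart) : S.Run (S.dInit d) [S.dLab d] (S.dTerm d) := ⟨d, rfl, rfl, rfl⟩

theorem Run.invRev {u v : S.V} {l : List (X × Bool)} (h : S.Run u l v) :
    S.Run v (FreeGroup.invRev l) u := by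
  induction l generalizing u with
  | nil => exact Eq.symm h
  | cons z l ih =>
    obtain ⟨d, h1, h2, h3⟩ := h
    rw [invRev_cons_eq, run_append]
    exact ⟨_, ih h3, S.dRev d, by simp, by simp [h2], by simp [h1, Run]⟩

theorem Folded.run_unique (hS : S.Folded) {u v w : S.V} {l : List (X × Bool)}
    (h : S.Run u l v) (h' : S.Run u l w) : v = w := by
  induction l generalizing u with
  | nil => exact (Eq.symm h).trans h'
  | cons z l ih =>
    obtain ⟨d, h1, h2, h3⟩ := h
    obtain ⟨d', h1', h2', h3'⟩ := h'
    obtain rfl := hS.eq_of_dInit (h1.trans h1'.symm) (h2.trans h2'.symm)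
    exact ih h3 h3'

theorem Folded.run_of_red (hS : S.Folded) {u v : S.V} {l l' : List (X × Bool)}
    (hl : FreeGroup.Red l l') (h : S.Run u l v) : S.Run u l' v := by
  induction hl with
  | refl => exact h
  | tail _ hstep ih =>
    cases hstep with
    | @not L₁ L₂ x b =>
      obtain ⟨w, h1, d, hd, hl, d', hd', hl', h2⟩ := run_append.1 ih
      have : d' = S.dRev d := hS.eq_of_dInit (by simpa using hd') (by simp [hl, hl', letterInv])
      subst this
      refine run_append.2 ⟨w, h1, ?_⟩
      simpa [hd] using h2

theorem Run.exists_dart {u v : S.V} {l : List (X × Bool)} (h : S.Run u l v) {z : X × Bool}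
    (hz : z ∈ l) : ∃ d, S.dLab d = z := by
  induction l generalizing u with
  | nil => simp at hz
  | cons y l ih =>
    obtain ⟨d, -, h2, h3⟩ := h
    rcases List.mem_cons.1 hz with rfl | hz
    · exact ⟨d, h2⟩
    · exact ih h3 hz

/-- `S.Conn u v w` says that some path of `S` from `u` to `v` has a label representing `w`. -/
def Conn (S : XDigraph X) (u v : S.V) (w : FreeGroup X) : Prop :=
  ∃ l, FreeGroup.mk l = w ∧ S.Run u l v

theorem conn_one (u : S.V) : S.Conn u u 1 := ⟨[], rfl, rfl⟩

theorem Conn.mul {u v w : S.V} {a b : FreeGroup X} (h : S.Conn u v a) (h' : S.Conn v w b) :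
    S.Conn u w (a * b) := by
  obtain ⟨l, rfl, h⟩ := h
  obtain ⟨l', rfl, h'⟩ := h'
  exact ⟨l ++ l', by simp, run_append.2 ⟨v, h, h'⟩⟩

theorem Conn.inv {u v : S.V} {a : FreeGroup X} (h : S.Conn u v a) : S.Conn v u a⁻¹ := by
  obtain ⟨l, rfl, h⟩ := h
  exact ⟨FreeGroup.invRev l, by simp, h.invRev⟩

theorem conn_dart (d : S.Dart) : S.Conn (S.dInit d) (S.dTerm d) (iota (S.dLab d)) :=
  ⟨_, (iota_eq_mk _).symm, run_dart d⟩

theorem Folded.conn_iff [DecidableEq X] (hS : S.Folded) {u v : S.V} {w : FreeGroup X} :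
    S.Conn u v w ↔ S.Run u w.toWord v := by
  constructor
  · rintro ⟨l, rfl, h⟩
    exact hS.run_of_red FreeGroup.reduce.red h
  · exact fun h => ⟨_, FreeGroup.mk_toWord, h⟩

theorem eqvGen_adj_iff {u v : S.V} : Relation.EqvGen S.Adj u v ↔ ∃ w, S.Conn u v w := by
  constructor
  · intro h
    induction h with
    | rel u v h => obtain ⟨d, rfl, rfl⟩ := h; exact ⟨_, conn_dart d⟩
    | refl u => exact ⟨_, conn_one u⟩
    | symm _ _ _ ih => exact ⟨_, ih.choose_spec.inv⟩
    | trans _ _ _ _ _ ih ih' => exact ⟨_, ih.choose_spec.mul ih'.choose_spec⟩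
  · rintro ⟨w, l, -, h⟩
    induction l generalizing u with
    | nil => obtain rfl : u = v := h; exact .refl _
    | cons z l ih =>
      obtain ⟨d, h1, h2, h3⟩ := h
      exact .trans _ _ _ (.rel _ _ ⟨d, h1, rfl⟩) (ih h3)

theorem connected_iff : S.Connected ↔ Nonempty S.V ∧ ∀ u v, ∃ w, S.Conn u v w := by
  simp only [Connected, eqvGen_adj_iff]

theorem run_pathLab {p : List S.Dart} (hp : S.IsPath p) (h : p ≠ []) :
    S.Run (S.dInit (p.head h)) (S.pathLab p) (S.dTerm (p.getLast h)) := by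
  induction p with
  | nil => exact absurd rfl h
  | cons d p ih =>
    cases p with
    | nil => exact ⟨d, rfl, rfl, rfl⟩
    | cons d' p =>
      have hp' := List.isChain_cons_cons.1 hp
      refine ⟨d, rfl, rfl, ?_⟩
      rw [hp'.1]
      exact ih hp'.2 (by simp)

theorem Run.exists_path {u v : S.V} {l : List (X × Bool)} (h : S.Run u l v) :
    ∃ p : List S.Dart, S.pathLab p = l ∧ S.IsPath p ∧
      ∀ h : p ≠ [], S.dInit (p.head h) = u ∧ S.dTerm (p.getLast h) = v := by
  induction l generalizing u with
  | nil => exact ⟨[], rfl, List.isChain_nil, fun h => absurd rfl h⟩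
  | cons z l ih =>
    obtain ⟨d, h1, h2, h3⟩ := h
    obtain ⟨p, hp1, hp2, hp3⟩ := ih h3
    refine ⟨d :: p, by simp [pathLab, h2, ← hp1], ?_, fun _ => ⟨h1, ?_⟩⟩
    · cases p with
      | nil => exact List.isChain_singleton _
      | cons d' p => exact List.isChain_cons_cons.2 ⟨(hp3 (by simp)).1.symm, hp2⟩
    · cases p with
      | nil => obtain rfl : [] = l := hp1; exact h3
      | cons d' p => exact (hp3 (by simp)).2

theorem reads_iff [DecidableEq X] {v : S.V} {w : FreeGroup X} :
    Reads S v w ↔ S.Run v w.toWord v := by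
  constructor
  · rintro ⟨p, -, ⟨hp, hp'⟩, hl⟩
    rw [← hl]
    by_cases h : p = []
    · subst h; rfl
    · have := run_pathLab hp h
      rwa [(hp' h).1, (hp' h).2] at this
  · intro h
    obtain ⟨p, hl, hp, hp'⟩ := h.exists_path
    refine ⟨p, ?_, ⟨hp, hp'⟩, hl⟩
    have := (isReduced_iff_ne_letterInv w.toWord).1 FreeGroup.isReduced_toWord
    rw [← hl, pathLab, List.isChain_map] at this
    refine List.IsChain.imp ?_ this
    rintro d d' h rfl
    exact h rfl

end XDigraph

theorem cyclRed_iff {X : Type} [DecidableEq X] (w : FreeGroup X) :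
    CyclRed w ↔ FreeGroup.IsCyclicallyReduced w.toWord := by
  simp only [CyclRed, reducedList_iff]
  constructor
  · intro h
    refine ⟨h _ (List.IsRotated.refl _), fun a ha b hb => ?_⟩
    generalize w.toWord = l at h ha hb
    obtain ⟨l₁, rfl⟩ := List.mem_getLast?_eq_getLast ha |>.elim fun hn hl =>
      (⟨l.dropLast, by rw [hl, List.dropLast_append_getLast hn]⟩ : ∃ l₁, l = l₁ ++ [a])
    cases l₁ with
    | nil => simp_all
    | cons b' l₂ =>
      obtain rfl : b' = b := by simpa using hb
      have := h ([a] ++ (b' :: l₂)) List.isRotated_append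
      exact (FreeGroup.isReduced_cons_cons.1 this).1
  · intro h l hl
    obtain ⟨n, rfl⟩ := hl
    have h2 := (h.flatten_replicate 2).isReduced
    obtain ⟨u, v, huv, hvu⟩ : ∃ u v, w.toWord = u ++ v ∧ w.toWord.rotate n = v ++ u := by
      refine ⟨w.toWord.take (n % w.toWord.length), w.toWord.drop (n % w.toWord.length), by simp, ?_⟩
      exact List.rotate_eq_drop_append_take_mod
    rw [hvu]
    rw [huv] at h2
    exact h2.infix ⟨u, v, by simp⟩

theorem isCyclicallyReduced_swap {X : Type} [DecidableEq X] {u v : List (X × Bool)}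
    (h : FreeGroup.IsCyclicallyReduced (u ++ v)) : FreeGroup.IsCyclicallyReduced (v ++ u) := by
  have key : ∀ l : List (X × Bool), FreeGroup.IsReduced l → (CyclRed (FreeGroup.mk l) ↔
      FreeGroup.IsCyclicallyReduced l) := by
    intro l hl
    rw [cyclRed_iff, FreeGroup.toWord_mk, hl.reduce_eq]
  have h1 := (key _ h.isReduced).2 h
  have hw : (FreeGroup.mk (u ++ v)).toWord = u ++ v := by
    rw [FreeGroup.toWord_mk, h.isReduced.reduce_eq]
  have hr : FreeGroup.IsReduced (v ++ u) :=
    (reducedList_iff _).1 (h1 _ (by rw [hw]; exact List.isRotated_append))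
  refine (key _ hr).1 fun l hl => h1 l ?_
  rw [hw]
  rw [FreeGroup.toWord_mk, hr.reduce_eq] at hl
  exact List.isRotated_append.trans hl

theorem exists_cyclRed_conj {X : Type} [DecidableEq X] (w : FreeGroup X) :
    ∃ c w₀ : FreeGroup X, CyclRed w₀ ∧ w = c * w₀ * c⁻¹ := by
  have h := FreeGroup.reduceCyclically.isCyclicallyReduced (FreeGroup.isReduced_toWord (x := w))
  refine ⟨FreeGroup.mk (FreeGroup.reduceCyclically.conjugator w.toWord),
    FreeGroup.mk (FreeGroup.reduceCyclically w.toWord), ?_, ?_⟩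
  · rwa [cyclRed_iff, FreeGroup.toWord_mk, h.isReduced.reduce_eq]
  · conv_lhs => rw [← FreeGroup.mk_toWord (x := w),
      ← FreeGroup.reduceCyclically.conj_conjugator_reduceCyclically w.toWord]
    simp

namespace XDigraph

variable {X : Type} {S T : XDigraph X}

theorem Folded.exists_run_of_conn_conj [DecidableEq X] (hS : S.Folded) (c : List (X × Bool)) :
    ∀ (l : List (X × Bool)) (v : S.V), FreeGroup.IsCyclicallyReduced l → FreeGroup.IsReduced c →
      S.Conn v v (FreeGroup.mk c * FreeGroup.mk l * (FreeGroup.mk c)⁻¹) → ∃ v', S.Run v' l v' := by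
  induction c using List.reverseRecOn with
  | nil =>
    intro l v hl _ h
    refine ⟨v, ?_⟩
    have := hS.conn_iff.1 h
    simpa [← FreeGroup.one_eq_mk, hl.isReduced.reduce_eq] using this
  | append_singleton c z ih =>
    intro l v hl hc h
    have hc' : FreeGroup.IsReduced c := hc.infix ⟨[], [z], by simp⟩
    by_cases h0 : l = []
    · subst h0; exact ⟨v, rfl⟩
    by_cases h1 : l.head h0 = letterInv z
    · obtain ⟨l₁, rfl⟩ : ∃ l₁, l = [letterInv z] ++ l₁ :=
        ⟨l.tail, by rw [← h1]; exact (List.cons_head_tail h0).symm⟩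
      obtain ⟨v', h'⟩ := ih (l₁ ++ [letterInv z]) v (isCyclicallyReduced_swap hl) hc' (by
        convert h using 1
        simp only [← FreeGroup.mul_mk, ← iota_eq_mk, iota_letterInv]
        group)
      obtain ⟨m, h2, h3⟩ := run_append.1 h'
      exact ⟨m, run_append.2 ⟨v', h3, h2⟩⟩
    by_cases h2 : l.getLast h0 = z
    · obtain ⟨l₁, rfl⟩ : ∃ l₁, l = l₁ ++ [z] :=
        ⟨l.dropLast, by rw [← h2]; exact (List.dropLast_append_getLast h0).symm⟩
      obtain ⟨v', h'⟩ := ih ([z] ++ l₁) v (isCyclicallyReduced_swap hl) hc' (by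
        convert h using 1
        simp only [← FreeGroup.mul_mk, ← iota_eq_mk]
        group)
      obtain ⟨m, h2, h3⟩ := run_append.1 h'
      exact ⟨m, run_append.2 ⟨v', h3, h2⟩⟩
    have hzl : FreeGroup.IsReduced ([z] ++ l) := by
      rw [isReduced_iff_ne_letterInv, List.isChain_append]
      refine ⟨List.isChain_singleton _, (isReduced_iff_ne_letterInv _).1 hl.isReduced, ?_⟩
      intro x hx y hy
      obtain rfl : z = x := by simpa using hx
      rw [List.head?_eq_some_head h0] at hy
      obtain rfl : l.head h0 = y := by simpa using hy
      exact h1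
    have hlz : FreeGroup.IsReduced (l ++ [letterInv z]) := by
      rw [isReduced_iff_ne_letterInv, List.isChain_append]
      refine ⟨(isReduced_iff_ne_letterInv _).1 hl.isReduced, List.isChain_singleton _, ?_⟩
      intro x hx y hy
      obtain rfl : letterInv z = y := by simpa using hy
      rw [List.getLast?_eq_some_getLast h0] at hx
      obtain rfl : l.getLast h0 = x := by simpa using hx
      intro h3
      exact h2 (by simpa using (congrArg letterInv h3).symm)
    have hi := isReduced_invRev hc
    have h3 : FreeGroup.invRev (c ++ [z]) = [letterInv z] ++ FreeGroup.invRev c := by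
      simp [FreeGroup.invRev, letterInv]
    have h4 : FreeGroup.IsReduced (l ++ FreeGroup.invRev (c ++ [z])) := by
      rw [h3, ← List.append_assoc]
      exact hlz.append_overlap (h3 ▸ hi) (by simp)
    have h5 : FreeGroup.IsReduced (c ++ [z] ++ l) := hc.append_overlap hzl (by simp)
    have h6 := h5.append_overlap h4 h0
    have h7 := hS.conn_iff.1 h
    rw [FreeGroup.inv_mk, FreeGroup.mul_mk, FreeGroup.mul_mk, FreeGroup.toWord_mk,
      h6.reduce_eq] at h7
    obtain ⟨b, h8, h9⟩ := run_append.1 h7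
    obtain ⟨a, h10, h11⟩ := run_append.1 h8
    have h12 := h9.invRev
    rw [FreeGroup.invRev_invRev] at h12
    obtain rfl := hS.run_unique h10 h12
    exact ⟨a, h11⟩

/-- The closed paths of `S` represent exactly the conjugates of elements of `H`. -/
def Represents (S : XDigraph X) (H : Subgroup (FreeGroup X)) : Prop :=
  ∀ w, (∃ v c, S.Conn v v (c * w * c⁻¹)) ↔ ∃ c, c * w * c⁻¹ ∈ H

theorem Folded.exists_reads_iff [DecidableEq X] (hS : S.Folded) {w : FreeGroup X}
    (hw : CyclRed w) : (∃ v, Reads S v w) ↔ ∃ v c, S.Conn v v (c * w * c⁻¹) := by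
  constructor
  · rintro ⟨v, h⟩
    exact ⟨v, 1, by simpa using hS.conn_iff.2 (reads_iff.1 h)⟩
  · rintro ⟨v, c, h⟩
    obtain ⟨v', h'⟩ := hS.exists_run_of_conn_conj c.toWord w.toWord v ((cyclRed_iff w).1 hw)
      FreeGroup.isReduced_toWord (by simpa [FreeGroup.mk_toWord] using h)
    exact ⟨v', reads_iff.2 h'⟩

theorem crep_iff [DecidableEq X] {H : Subgroup (FreeGroup X)} :
    CRep S H ↔ S.Folded ∧ S.Connected ∧ S.NoLeaf ∧ S.Represents H := by
  refine and_congr_right fun hS => and_congr_right fun _ => and_congr_right fun _ => ?_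
  constructor
  · intro h w
    obtain ⟨c₀, w₀, hw₀, rfl⟩ := exists_cyclRed_conj w
    have := h w₀ hw₀
    rw [hS.exists_reads_iff hw₀] at this
    constructor
    · rintro ⟨v, c, h1⟩
      obtain ⟨c', h2⟩ := this.1 ⟨v, c * c₀, by simpa [mul_assoc] using h1⟩
      exact ⟨c' * c₀⁻¹, by simpa [mul_assoc] using h2⟩
    · rintro ⟨c, h1⟩
      obtain ⟨v, c', h2⟩ := this.2 ⟨c * c₀, by simpa [mul_assoc] using h1⟩
      exact ⟨v, c' * c₀⁻¹, by simpa [mul_assoc] using h2⟩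
  · intro h w hw
    rw [hS.exists_reads_iff hw, h w]

/-- A vertex map `f : S → T`, with vertex potentials `t`, sending every edge of `S` to a path of
`T` whose label is the `φ`-image of the label of the edge, corrected by the potentials. -/
def IsMorph (φ : FreeGroup X →* FreeGroup X) (S T : XDigraph X) (f : S.V → T.V)
    (t : S.V → FreeGroup X) : Prop :=
  ∀ e, T.Conn (f (S.init e)) (f (S.term e))
    (t (S.init e) * φ (FreeGroup.of (S.lab e)) * (t (S.term e))⁻¹)

theorem IsMorph.conn_dart {φ : FreeGroup X →* FreeGroup X} {f : S.V → T.V}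
    {t : S.V → FreeGroup X} (h : IsMorph φ S T f t) (d : S.Dart) :
    T.Conn (f (S.dInit d)) (f (S.dTerm d))
      (t (S.dInit d) * φ (iota (S.dLab d)) * (t (S.dTerm d))⁻¹) := by
  obtain ⟨e, b⟩ := d
  cases b
  · have := (h e).inv
    simpa [dInit, dTerm, dLab, iota, mul_assoc] using this
  · simpa [dInit, dTerm, dLab, iota] using h e

theorem IsMorph.conn {φ : FreeGroup X →* FreeGroup X} {f : S.V → T.V} {t : S.V → FreeGroup X}
    (h : IsMorph φ S T f t) {u v : S.V} {w : FreeGroup X} (huv : S.Conn u v w) :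
    T.Conn (f u) (f v) (t u * φ w * (t v)⁻¹) := by
  obtain ⟨l, rfl, hl⟩ := huv
  induction l generalizing u with
  | nil =>
    obtain rfl : u = v := hl
    simpa [← FreeGroup.one_eq_mk] using conn_one (S := T) (f u)
  | cons z l ih =>
    obtain ⟨d, rfl, rfl, h3⟩ := hl
    convert (h.conn_dart d).mul (ih h3) using 1
    rw [show S.dLab d :: l = [S.dLab d] ++ l from rfl, ← FreeGroup.mul_mk, ← iota_eq_mk, map_mul]
    group

theorem IsMorph.connected {φ : FreeGroup X →* FreeGroup X} {f : S.V → T.V}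
    {t : S.V → FreeGroup X} (h : IsMorph φ S T f t) (hf : Function.Surjective f)
    (hS : S.Connected) : T.Connected := by
  rw [connected_iff] at hS ⊢
  obtain ⟨⟨v⟩, hS⟩ := hS
  refine ⟨⟨f v⟩, fun a b => ?_⟩
  obtain ⟨a, rfl⟩ := hf a
  obtain ⟨b, rfl⟩ := hf b
  obtain ⟨w, hw⟩ := hS a b
  exact ⟨_, h.conn hw⟩

theorem isMorph_id (S : XDigraph X) : IsMorph (MonoidHom.id _) S S id fun _ => 1 := by
  intro e
  simpa [dInit, dTerm, dLab, iota] using XDigraph.conn_dart (S := S) (e, true)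

theorem IsMorph.comp {U : XDigraph X} {f : S.V → T.V} {t : S.V → FreeGroup X} {g : T.V → U.V}
    {s : T.V → FreeGroup X} (hf : IsMorph (MonoidHom.id _) S T f t)
    (hg : IsMorph (MonoidHom.id _) T U g s) :
    IsMorph (MonoidHom.id _) S U (g ∘ f) (fun v => s (f v) * t v) := by
  intro e
  simpa [mul_assoc] using hg.conn (hf e)

theorem Represents.of_isMorph {H : Subgroup (FreeGroup X)} (hS : S.Represents H)
    (φ : FreeGroup X ≃* FreeGroup X) {f : S.V → T.V} {t : S.V → FreeGroup X} {g : T.V → S.V}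
    {s : T.V → FreeGroup X} (hf : IsMorph φ.toMonoidHom S T f t)
    (hg : IsMorph φ.symm.toMonoidHom T S g s) : T.Represents (H.map φ.toMonoidHom) := by
  intro w
  constructor
  · rintro ⟨a, c, h⟩
    have h1 := hg.conn h
    obtain ⟨c', h2⟩ := (hS (φ.symm w)).1 ⟨g a, s a * φ.symm c, by
      simpa [mul_assoc] using h1⟩
    exact ⟨φ c', _, h2, by simp⟩
  · rintro ⟨c, k, hk, h⟩
    have hk' : k = φ.symm c * φ.symm w * (φ.symm c)⁻¹ := by
      rw [← map_inv, ← map_mul, ← map_mul, ← h]; simp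
    obtain ⟨v, c', h1⟩ := (hS (φ.symm w)).2 ⟨φ.symm c, hk' ▸ hk⟩
    exact ⟨f v, t v * φ c', by simpa [mul_assoc] using hf.conn h1⟩

end XDigraph

namespace XDigraph

variable {X : Type} {S T : XDigraph X}

theorem conn_edge (e : S.E) : S.Conn (S.init e) (S.term e) (FreeGroup.of (S.lab e)) :=
  ⟨[(S.lab e, true)], rfl, (e, true), rfl, rfl, rfl⟩

/-- The graph obtained from `S` by deleting the vertex `v` and the edge `e₀`, provided that `e₀` is
the only edge at `v`. -/
def prune (S : XDigraph X) (v : S.V) (e₀ : S.E)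
    (h : ∀ d : S.Dart, d.1 ≠ e₀ → S.dTerm d ≠ v) : XDigraph X where
  V := {w // w ≠ v}
  E := {e // e ≠ e₀}
  init e := ⟨S.init e.1, h (e.1, false) e.2⟩
  term e := ⟨S.term e.1, h (e.1, true) e.2⟩
  lab e := S.lab e.1

theorem exists_prune (hS : S.Folded) (hc : S.Connected) (hl : ¬ S.NoLeaf) :
    ∃ T : XDigraph X, T.Folded ∧ T.Connected ∧ Fintype.card T.E < Fintype.card S.E ∧
      (∃ f t, IsMorph (MonoidHom.id _) S T f t) ∧ ∃ g s, IsMorph (MonoidHom.id _) T S g s := by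
  simp only [NoLeaf, not_forall, not_not] at hl
  obtain ⟨v, hv⟩ := hl
  obtain ⟨d, hd⟩ := Finset.card_eq_one.1 hv
  have hd' : ∀ d', S.dTerm d' = v ↔ d' = d := fun d' => by
    have := Finset.ext_iff.1 hd d'
    simpa using this
  have hdv : S.dTerm d = v := (hd' d).2 rfl
  have hu : S.dInit d ≠ v := by
    intro h
    exact dRev_ne d ((hd' (S.dRev d)).1 (by simpa using h))
  have hne : ∀ d' : S.Dart, d'.1 ≠ d.1 → S.dTerm d' ≠ v := by
    intro d' h h'
    exact h (congrArg Prod.fst ((hd' d').1 h'))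
  let T := S.prune v d.1 hne
  let f : S.V → T.V := fun w => if h : w ≠ v then ⟨w, h⟩ else ⟨S.dInit d, hu⟩
  have hf : ∀ w (h : w ≠ v), f w = ⟨w, h⟩ := fun w h => dif_pos h
  have hfv : f v = f (S.dInit d) := by
    rw [hf _ hu]
    exact dif_neg (not_not.2 rfl)
  have hfm : IsMorph (MonoidHom.id _) S T f (fun w => if w = v then iota (S.dLab d) else 1) := by
    intro e
    by_cases he : e = d.1
    · subst he
      obtain ⟨e, b⟩ := d
      cases b
      · simp only [dInit, dTerm, Bool.false_eq_true, ↓reduceIte] at hdv hu hfv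
        have h1 : S.init e = v := hdv
        have h2 : S.term e ≠ v := hu
        simp only [h1, hfv, h2, if_true, if_false]
        simpa [iota, dLab] using conn_one (S := T) (f (S.term e))
      · simp only [dInit, dTerm, ↓reduceIte] at hdv hu hfv
        have h1 : S.term e = v := hdv
        have h2 : S.init e ≠ v := hu
        simp only [h1, hfv, h2, if_true, if_false]
        simpa [iota, dLab] using conn_one (S := T) (f (S.init e))
    · have h1 : S.init e ≠ v := hne (e, false) he
      have h2 : S.term e ≠ v := hne (e, true) he
      simp only [hf _ h1, hf _ h2, h1, h2, if_false]
      simp only [one_mul, MonoidHom.id_apply, inv_one, mul_one]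
      exact conn_edge (S := S.prune v d.1 hne) ⟨e, he⟩
  refine ⟨T, ?_, hfm.connected (fun a => ⟨a.1, hf _ a.2⟩) hc, ?_, ⟨f, _, hfm⟩, Subtype.val,
    fun _ => 1, fun e => ?_⟩
  · rintro w ⟨⟨e, he⟩, b⟩ h ⟨⟨e', he'⟩, b'⟩ h' hl
    have : (e, b) = (e', b') := hS.eq_of_dTerm (S := S) (d := (e, b)) (d' := (e', b')) (by
      have := congrArg Subtype.val (Eq.trans h (Eq.symm h'))
      cases b <;> cases b' <;> exact this) hl
    obtain ⟨rfl, rfl⟩ := Prod.mk.inj this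
    rfl
  · exact Fintype.card_subtype_lt (p := fun e => e ≠ d.1) (x := d.1) (by simp)
  · simp only [one_mul, MonoidHom.id_apply, inv_one, mul_one]
    exact conn_edge (S := S) e.1

theorem exists_noLeaf (n : ℕ) : ∀ S : XDigraph X, Fintype.card S.E = n → S.Folded → S.Connected →
    ∃ T : XDigraph X, T.Folded ∧ T.Connected ∧ T.NoLeaf ∧ Fintype.card T.E ≤ Fintype.card S.E ∧
      (∃ f t, IsMorph (MonoidHom.id _) S T f t) ∧ ∃ g s, IsMorph (MonoidHom.id _) T S g s := by
  induction n using Nat.strong_induction_on with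
  | _ n ih =>
    rintro S rfl hS hc
    by_cases hl : S.NoLeaf
    · exact ⟨S, hS, hc, hl, le_rfl, ⟨_, _, isMorph_id S⟩, _, _, isMorph_id S⟩
    · obtain ⟨T, hT, hTc, hlt, ⟨f, t, hf⟩, g, s, hg⟩ := exists_prune hS hc hl
      obtain ⟨U, hU, hUc, hUl, hle, ⟨f', t', hf'⟩, g', s', hg'⟩ := ih _ hlt T rfl hT hTc
      exact ⟨U, hU, hUc, hUl, hle.trans hlt.le, ⟨_, _, hf.comp hf'⟩, _, _, hg'.comp hg⟩

theorem Represents.of_isMorph_id {H : Subgroup (FreeGroup X)} (hS : S.Represents H)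
    {f : S.V → T.V} {t : S.V → FreeGroup X} {g : T.V → S.V} {s : T.V → FreeGroup X}
    (hf : IsMorph (MonoidHom.id _) S T f t) (hg : IsMorph (MonoidHom.id _) T S g s) :
    T.Represents H := by
  have := hS.of_isMorph (MulEquiv.refl _) hf hg
  rwa [show (MulEquiv.refl (FreeGroup X)).toMonoidHom = MonoidHom.id _ from rfl,
    Subgroup.map_id] at this

/-- The subgraph of the Schreier graph of `H` spanned by a finite set of cosets. -/
noncomputable def schreier [Fintype X] (H : Subgroup (FreeGroup X))
    (s : Finset (FreeGroup X ⧸ H)) : XDigraph X :=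
  letI := Classical.decEq X
  letI := Classical.decEq (FreeGroup X ⧸ H)
  { V := {q // q ∈ s}
    E := {p : {q // q ∈ s} × X // (FreeGroup.of p.2)⁻¹ • p.1.1 ∈ s}
    init := fun e => e.1.1
    term := fun e => ⟨(FreeGroup.of e.1.2)⁻¹ • e.1.1.1, e.2⟩
    lab := fun e => e.1.2 }

section Schreier

variable [Fintype X] {H : Subgroup (FreeGroup X)} {s : Finset (FreeGroup X ⧸ H)}

theorem schreier_dart (d : (schreier H s).Dart) :
    ((schreier H s).dTerm d).1 = (iota ((schreier H s).dLab d))⁻¹ •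
      ((schreier H s).dInit d).1 := by
  obtain ⟨e, b⟩ := d
  cases b
  · simp [dInit, dTerm, dLab, iota, schreier]
  · simp [dInit, dTerm, dLab, iota, schreier]

theorem schreier_folded : (schreier H s).Folded := by
  rintro v ⟨e, b⟩ h ⟨e', b'⟩ h' hl
  have h1 := schreier_dart (H := H) (s := s) (e, b)
  have h2 := schreier_dart (H := H) (s := s) (e', b')
  have h3 : (schreier H s).dTerm (e, b) = (schreier H s).dTerm (e', b') := Eq.trans h (Eq.symm h')
  rw [← h3, ← hl, h1] at h2
  have h4 : (schreier H s).dInit (e, b) = (schreier H s).dInit (e', b') :=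
    Subtype.ext (by simpa using h2)
  obtain ⟨hlab, rfl⟩ := Prod.mk.inj hl
  have h5 : (schreier H s).init e = (schreier H s).init e' := by
    cases b
    · exact h3
    · exact h4
  exact Prod.ext (Subtype.ext (Prod.ext h5 hlab)) rfl

theorem schreier_conn {u v : (schreier H s).V} {w : FreeGroup X} (h : (schreier H s).Conn u v w) :
    v.1 = w⁻¹ • u.1 := by
  obtain ⟨l, rfl, hl⟩ := h
  induction l generalizing u with
  | nil =>
    obtain rfl : u = v := hl
    simp [← FreeGroup.one_eq_mk]
  | cons z l ih =>
    obtain ⟨d, rfl, rfl, h3⟩ := hl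
    rw [ih h3, schreier_dart, show (schreier H s).dLab d :: l = [(schreier H s).dLab d] ++ l from
      rfl, ← FreeGroup.mul_mk, ← iota_eq_mk, mul_inv_rev, mul_smul]

theorem exists_schreier_dart (u v : (schreier H s).V) (z : X × Bool) (h : v.1 = (iota z)⁻¹ • u.1) :
    (schreier H s).Conn u v (iota z) := by
  obtain ⟨x, b⟩ := z
  cases b
  · have h' : u.1 = (FreeGroup.of x)⁻¹ • v.1 := by rw [h]; simp [iota]
    have := (conn_edge (S := schreier H s) ⟨(v, x), h' ▸ u.2⟩).inv
    rwa [show (schreier H s).term ⟨(v, x), h' ▸ u.2⟩ = u from Subtype.ext h'.symm] at this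
  · have h' : v.1 = (FreeGroup.of x)⁻¹ • u.1 := by rw [h]; simp [iota]
    have := conn_edge (S := schreier H s) ⟨(u, x), h' ▸ v.2⟩
    rwa [show (schreier H s).term ⟨(u, x), h' ▸ v.2⟩ = v from Subtype.ext h'.symm] at this

theorem schreier_conn_of_prefixes (l : List (X × Bool)) (u v : (schreier H s).V)
    (hs : ∀ l', l' <+: l → (FreeGroup.mk l')⁻¹ • u.1 ∈ s)
    (h : v.1 = (FreeGroup.mk l)⁻¹ • u.1) : (schreier H s).Conn u v (FreeGroup.mk l) := by
  induction l generalizing u with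
  | nil =>
    obtain rfl : v = u := Subtype.ext (by simpa [← FreeGroup.one_eq_mk] using h)
    exact conn_one _
  | cons z l ih =>
    have hz : ∀ l', (FreeGroup.mk (z :: l') : FreeGroup X) = iota z * FreeGroup.mk l' := by
      intro l'
      rw [iota_eq_mk, FreeGroup.mul_mk]; rfl
    let u' : (schreier H s).V := ⟨(iota z)⁻¹ • u.1, by
      rw [iota_eq_mk]; exact hs [z] ⟨l, rfl⟩⟩
    rw [hz]
    refine (exists_schreier_dart u u' z rfl).mul (ih u' (fun l' hl' => ?_) ?_)
    · have := hs (z :: l') (List.cons_prefix_cons.2 ⟨rfl, hl'⟩)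
      rw [hz, mul_inv_rev, mul_smul] at this
      exact this
    · rw [h, hz, mul_inv_rev, mul_smul]

end Schreier

theorem exists_stallings [Fintype X] [DecidableEq X] (H : Subgroup (FreeGroup X)) (hfg : H.FG) :
    ∃ S : XDigraph X, CRep S H ∧ ∃ v c, ∀ h ∈ H, S.Conn v v (c * h * c⁻¹) := by
  classical
  obtain ⟨B, hB⟩ := hfg
  let s : Finset (FreeGroup X ⧸ H) := insert ((1 : FreeGroup X) : FreeGroup X ⧸ H)
    (B.biUnion fun b => b.toWord.inits.toFinset.image fun l =>
      (((FreeGroup.mk l)⁻¹ : FreeGroup X) : FreeGroup X ⧸ H))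
  let G := schreier H s
  let v₀ : G.V := ⟨((1 : FreeGroup X) : FreeGroup X ⧸ H), Finset.mem_insert_self _ _⟩
  have hmem : ∀ b ∈ B, ∀ l, l <+: b.toWord → (FreeGroup.mk l)⁻¹ • v₀.1 ∈ s := by
    intro b hb l hl
    refine Finset.mem_insert_of_mem (Finset.mem_biUnion.2 ⟨b, hb, Finset.mem_image.2
      ⟨l, by simpa using hl, ?_⟩⟩)
    simp [v₀]
  have hG : G.Connected := by
    have h0 : ∀ u : G.V, ∃ w, G.Conn v₀ u w := by
      rintro ⟨q, hq⟩
      have hq' := hq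
      simp only [s, Finset.mem_insert, Finset.mem_biUnion, Finset.mem_image, List.mem_toFinset,
        List.mem_inits] at hq'
      rcases hq' with rfl | ⟨b, hb, l, hl, rfl⟩
      · exact ⟨1, conn_one _⟩
      · refine ⟨_, schreier_conn_of_prefixes l v₀ _ (fun l' hl' => hmem b hb l' (hl'.trans hl)) ?_⟩
        simp [v₀]
    refine connected_iff.2 ⟨⟨v₀⟩, fun u v => ?_⟩
    exact ⟨_, (h0 u).choose_spec.inv.mul (h0 v).choose_spec⟩
  have hH : ∀ h ∈ H, G.Conn v₀ v₀ h := by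
    intro h hh
    rw [← hB] at hh
    induction hh using Subgroup.closure_induction with
    | mem b hb =>
      rw [← FreeGroup.mk_toWord (x := b)]
      refine schreier_conn_of_prefixes _ _ _ (hmem b hb) ?_
      have hbH : b ∈ H := hB ▸ Subgroup.subset_closure hb
      rw [FreeGroup.mk_toWord]
      simpa [v₀, eq_comm, QuotientGroup.eq] using hbH
    | one => exact conn_one _
    | mul _ _ _ _ h1 h2 => exact h1.mul h2
    | inv _ _ h1 => exact h1.inv
  have hrep : G.Represents H := by
    intro w
    constructor
    · rintro ⟨⟨q, hq⟩, c, h⟩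
      have h1 := schreier_conn h
      obtain ⟨g, rfl⟩ := QuotientGroup.mk_surjective q
      refine ⟨g⁻¹ * c, ?_⟩
      have h2 : ((g : FreeGroup X) : FreeGroup X ⧸ H) =
          (((c * w * c⁻¹)⁻¹ * g : FreeGroup X) : FreeGroup X ⧸ H) := h1
      rw [QuotientGroup.eq] at h2
      have h3 := H.inv_mem h2
      simpa [mul_assoc] using h3
    · rintro ⟨c, h⟩
      exact ⟨v₀, c, hH _ h⟩
  obtain ⟨T, hT, hTc, hTl, -, ⟨f, t, hf⟩, g, s', hg⟩ := exists_noLeaf _ G rfl schreier_folded hG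
  refine ⟨T, crep_iff.2 ⟨hT, hTc, hTl, hrep.of_isMorph_id hf hg⟩, f v₀, t v₀, fun h hh => ?_⟩
  exact hf.conn (hH h hh)

end XDigraph

theorem exists_derangement {α : Type} [Fintype α] (h : Fintype.card α ≠ 1) :
    ∃ δ : Equiv.Perm α, ∀ x, δ x ≠ x := by
  rcases hn : Fintype.card α with _ | _ | n
  · have := Fintype.card_eq_zero_iff.1 hn
    exact ⟨1, fun x => isEmptyElim x⟩
  · exact absurd hn h
  · let e := Fintype.equivFinOfCardEq hn
    refine ⟨(e.trans (finRotate (n + 2))).trans e.symm, fun x hx => ?_⟩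
    simp [Equiv.symm_apply_eq] at hx

theorem exists_derangement_apply_eq {α : Type} [Fintype α] {a b : α} (hab : a ≠ b) :
    ∃ δ : Equiv.Perm α, (∀ x, δ x ≠ x) ∧ δ a = b := by
  classical
  have h : Fintype.card α ≠ 1 := fun h => hab (Fintype.card_le_one_iff.1 h.le a b)
  obtain ⟨δ, hδ⟩ := exists_derangement h
  refine ⟨Equiv.swap (δ a) b * δ * Equiv.swap (δ a) b, fun x hx => ?_, ?_⟩
  · simp only [Equiv.Perm.mul_apply] at hx
    refine hδ (Equiv.swap (δ a) b x) ?_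
    conv_rhs => rw [← hx]
    simp
  · simp [Equiv.swap_apply_of_ne_of_ne (hδ a).symm hab]

namespace XDigraph

variable {X : Type} {S : XDigraph X}

theorem run_map_range {f : ℕ → S.Dart} (hf : ∀ i, S.dInit (f (i + 1)) = S.dTerm (f i)) (n : ℕ) :
    S.Run (S.dInit (f 0)) ((List.range n).map fun i => S.dLab (f i)) (S.dInit (f n)) := by
  induction n with
  | zero => rfl
  | succ n ih =>
    rw [List.range_succ, List.map_append, run_append]
    exact ⟨_, ih, f n, rfl, rfl, (hf n).symm⟩

theorem exists_turn (hS : S.Folded) (hl : S.NoLeaf) {d₁ d₂ : S.Dart} (hd : d₂ ≠ d₁)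
    (ht : S.dTerm d₁ = S.dTerm d₂) :
    ∃ l, FreeGroup.IsCyclicallyReduced l ∧ S.Run (S.dTerm d₂) l (S.dTerm d₂) ∧
      l.head? = some (letterInv (S.dLab d₁)) ∧ l.getLast? = some (S.dLab d₂) := by
  have hδ : ∀ v, ∃ δ : Equiv.Perm {d // S.dTerm d = v}, (∀ x, δ x ≠ x) ∧
      ∀ h₁ h₂, δ ⟨d₂, h₂⟩ = ⟨d₁, h₁⟩ := by
    intro v
    by_cases hv : S.dTerm d₂ = v
    · obtain ⟨δ, h1, h2⟩ := exists_derangement_apply_eq (α := {d // S.dTerm d = v})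
        (a := ⟨d₂, hv⟩) (b := ⟨d₁, ht.trans hv⟩) (fun h => hd (congrArg Subtype.val h))
      exact ⟨δ, h1, fun _ _ => h2⟩
    · obtain ⟨δ, h1⟩ := exists_derangement (α := {d // S.dTerm d = v}) (by
        rw [Fintype.card_subtype]; exact hl v)
      exact ⟨δ, h1, fun _ h => absurd h hv⟩
  choose δ hδ1 hδ2 using hδ
  let τ : Equiv.Perm S.Dart := (Equiv.sigmaFiberEquiv S.dTerm).symm.trans
    ((Equiv.sigmaCongrRight δ).trans (Equiv.sigmaFiberEquiv S.dTerm))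
  have hτ : ∀ d, τ d = (δ (S.dTerm d) ⟨d, rfl⟩).1 := fun d => rfl
  have hτt : ∀ d, S.dTerm (τ d) = S.dTerm d := fun d => (δ (S.dTerm d) ⟨d, rfl⟩).2
  have hτn : ∀ d, τ d ≠ d := fun d h => hδ1 _ _ (Subtype.ext h)
  have hτd : τ d₂ = d₁ := by rw [hτ, hδ2 _ ht rfl]
  let r : Equiv.Perm S.Dart := Function.Involutive.toPerm S.dRev dRev_dRev
  let σ : Equiv.Perm S.Dart := τ.trans r
  have hσ : ∀ d, σ d = S.dRev (τ d) := fun d => rfl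
  have hσi : ∀ d, S.dInit (σ d) = S.dTerm d := fun d => by rw [hσ, dInit_dRev, hτt]
  have hσl : ∀ d, S.dLab (σ d) ≠ letterInv (S.dLab d) := by
    intro d h
    rw [hσ, dLab_dRev] at h
    have h2 := congrArg letterInv h
    simp only [letterInv_letterInv] at h2
    exact hτn d (hS.eq_of_dTerm (hτt d) h2)
  obtain ⟨n, hn⟩ : ∃ n, orderOf σ = n + 1 :=
    Nat.exists_eq_succ_of_ne_zero (orderOf_pos σ).ne'
  have hp : ∀ d, (σ ^ (n + 1)) d = d := fun d => by rw [← hn, pow_orderOf_eq_one]; rfl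
  let f : ℕ → S.Dart := fun i => (σ ^ (i + 1)) d₂
  have hf : ∀ i, f (i + 1) = σ (f i) := fun i => by
    simp only [f]; rw [pow_succ' σ (i + 1)]; rfl
  have hf0 : f 0 = σ d₂ := by simp [f]
  have hfn : f n = d₂ := hp d₂
  have hhead : ((List.range (n + 1)).map fun i => S.dLab (f i)).head? =
      some (letterInv (S.dLab d₁)) := by
    rw [List.range_succ_eq_map]
    simp [hf0, hσ, hτd]
  have hlast : ((List.range (n + 1)).map fun i => S.dLab (f i)).getLast? =
      some (S.dLab d₂) := by
    rw [List.range_succ]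
    simp [hfn]
  refine ⟨(List.range (n + 1)).map fun i => S.dLab (f i), ⟨?_, ?_⟩, ?_, hhead, hlast⟩
  · rw [isReduced_iff_ne_letterInv, List.isChain_map, List.isChain_range]
    intro i _
    rw [hf]
    exact hσl _
  · rw [hhead, hlast]
    rintro a ha b hb h1
    obtain rfl := Option.some.inj ha
    obtain rfl := Option.some.inj hb
    by_contra h2
    refine hd (hS.eq_of_dTerm ht.symm (Prod.ext h1 ?_))
    simpa [letterInv] using h2
  · have := run_map_range (f := f) (fun i => by rw [hf, hσi]) (n + 1)
    rw [hf, hfn, hf0, hσi] at this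
    exact this

theorem exists_cyclRed_through (hS : S.Folded) (hl : S.NoLeaf) (d : S.Dart) :
    ∃ l, FreeGroup.IsCyclicallyReduced l ∧ S.Run (S.dTerm d) l (S.dTerm d) ∧ S.dLab d ∈ l := by
  have h1 := hl (S.dTerm d)
  have h2 : ∃ d₁, d ≠ d₁ ∧ S.dTerm d₁ = S.dTerm d := by
    by_contra! h
    refine h1 (Finset.card_eq_one.2 ⟨d, ?_⟩)
    ext d₁
    simp only [Finset.mem_filter, Finset.mem_univ, true_and, Finset.mem_singleton]
    refine ⟨fun h' => ?_, fun h' => by rw [h']⟩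
    by_contra h''
    exact h d₁ (Ne.symm h'') h'
  obtain ⟨d₁, hd, ht⟩ := h2
  obtain ⟨l, hl, hr, -, hlast⟩ := exists_turn hS hl hd ht
  exact ⟨l, hl, hr, List.mem_of_getLast? hlast⟩

end XDigraph

/-- `Q` is invariant under right multiplication by `K`, changes only at finitely many places under
right multiplication by any group element, and is not constant. -/
structure IsCutFunction {G : Type} [Group G] (K : Subgroup G) (Q : G → ℤ) : Prop where
  mul_mem : ∀ g, ∀ k ∈ K, Q (g * k) = Q g
  finite : ∀ x, {g | Q (g * x) ≠ Q g}.Finite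
  ne : ∃ g₁ g₂, Q g₁ ≠ Q g₂

theorem exists_isCutFunction {G : Type} [Group G] {K L : Subgroup G} (hL : L ≠ ⊥)
    (h : Function.Bijective (Monoid.Coprod.lift K.subtype L.subtype)) :
    ∃ Q, IsCutFunction K Q := by
  classical
  let e := MulEquiv.ofBijective _ h
  let P : G →* Equiv.Perm (G × ℤ) :=
    { toFun := fun u => (Equiv.mulRight u⁻¹).prodCongr (Equiv.refl ℤ)
      map_one' := by ext x <;> simp
      map_mul' := fun a b => by ext x <;> simp [mul_assoc] }
  have hP : ∀ u g n, P u (g, n) = (g * u⁻¹, n) := fun u g n => rfl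
  let τ : Equiv.Perm (G × ℤ) :=
    { toFun := fun p => (p.1, p.2 + if p.1 = 1 then 1 else 0)
      invFun := fun p => (p.1, p.2 - if p.1 = 1 then 1 else 0)
      left_inv := fun p => by simp
      right_inv := fun p => by simp }
  have hτ : ∀ g n, τ (g, n) = (g, n + if g = 1 then 1 else 0) := fun g n => rfl
  have hτ' : ∀ g n, τ⁻¹ (g, n) = (g, n - if g = 1 then 1 else 0) := fun g n => rfl
  let Φ' := Monoid.Coprod.lift (P.comp K.subtype)
    ((MulAut.conj τ).toMonoidHom.comp (P.comp L.subtype))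
  let Φ : G →* Equiv.Perm (G × ℤ) := Φ'.comp e.symm.toMonoidHom
  have hK : ∀ k ∈ K, ∀ g n, Φ k (g, n) = (g * k⁻¹, n) := by
    intro k hk g n
    have : e.symm k = Monoid.Coprod.inl ⟨k, hk⟩ := by
      rw [MulEquiv.symm_apply_eq]; simp [e]
    simp [Φ, Φ', this, hP]
  have hL' : ∀ l ∈ L, ∀ g n, Φ l (g, n) =
      (g * l⁻¹, n + ((if g = l then 1 else 0) - if g = 1 then 1 else 0)) := by
    intro l hl g n
    have : e.symm l = Monoid.Coprod.inr ⟨l, hl⟩ := by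
      rw [MulEquiv.symm_apply_eq]; simp [e]
    simp only [Φ, Φ', MonoidHom.comp_apply, MulEquiv.coe_toMonoidHom, this,
      Monoid.Coprod.lift_apply_inr, MulAut.conj_apply, Subgroup.subtype_apply,
      Equiv.Perm.mul_apply, hτ', hP, hτ, mul_inv_eq_one]
    congr 1
    ring
  have hΦ : ∀ u, ∃ c : G → ℤ, c.support.Finite ∧ ∀ g n, Φ u (g, n) = (g * u⁻¹, n + c g) := by
    intro u
    obtain ⟨u, rfl⟩ := e.surjective u
    induction u using Monoid.Coprod.induction_on with
    | inl k => exact ⟨0, by simp, fun g n => by simpa [e] using hK k k.2 g n⟩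
    | inr l =>
      have hl : e (Monoid.Coprod.inr l) = l := by simp [e]
      rw [hl]
      refine ⟨_, ?_, hL' _ l.2⟩
      refine (Set.toFinite {l.1, 1}).subset fun g hg => ?_
      by_contra h'
      simp only [Set.mem_insert_iff, Set.mem_singleton_iff, not_or] at h'
      simp [h'.1, h'.2] at hg
    | mul a b ha hb =>
      obtain ⟨c, hc, hc'⟩ := ha
      obtain ⟨d, hd, hd'⟩ := hb
      refine ⟨fun g => d g + c (g * (e b)⁻¹), ?_, fun g n => ?_⟩
      · refine (hd.union (hc.preimage (f := fun g => g * (e b)⁻¹)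
          (mul_left_injective _).injOn)).subset fun g hg => ?_
        by_contra h'
        simp only [Set.mem_union, Function.mem_support, Set.mem_preimage, not_or, not_not] at h'
        simp [h'.1, h'.2] at hg
      · rw [map_mul, map_mul, Equiv.Perm.mul_apply, hd', hc']
        simp [mul_assoc, add_assoc]
  have hstep : ∀ u x g n, Φ u (1, 0) = (g, n) → Φ (x * u) (1, 0) = Φ x (g, n) := by
    intro u x g n h'
    rw [map_mul, Equiv.Perm.mul_apply, h']
  have hfst : ∀ u, Φ u⁻¹ (1, 0) = (u, (Φ u⁻¹ (1, 0)).2) := by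
    intro u
    obtain ⟨c, -, hc⟩ := hΦ u⁻¹
    rw [hc]; simp
  refine ⟨fun u => (Φ u⁻¹ (1, 0)).2, ⟨fun g k hk => ?_, fun x => ?_, ?_⟩⟩
  · simp only [mul_inv_rev]
    rw [hstep _ _ _ _ (hfst g), hK _ (K.inv_mem hk)]
  · obtain ⟨c, hc, hc'⟩ := hΦ x⁻¹
    refine hc.subset fun g hg h' => hg ?_
    simp only [mul_inv_rev]
    rw [hstep _ _ _ _ (hfst g), hc', h', add_zero]
  · obtain ⟨⟨l, hl⟩, hne⟩ := Subgroup.ne_bot_iff_exists_ne_one.1 hL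
    have hne : l ≠ 1 := fun h' => hne (Subtype.ext h')
    refine ⟨l, 1, ?_⟩
    rw [hL' _ (L.inv_mem hl), hL' _ (L.inv_mem L.one_mem)]
    simp [hne, eq_comm]

theorem IsCutFunction.map {G : Type} [Group G] {K : Subgroup G} {Q : G → ℤ}
    (hQ : IsCutFunction K Q) (φ : G ≃* G) :
    IsCutFunction (K.map φ.toMonoidHom) fun g => Q (φ.symm g) := by
  refine ⟨?_, fun x => ?_, ?_⟩
  · rintro g _ ⟨k, hk, rfl⟩
    simpa using hQ.mul_mem (φ.symm g) k hk
  · refine ((hQ.finite (φ.symm x)).preimage (f := φ.symm) φ.symm.injective.injOn).subset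
      fun g hg => ?_
    simpa using hg
  · obtain ⟨g₁, g₂, h⟩ := hQ.ne
    exact ⟨φ g₁, φ g₂, by simpa using h⟩

theorem FreeGroup.injective_pow {X : Type} {u : FreeGroup X} (hu : u ≠ 1) :
    Function.Injective fun n : ℕ => u ^ n :=
  injective_pow_iff_not_isOfFinOrder.2 (not_isOfFinOrder_of_isMulTorsionFree hu)

theorem head?_invRev {X : Type} (l : List (X × Bool)) :
    (FreeGroup.invRev l).head? = l.getLast?.map letterInv := by
  simp only [FreeGroup.invRev, List.head?_reverse, List.getLast?_map]
  rfl

theorem isReduced_append_singleton {X : Type} {l : List (X × Bool)} {z : X × Bool} :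
    FreeGroup.IsReduced (l ++ [z]) ↔
      FreeGroup.IsReduced l ∧ ∀ x ∈ l.getLast?, z ≠ letterInv x := by
  rw [isReduced_iff_ne_letterInv, isReduced_iff_ne_letterInv, List.isChain_append]
  simp

theorem prefix_toWord_mk_mul {X : Type} [DecidableEq X] {l : List (X × Bool)} {z : X × Bool}
    (hl : FreeGroup.IsReduced (l ++ [z])) {w : FreeGroup X} (hw : w.toWord.head? = some z) :
    l ++ [z] <+: (FreeGroup.mk l * w).toWord := by
  have hr : FreeGroup.IsReduced (l ++ w.toWord) := by
    have h1 := FreeGroup.isReduced_toWord (x := w)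
    rw [isReduced_iff_ne_letterInv] at h1 hl ⊢
    rw [List.isChain_append] at hl ⊢
    refine ⟨hl.1, h1, ?_⟩
    rw [hw]
    exact hl.2.2
  have h2 : FreeGroup.mk l * w = FreeGroup.mk (l ++ w.toWord) := by
    rw [← FreeGroup.mul_mk, FreeGroup.mk_toWord]
  rw [h2, FreeGroup.toWord_mk, hr.reduce_eq]
  obtain ⟨r, hr⟩ : ∃ r, w.toWord = z :: r := by
    rcases h : w.toWord with _ | ⟨y, r⟩
    · simp [h] at hw
    · simp only [h, List.head?_cons, Option.some.injEq] at hw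
      exact ⟨r, by rw [hw]⟩
  exact ⟨r, by simp [hr]⟩

theorem IsCutFunction.eq_of_forall_pow_mem {X : Type} {K : Subgroup (FreeGroup X)}
    {Q : FreeGroup X → ℤ} (hQ : IsCutFunction K Q) {u c g : FreeGroup X} (hu : u ≠ 1)
    (huK : c * u * c⁻¹ ∈ K) {A : FreeGroup X → Prop} {q : ℤ}
    (hA : {h | A h ∧ Q h ≠ q}.Finite) (hg : ∀ n : ℕ, A (g * u ^ (n + 1))) :
    Q (g * c⁻¹) = q := by
  have hinj : Function.Injective fun n : ℕ => g * u ^ (n + 1) := fun a b h => by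
    have := FreeGroup.injective_pow hu (mul_left_cancel h)
    omega
  have h1 := hA.preimage hinj.injOn
  have h2 := (hQ.finite c⁻¹).preimage (f := fun n : ℕ => g * u ^ (n + 1)) hinj.injOn
  obtain ⟨n, hn⟩ := ((h1.union h2).infinite_compl).nonempty
  simp only [Set.mem_compl_iff, Set.mem_union, Set.mem_preimage, Set.mem_ofPred_eq, hg, true_and,
    not_or, not_not] at hn
  rw [← hn.1, ← hn.2, ← hQ.mul_mem _ _ (K.pow_mem huK (n + 1)), conj_pow]
  simp [mul_assoc]

/-- The function `Q` takes no single value on all but finitely many reduced words starting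
with `l`. -/
def Undecided {X : Type} [DecidableEq X] (Q : FreeGroup X → ℤ) (l : List (X × Bool)) : Prop :=
  ∀ q, ¬ {g : FreeGroup X | l <+: g.toWord ∧ Q g ≠ q}.Finite

section

variable {X : Type} [DecidableEq X] {K : Subgroup (FreeGroup X)} {Q : FreeGroup X → ℤ}

theorem Undecided.isReduced {l : List (X × Bool)} (h : Undecided Q l) :
    FreeGroup.IsReduced l := by
  by_contra hl
  refine h 0 (Set.finite_empty.subset ?_)
  rintro g ⟨hg, -⟩
  exact hl (FreeGroup.isReduced_toWord.infix hg.isInfix)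

theorem IsCutFunction.undecided_nil (hQ : IsCutFunction K Q) {k : FreeGroup X} (hk : k ∈ K)
    (hk1 : k ≠ 1) : Undecided Q [] := by
  intro q hfin
  obtain ⟨g₁, g₂, hne⟩ := hQ.ne
  have key : ∀ g, Q g = q := fun g => by
    simpa using hQ.eq_of_forall_pow_mem (c := 1) (g := g) hk1 (by simpa using hk) hfin
      (by simp)
  exact hne ((key g₁).trans (key g₂).symm)

theorem IsCutFunction.exists_length_lt [Finite X] (hQ : IsCutFunction K Q) :
    ∃ N, ∀ l, Undecided Q l → l.length < N := by
  have hD : (⋃ z : X × Bool, {g | Q (g * iota z) ≠ Q g}).Finite :=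
    Set.finite_iUnion fun z => hQ.finite _
  obtain ⟨N, hN⟩ := (hD.image FreeGroup.norm).bddAbove
  refine ⟨N + 1, fun l hl => ?_⟩
  by_contra hlen
  refine hl (Q (FreeGroup.mk l)) (Set.finite_empty.subset ?_)
  rintro g ⟨⟨r, hr⟩, hg⟩
  refine hg ?_
  have hred : FreeGroup.IsReduced (l ++ r) := hr ▸ FreeGroup.isReduced_toWord
  rw [← FreeGroup.mk_toWord (x := g), ← hr]
  clear hr hg
  induction r using List.reverseRecOn with
  | nil => simp
  | append_singleton r z ih =>
    have h1 : FreeGroup.IsReduced (l ++ r) := hred.infix ⟨[], [z], by simp⟩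
    rw [← ih h1, ← List.append_assoc, ← FreeGroup.mul_mk, ← iota_eq_mk]
    by_contra h2
    have h3 := hN ⟨_, Set.mem_iUnion.2 ⟨z, h2⟩, rfl⟩
    rw [FreeGroup.norm, FreeGroup.toWord_mk, h1.reduce_eq, List.length_append] at h3
    omega

theorem IsCutFunction.exists_undecided_maximal [Finite X] (hQ : IsCutFunction K Q)
    {k : FreeGroup X} (hk : k ∈ K) (hk1 : k ≠ 1) :
    ∃ l, Undecided Q l ∧ ∀ z, ¬ Undecided Q (l ++ [z]) := by
  by_contra! h
  obtain ⟨N, hN⟩ := hQ.exists_length_lt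
  have : ∀ n, ∃ l : List (X × Bool), Undecided Q l ∧ l.length = n := by
    intro n
    induction n with
    | zero => exact ⟨[], hQ.undecided_nil hk hk1, rfl⟩
    | succ n ih =>
      obtain ⟨l, hl, rfl⟩ := ih
      obtain ⟨z, hz⟩ := h l hl
      exact ⟨_, hz, by simp⟩
  obtain ⟨l, hl, rfl⟩ := this N
  exact lt_irrefl _ (hN l hl)

theorem Undecided.exists_ne [Finite X] {l : List (X × Bool)} (hl : Undecided Q l)
    {q : X × Bool → ℤ}
    (hq : ∀ z, {g : FreeGroup X | l ++ [z] <+: g.toWord ∧ Q g ≠ q z}.Finite) :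
    ∃ z₁ z₂, FreeGroup.IsReduced (l ++ [z₁]) ∧ FreeGroup.IsReduced (l ++ [z₂]) ∧ q z₁ ≠ q z₂ := by
  by_contra! h
  obtain ⟨q₀, hq₀⟩ : ∃ q₀, ∀ z, FreeGroup.IsReduced (l ++ [z]) → q z = q₀ := by
    by_cases hz : ∃ z, FreeGroup.IsReduced (l ++ [z])
    · obtain ⟨z, hz⟩ := hz
      exact ⟨q z, fun z' hz' => h _ _ hz' hz⟩
    · exact ⟨0, fun z hz' => absurd ⟨z, hz'⟩ hz⟩
  refine hl q₀ (((Set.finite_singleton (FreeGroup.mk l)).union (Set.finite_iUnion hq)).subset ?_)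
  rintro g ⟨⟨r, hr⟩, hg⟩
  rcases r with _ | ⟨z, r⟩
  · left
    rw [List.append_nil] at hr
    rw [Set.mem_singleton_iff, hr, FreeGroup.mk_toWord]
  · right
    have hp : l ++ [z] <+: g.toWord := ⟨r, by simp [← hr]⟩
    refine Set.mem_iUnion.2 ⟨z, hp, ?_⟩
    rwa [hq₀ z (FreeGroup.isReduced_toWord.infix hp.isInfix)]

end

namespace XDigraph

variable {X : Type} [DecidableEq X] {S : XDigraph X} {K : Subgroup (FreeGroup X)}
  {Q : FreeGroup X → ℤ}

theorem exists_cut_vertex [Finite X] (hQ : IsCutFunction K Q) (hS : S.Folded) (hl : S.NoLeaf)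
    [hE : Nonempty S.E]
    (hK : ∀ v l, FreeGroup.IsCyclicallyReduced l → S.Run v l v →
      ∃ c : FreeGroup X, c * FreeGroup.mk l * c⁻¹ ∈ K) :
    ∃ A B : Set (X × Bool), A.Nonempty ∧ B.Nonempty ∧ (∀ p ∈ A, p ∉ B) ∧
      (∀ d₁ d₂, S.dTerm d₁ = S.dTerm d₂ → S.dLab d₁ ∈ A → S.dLab d₂ ∉ B) ∧
      ∀ p p', p ∉ A → p ∉ B → p' ∉ A → p' ∉ B → p = p' := by
  have hne : ∀ l : List (X × Bool), l ≠ [] → FreeGroup.IsReduced l → FreeGroup.mk l ≠ 1 := by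
    intro l h1 h2 h3
    have := congrArg FreeGroup.toWord h3
    rw [FreeGroup.toWord_mk, h2.reduce_eq] at this
    exact h1 (by simpa using this)
  obtain ⟨k, hk, hk1⟩ : ∃ k ∈ K, k ≠ 1 := by
    obtain ⟨e⟩ := hE
    obtain ⟨w, hw, hr, hmem⟩ := exists_cyclRed_through hS hl (e, true)
    obtain ⟨c, hc⟩ := hK _ _ hw hr
    exact ⟨_, hc, fun h => hne w (List.ne_nil_of_mem hmem) hw.isReduced (by simpa using h)⟩
  obtain ⟨l, hlu, hmax⟩ := hQ.exists_undecided_maximal hk hk1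
  simp only [Undecided, not_forall, not_not] at hmax
  choose q hq using hmax
  obtain ⟨z₁, z₂, hz₁, hz₂, hz⟩ := hlu.exists_ne hq
  refine ⟨{p | FreeGroup.IsReduced (l ++ [letterInv p]) ∧ q (letterInv p) = q z₁},
    {p | FreeGroup.IsReduced (l ++ [letterInv p]) ∧ q (letterInv p) ≠ q z₁},
    ⟨letterInv z₁, by simpa⟩, ⟨letterInv z₂, by simpa using ⟨hz₂, hz.symm⟩⟩,
    fun p hp hp' => hp'.2 hp.2, ?_, ?_⟩
  · rintro d₁ d₂ ht ⟨h1, h1'⟩ ⟨h2, h2'⟩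
    have hd : d₂ ≠ d₁ := by
      rintro rfl
      exact h2' h1'
    obtain ⟨w, hw, hr, hhead, hlast⟩ := exists_turn hS hl hd ht
    obtain ⟨c, hc⟩ := hK _ _ hw hr
    have hw0 : w ≠ [] := by
      rintro rfl
      simp at hhead
    have hu : FreeGroup.mk w ≠ 1 := hne w hw0 hw.isReduced
    have hpow : ∀ n : ℕ, (FreeGroup.mk w ^ (n + 1)).toWord =
        (List.replicate (n + 1) w).flatten := by
      intro n
      rw [FreeGroup.toWord_pow, FreeGroup.toWord_mk, hw.isReduced.reduce_eq,
        (hw.flatten_replicate _).isReduced.reduce_eq]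
    have e1 := hQ.eq_of_forall_pow_mem (g := FreeGroup.mk l) hu hc (hq (letterInv (S.dLab d₁)))
      fun n => prefix_toWord_mk_mul h1 (by
        rw [hpow, List.head?_flatten_replicate (by omega), hhead])
    have e2 := hQ.eq_of_forall_pow_mem (g := FreeGroup.mk l) (c := c) (inv_ne_one.2 hu)
      (by simpa [mul_assoc] using K.inv_mem hc) (hq (letterInv (S.dLab d₂)))
      fun n => prefix_toWord_mk_mul h2 (by
        rw [inv_pow, FreeGroup.toWord_inv, hpow, head?_invRev,
          List.getLast?_flatten_replicate (by omega), hlast]; rfl)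
    exact h2' (e2.symm.trans (e1.trans h1'))
  · have key : ∀ p, ¬ (FreeGroup.IsReduced (l ++ [letterInv p]) ∧ q (letterInv p) = q z₁) →
        ¬ (FreeGroup.IsReduced (l ++ [letterInv p]) ∧ q (letterInv p) ≠ q z₁) →
        p ∈ l.getLast? := by
      intro p h1 h2
      have h3 : ¬ FreeGroup.IsReduced (l ++ [letterInv p]) := by tauto
      rw [isReduced_append_singleton] at h3
      push Not at h3
      obtain ⟨x, hx, h4⟩ := h3 hlu.isReduced
      have := congrArg letterInv h4
      simp only [letterInv_letterInv] at this
      rwa [this]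
    intro p p' h1 h2 h3 h4
    exact Option.mem_unique (key p h1 h2) (key p' h3 h4)

end XDigraph

namespace XDigraph

variable {X : Type} {S : XDigraph X}

/-- The cut `C` with multiplier `m` separates each hyperlink from its complement, up to deleting
`m`, and the hyperlink of some vertex contains `m` and is contained in `C`. -/
structure ReducingCut (S : XDigraph X) (C : Set (X × Bool)) (m : X × Bool) : Prop where
  mem : m ∈ C
  inv_notMem : letterInv m ∉ C
  mem_of_mem : ∀ d₁ d₂, S.dTerm d₁ = S.dTerm d₂ → S.dLab d₁ ∈ C → S.dLab d₁ ≠ m → S.dLab d₂ ∈ C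
  exists_dart : ∃ d₀, S.dLab d₀ = m ∧ ∀ d, S.dTerm d = S.dTerm d₀ → S.dLab d ∈ C

theorem exists_dart_of_forall_lab (hx : ∀ x, ∃ e, S.lab e = x) (p : X × Bool) :
    ∃ d, S.dLab d = p := by
  obtain ⟨e, he⟩ := hx p.1
  exact ⟨(e, p.2), by simp [dLab, he]⟩

theorem exists_reducingCut_of_closed (hc : S.Connected) (hx : ∀ x, ∃ e, S.lab e = x)
    {A : Set (X × Bool)} (hA : A.Nonempty) (hA' : Aᶜ.Nonempty)
    (h : ∀ d₁ d₂, S.dTerm d₁ = S.dTerm d₂ → S.dLab d₁ ∈ A → S.dLab d₂ ∈ A) :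
    ∃ C m, S.ReducingCut C m := by
  by_cases hm : ∃ m ∈ A, letterInv m ∉ A
  · obtain ⟨m, hm, hm'⟩ := hm
    obtain ⟨d₀, hd₀⟩ := exists_dart_of_forall_lab hx m
    exact ⟨A, m, hm, hm', fun d₁ d₂ ht h1 _ => h d₁ d₂ ht h1, d₀, hd₀,
      fun d hd => h d₀ d hd.symm (hd₀ ▸ hm)⟩
  · push Not at hm
    have hiff : ∀ p, letterInv p ∈ A ↔ p ∈ A :=
      fun p => ⟨fun hp => by simpa using hm _ hp, hm p⟩
    have hv : ∀ d, (∃ d', S.dTerm d' = S.dTerm d ∧ S.dLab d' ∈ A) ↔ S.dLab d ∈ A :=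
      fun d => ⟨fun ⟨d', h1, h2⟩ => h _ _ h1 h2, fun h' => ⟨d, rfl, h'⟩⟩
    have key : ∀ u v, Relation.EqvGen S.Adj u v →
        ((∃ d, S.dTerm d = u ∧ S.dLab d ∈ A) ↔ ∃ d, S.dTerm d = v ∧ S.dLab d ∈ A) := by
      intro u v huv
      induction huv with
      | rel u v h =>
        obtain ⟨d, rfl, rfl⟩ := h
        rw [hv, ← dTerm_dRev, hv, dLab_dRev, hiff]
      | refl u => exact Iff.rfl
      | symm _ _ _ ih => exact ih.symm
      | trans _ _ _ _ _ ih₁ ih₂ => exact ih₁.trans ih₂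
    obtain ⟨p, hp⟩ := hA
    obtain ⟨p', hp'⟩ := hA'
    obtain ⟨d, rfl⟩ := exists_dart_of_forall_lab hx p
    obtain ⟨d', rfl⟩ := exists_dart_of_forall_lab hx p'
    exact absurd ((hv d').1 ((key _ _ (hc.2 _ _)).1 ((hv d).2 hp))) hp'

theorem exists_reducingCut_of_inv_mem (hc : S.Connected) (hx : ∀ x, ∃ e, S.lab e = x)
    {A B : Set (X × Bool)} (hA : A.Nonempty)
    (h : ∀ d₁ d₂, S.dTerm d₁ = S.dTerm d₂ → S.dLab d₁ ∈ A → S.dLab d₂ ∉ B)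
    (hAB : ∀ p ∈ A, p ∉ B) {m : X × Bool} (hmA : m ∉ A) (hm : ∀ p, p ∉ A → p ∉ B → p = m)
    (hmB : letterInv m ∈ B) : ∃ C m, S.ReducingCut C m := by
  by_cases hd : ∃ d₀, S.dLab d₀ = m ∧ ∀ d, S.dTerm d = S.dTerm d₀ → S.dLab d ∉ B
  · obtain ⟨d₀, hd₀, hd⟩ := hd
    have key : ∀ p, p ∉ B → p ∈ insert m A := by
      intro p hp
      by_cases hpA : p ∈ A
      · exact Or.inr hpA
      · exact Or.inl (hm p hpA hp)
    refine ⟨insert m A, m, Set.mem_insert _ _, ?_, ?_, d₀, hd₀, fun d h' => key _ (hd d h')⟩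
    · rintro (h' | h')
      · exact letterInv_ne m h'
      · exact hAB _ h' hmB
    · rintro d₁ d₂ ht (h1 | h1) h2
      · exact absurd h1 h2
      · exact key _ (h d₁ d₂ ht h1)
  · push Not at hd
    have h' : ∀ d₁ d₂, S.dTerm d₁ = S.dTerm d₂ → S.dLab d₁ ∈ B → S.dLab d₂ ∉ A :=
      fun d₁ d₂ ht h1 h2 => h d₂ d₁ ht.symm h2 h1
    have key : ∀ p, p ∉ A → p ∈ insert m B := by
      intro p hp
      by_cases hpB : p ∈ B
      · exact Or.inr hpB
      · exact Or.inl (hm p hp hpB)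
    refine exists_reducingCut_of_closed hc hx (A := insert m B) (Set.insert_nonempty _ _) ?_ ?_
    · obtain ⟨p, hp⟩ := hA
      refine ⟨p, ?_⟩
      rintro (rfl | h')
      · exact hmA hp
      · exact hAB _ hp h'
    · rintro d₁ d₂ ht (h1 | h1)
      · obtain ⟨d, hd1, hd2⟩ := hd d₁ h1
        exact key _ (h' d d₂ (hd1.trans ht) hd2)
      · exact key _ (h' d₁ d₂ ht h1)

theorem exists_reducingCut (hc : S.Connected) (hx : ∀ x, ∃ e, S.lab e = x)
    {A B : Set (X × Bool)} (hA : A.Nonempty) (hB : B.Nonempty) (hAB : ∀ p ∈ A, p ∉ B)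
    (h : ∀ d₁ d₂, S.dTerm d₁ = S.dTerm d₂ → S.dLab d₁ ∈ A → S.dLab d₂ ∉ B)
    (huniq : ∀ p p', p ∉ A → p ∉ B → p' ∉ A → p' ∉ B → p = p') :
    ∃ C m, S.ReducingCut C m := by
  by_cases hm : ∃ m, m ∉ A ∧ m ∉ B
  · obtain ⟨m, hmA, hmB⟩ := hm
    by_cases h1 : letterInv m ∈ B
    · exact exists_reducingCut_of_inv_mem hc hx hA h hAB hmA
        (fun p h2 h3 => huniq p m h2 h3 hmA hmB) h1
    · refine exists_reducingCut_of_inv_mem hc hx hB (B := A) (fun d₁ d₂ ht h2 h3 =>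
        h d₂ d₁ ht.symm h3 h2) (fun p hp hp' => hAB p hp' hp) hmB
        (fun p h2 h3 => huniq p m h3 h2 hmA hmB) ?_
      by_contra h2
      exact letterInv_ne m (huniq _ _ h2 h1 hmA hmB)
  · push Not at hm
    refine exists_reducingCut_of_closed hc hx hA ?_ fun d₁ d₂ ht h1 => ?_
    · obtain ⟨p, hp⟩ := hB
      exact ⟨p, fun h' => hAB p h' hp⟩
    · by_contra h2
      exact h d₁ d₂ ht h1 (hm _ h2)

end XDigraph

namespace XDigraph

variable {X : Type}

open Classical in
/-- The multiplier `m` if `p` is a letter of `C` different from `m`, and `1` otherwise. -/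
noncomputable def cutFactor (C : Set (X × Bool)) (m p : X × Bool) : FreeGroup X :=
  if p ∈ C ∧ p ≠ m then iota m else 1

theorem cutFactor_self (C : Set (X × Bool)) (m : X × Bool) : cutFactor C m m = 1 :=
  if_neg fun h => h.2 rfl

theorem cutFactor_of_notMem {C : Set (X × Bool)} {m p : X × Bool} (hp : p ∉ C) :
    cutFactor C m p = 1 :=
  if_neg fun h => hp h.1

theorem map_cutFactor {C : Set (X × Bool)} {m : X × Bool} {f : FreeGroup X →* FreeGroup X}
    (hf : f (iota m) = iota m) (p : X × Bool) : f (cutFactor C m p) = cutFactor C m p := by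
  unfold cutFactor
  split_ifs
  · exact hf
  · exact map_one f

theorem exists_whitehead {C : Set (X × Bool)} {m : X × Bool} (hm : letterInv m ∉ C) :
    ∃ φ : FreeGroup X ≃* FreeGroup X,
      (∀ x, φ (FreeGroup.of x) =
        (cutFactor C m (x, false))⁻¹ * FreeGroup.of x * cutFactor C m (x, true)) ∧
      ∀ x, φ.symm (FreeGroup.of x) =
        cutFactor C m (x, false) * FreeGroup.of x * (cutFactor C m (x, true))⁻¹ := by
  have h1 : ∀ b, cutFactor C m (m.1, b) = 1 := by
    intro b
    by_cases hb : b = m.2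
    · rw [hb]; exact cutFactor_self C m
    · have : (m.1, b) = letterInv m := Prod.ext rfl (by
        rw [letterInv]; cases b <;> cases hm2 : m.2 <;> simp_all)
      rw [this]; exact cutFactor_of_notMem hm
  let f : FreeGroup X →* FreeGroup X := FreeGroup.lift fun x =>
    (cutFactor C m (x, false))⁻¹ * FreeGroup.of x * cutFactor C m (x, true)
  let g : FreeGroup X →* FreeGroup X := FreeGroup.lift fun x =>
    cutFactor C m (x, false) * FreeGroup.of x * (cutFactor C m (x, true))⁻¹
  have hf : ∀ x, f (FreeGroup.of x) = _ := fun x => FreeGroup.lift_apply_of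
  have hg : ∀ x, g (FreeGroup.of x) = _ := fun x => FreeGroup.lift_apply_of
  have hfm : f (iota m) = iota m := by
    unfold iota; split_ifs <;> simp [hf, h1]
  have hgm : g (iota m) = iota m := by
    unfold iota; split_ifs <;> simp [hg, h1]
  refine ⟨MonoidHom.toMulEquiv f g ?_ ?_, hf, hg⟩
  · ext x
    simp [hf, hg, map_cutFactor hgm, mul_assoc]
  · ext x
    simp [hf, hg, map_cutFactor hfm, mul_assoc]

variable {S : XDigraph X} {C : Set (X × Bool)} {m : X × Bool}

open Classical in
/-- The origin of the dart labelled `m` into `v`, or `v` itself if there is none. -/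
noncomputable def source (S : XDigraph X) (m : X × Bool) (v : S.V) : S.V :=
  if h : ∃ d, S.dTerm d = v ∧ S.dLab d = m then S.dInit h.choose else v

theorem source_of_not {v : S.V} (h : ¬ ∃ d, S.dTerm d = v ∧ S.dLab d = m) : S.source m v = v :=
  dif_neg h

theorem Folded.source_dTerm (hS : S.Folded) (d : S.Dart) :
    S.source (S.dLab d) (S.dTerm d) = S.dInit d := by
  have h : ∃ d', S.dTerm d' = S.dTerm d ∧ S.dLab d' = S.dLab d := ⟨d, rfl, rfl⟩
  rw [source, dif_pos h, hS.eq_of_dTerm h.choose_spec.1 h.choose_spec.2]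

open Classical in
/-- The endpoint of the dart `d` after the Whitehead move with cut `C` and multiplier `m`. -/
noncomputable def moved (S : XDigraph X) (C : Set (X × Bool)) (m : X × Bool) (d : S.Dart) : S.V :=
  if S.dLab d ∈ C ∧ S.dLab d ≠ m then S.source m (S.dTerm d) else S.dTerm d

/-- The graph obtained from `S` by the Whitehead move with cut `C` and multiplier `m`. -/
noncomputable abbrev move (S : XDigraph X) (C : Set (X × Bool)) (m : X × Bool) : XDigraph X where
  V := S.V
  E := S.E
  init e := S.moved C m (e, false)
  term e := S.moved C m (e, true)
  lab := S.lab

theorem move_dTerm (d : S.Dart) : (S.move C m).dTerm d = S.moved C m d := by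
  obtain ⟨e, b⟩ := d
  cases b <;> rfl

theorem moved_of_not {d : S.Dart} (h : ¬ (S.dLab d ∈ C ∧ S.dLab d ≠ m)) :
    S.moved C m d = S.dTerm d :=
  if_neg h

theorem moved_of {d : S.Dart} (h : S.dLab d ∈ C ∧ S.dLab d ≠ m) :
    S.moved C m d = S.source m (S.dTerm d) :=
  if_pos h

open Classical in
/-- The vertex potential relating `S` with its Whitehead move. -/
noncomputable def potential (S : XDigraph X) (C : Set (X × Bool)) (m : X × Bool) (v : S.V) :
    FreeGroup X :=
  if (¬ ∃ d, S.dTerm d = v ∧ S.dLab d = m) ∧ ∃ d, S.dTerm d = v ∧ S.dLab d ∈ C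
  then iota m else 1

theorem commute_cutFactor_potential (p : X × Bool) (v : S.V) :
    Commute (cutFactor C m p) (S.potential C m v) := by
  unfold cutFactor potential
  split_ifs
  · exact Commute.refl _
  · exact Commute.one_right _
  · exact Commute.one_left _
  · exact Commute.one_left _

theorem potential_dTerm_self {d : S.Dart} (h : S.dLab d = m) :
    S.potential C m (S.dTerm d) = 1 :=
  if_neg fun h' => h'.1 ⟨d, rfl, h⟩

namespace ReducingCut

theorem notMem_of_dInit (h : S.ReducingCut C m) {d d' : S.Dart} (hd : S.dLab d = m)
    (ht : S.dTerm d' = S.dInit d) (hm : S.dLab d' ≠ m) : S.dLab d' ∉ C := by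
  intro hC
  have := h.mem_of_mem d' (S.dRev d) (by simpa using ht) hC hm
  rw [dLab_dRev, hd] at this
  exact h.inv_notMem this

theorem potential_dInit (h : S.ReducingCut C m) {d : S.Dart} (hd : S.dLab d = m) :
    S.potential C m (S.dInit d) = 1 := by
  refine if_neg ?_
  rintro ⟨h1, d', h2, h3⟩
  exact h.notMem_of_dInit hd h2 (fun h4 => h1 ⟨d', h2, h4⟩) h3

theorem potential_moved (h : S.ReducingCut C m) (hS : S.Folded) (d : S.Dart) :
    S.potential C m (S.moved C m d) = S.potential C m (S.dTerm d) := by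
  by_cases hd : S.dLab d ∈ C ∧ S.dLab d ≠ m
  · rw [moved_of hd]
    by_cases hm : ∃ d', S.dTerm d' = S.dTerm d ∧ S.dLab d' = m
    · obtain ⟨d', h1, rfl⟩ := hm
      rw [← h1, hS.source_dTerm, h.potential_dInit rfl, potential_dTerm_self rfl]
    · rw [source_of_not hm]
  · rw [moved_of_not hd]

theorem rel_moved (h : S.ReducingCut C m) (hS : S.Folded) {R : S.V → S.V → FreeGroup X → Prop}
    (h1 : ∀ v, R v v 1) (hm : ∀ d, S.dLab d = m → R (S.dInit d) (S.dTerm d) (iota m))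
    (d : S.Dart) : R (S.moved C m d) (S.dTerm d)
      (cutFactor C m (S.dLab d) * (S.potential C m (S.dTerm d))⁻¹) := by
  by_cases hd : S.dLab d ∈ C ∧ S.dLab d ≠ m
  · rw [moved_of hd, cutFactor, if_pos hd]
    by_cases hm' : ∃ d', S.dTerm d' = S.dTerm d ∧ S.dLab d' = m
    · obtain ⟨d', h2, rfl⟩ := hm'
      rw [← h2, hS.source_dTerm, potential_dTerm_self rfl, inv_one, mul_one]
      exact hm d' rfl
    · rw [source_of_not hm', potential, if_pos ⟨hm', d, rfl, hd.1⟩, mul_inv_cancel]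
      exact h1 _
  · have h2 : S.potential C m (S.dTerm d) = 1 := by
      by_cases hdm : S.dLab d = m
      · exact potential_dTerm_self hdm
      · refine if_neg ?_
        rintro ⟨h2, d', h3, h4⟩
        exact hd ⟨h.mem_of_mem d' d h3 h4 fun h5 => h2 ⟨d', h3, h5⟩, hdm⟩
    rw [moved_of_not hd, cutFactor, if_neg hd, h2, inv_one, mul_one]
    exact h1 _

theorem conn_move (h : S.ReducingCut C m) {d : S.Dart} (hd : S.dLab d = m) :
    (S.move C m).Conn (S.dInit d) (S.dTerm d) (iota m) := by
  have h1 : (S.move C m).dTerm d = S.dTerm d := by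
    rw [move_dTerm, moved_of_not fun h' => h'.2 hd]
  have h2 : (S.move C m).dInit d = S.dInit d := by
    rw [← dTerm_dRev (S := S.move C m) d, move_dTerm]
    refine (moved_of_not (d := S.dRev d) fun h' => h.inv_notMem ?_).trans (dTerm_dRev d)
    rw [← hd, ← dLab_dRev]
    exact h'.1
  have h3 := conn_dart (S := S.move C m) d
  rwa [h1, h2, show (S.move C m).dLab d = m from hd] at h3

theorem isMorph_move (h : S.ReducingCut C m) (hS : S.Folded) {φ : FreeGroup X →* FreeGroup X}
    (hφ : ∀ x, φ (FreeGroup.of x) =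
      (cutFactor C m (x, false))⁻¹ * FreeGroup.of x * cutFactor C m (x, true)) :
    IsMorph φ S (S.move C m) id (S.potential C m) := by
  intro e
  have key := h.rel_moved hS (R := (S.move C m).Conn) (conn_one (S := S.move C m)) fun d =>
    h.conn_move
  have h1 := (key (e, false)).inv.mul ((conn_edge (S := S.move C m) e).mul (key (e, true)))
  rw [hφ]
  refine cast ?_ h1
  congr 1
  simp only [mul_inv_rev, inv_inv, mul_assoc]
  rfl

theorem isMorph_move_symm (h : S.ReducingCut C m) (hS : S.Folded)
    {φ : FreeGroup X →* FreeGroup X} (hφ : ∀ x, φ (FreeGroup.of x) =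
      cutFactor C m (x, false) * FreeGroup.of x * (cutFactor C m (x, true))⁻¹) :
    IsMorph φ (S.move C m) S id fun v => (S.potential C m v)⁻¹ := by
  intro e
  have key := h.rel_moved hS (R := S.Conn) conn_one fun d hd => hd ▸ conn_dart d
  have h1 := (key (e, false)).mul ((conn_edge (S := S) e).mul (key (e, true)).inv)
  rw [hφ]
  refine cast ?_ h1
  have h2 : S.potential C m (S.moved C m (e, false)) = S.potential C m (S.init e) :=
    h.potential_moved hS (e, false)
  have h3 : S.potential C m (S.moved C m (e, true)) = S.potential C m (S.term e) :=
    h.potential_moved hS (e, true)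
  have h4 := (commute_cutFactor_potential (S := S) (C := C) (m := m) (S.lab e, false)
    (S.init e)).inv_right.eq
  have h5 := (commute_cutFactor_potential (S := S) (C := C) (m := m) (S.lab e, true)
    (S.term e)).inv_left.eq
  congr 1
  change cutFactor C m (S.lab e, false) * (S.potential C m (S.init e))⁻¹ *
    (FreeGroup.of (S.lab e) * (cutFactor C m (S.lab e, true) *
      (S.potential C m (S.term e))⁻¹)⁻¹) = (S.potential C m (S.moved C m (e, false)))⁻¹ *
    (cutFactor C m (S.lab e, false) * FreeGroup.of (S.lab e) *
      (cutFactor C m (S.lab e, true))⁻¹) * ((S.potential C m (S.moved C m (e, true)))⁻¹)⁻¹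
  rw [h2, h3, h4, mul_inv_rev, inv_inv, ← h5]
  simp only [mul_assoc]

theorem folded_move (h : S.ReducingCut C m) (hS : S.Folded) : (S.move C m).Folded := by
  rintro v d hd d' hd' hl
  replace hl : S.dLab d = S.dLab d' := hl
  have ht : S.moved C m d = S.moved C m d' := by
    rw [← move_dTerm, ← move_dTerm]
    exact Eq.trans hd (Eq.symm hd')
  by_cases hp : S.dLab d ∈ C ∧ S.dLab d ≠ m
  · have hp' : S.dLab d' ∈ C ∧ S.dLab d' ≠ m := hl ▸ hp
    rw [moved_of hp, moved_of hp'] at ht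
    by_cases h1 : ∃ d₁, S.dTerm d₁ = S.dTerm d ∧ S.dLab d₁ = m
    · obtain ⟨d₁, h1, hm⟩ := h1
      rw [← h1, ← hm, hS.source_dTerm, hm] at ht
      by_cases h2 : ∃ d₂, S.dTerm d₂ = S.dTerm d' ∧ S.dLab d₂ = m
      · obtain ⟨d₂, h2, hm'⟩ := h2
        rw [← h2, ← hm', hS.source_dTerm] at ht
        obtain rfl := hS.eq_of_dInit ht (hm.trans hm'.symm)
        exact hS.eq_of_dTerm (h1.symm.trans h2) hl
      · rw [source_of_not h2] at ht
        exact absurd hp'.1 (h.notMem_of_dInit hm ht.symm hp'.2)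
    · rw [source_of_not h1] at ht
      by_cases h2 : ∃ d₂, S.dTerm d₂ = S.dTerm d' ∧ S.dLab d₂ = m
      · obtain ⟨d₂, h2, hm'⟩ := h2
        rw [← h2, ← hm', hS.source_dTerm] at ht
        exact absurd hp.1 (h.notMem_of_dInit hm' ht hp.2)
      · rw [source_of_not h2] at ht
        exact hS.eq_of_dTerm ht hl
  · rw [moved_of_not hp, moved_of_not (hl ▸ hp)] at ht
    exact hS.eq_of_dTerm ht hl

theorem not_noLeaf_move (h : S.ReducingCut C m) (hS : S.Folded) : ¬ (S.move C m).NoLeaf := by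
  intro hl
  obtain ⟨d₀, hd₀, hC⟩ := h.exists_dart
  refine hl (S.dTerm d₀) (Finset.card_eq_one.2 ⟨d₀, ?_⟩)
  ext d
  rw [Finset.mem_filter, Finset.mem_singleton, move_dTerm]
  refine ⟨fun hd => ?_, fun hd => ⟨Finset.mem_univ _, ?_⟩⟩
  · replace hd := hd.2
    by_cases hp : S.dLab d ∈ C ∧ S.dLab d ≠ m
    · rw [moved_of hp] at hd
      by_cases h1 : ∃ d₁, S.dTerm d₁ = S.dTerm d ∧ S.dLab d₁ = m
      · obtain ⟨d₁, h1, hm⟩ := h1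
        rw [← h1, ← hm, hS.source_dTerm] at hd
        have := hC (S.dRev d₁) (by simpa using hd)
        rw [dLab_dRev, hm] at this
        exact absurd this h.inv_notMem
      · rw [source_of_not h1] at hd
        exact absurd ⟨d₀, hd.symm, hd₀⟩ h1
    · rw [moved_of_not hp] at hd
      refine hS.eq_of_dTerm hd ?_
      by_contra hne
      exact hp ⟨hC d hd, hd₀ ▸ hne⟩
  · rw [hd]
    exact moved_of_not fun h' => h'.2 hd₀

theorem exists_crep_lt [DecidableEq X] (h : S.ReducingCut C m) {H : Subgroup (FreeGroup X)}
    (hS : CRep S H) : ∃ (φ : FreeGroup X ≃* FreeGroup X) (T : XDigraph X),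
      CRep T (H.map φ.toMonoidHom) ∧ Fintype.card T.E < Fintype.card S.E := by
  obtain ⟨hf, hc, -, hr⟩ := crep_iff.1 hS
  obtain ⟨φ, hφ, hφ'⟩ := exists_whitehead h.inv_notMem
  have h1 := h.isMorph_move hf (φ := φ.toMonoidHom) hφ
  have h2 := h.isMorph_move_symm hf (φ := φ.symm.toMonoidHom) hφ'
  obtain ⟨U, hU, hUc, hlt, ⟨f, t, hft⟩, g, s, hgs⟩ := exists_prune (h.folded_move hf)
    (h1.connected Function.surjective_id hc) (h.not_noLeaf_move hf)
  obtain ⟨T, hT, hTc, hTl, hle, ⟨f', t', hft'⟩, g', s', hgs'⟩ := exists_noLeaf _ U rfl hU hUc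
  exact ⟨φ, T, crep_iff.2 ⟨hT, hTc, hTl, ((hr.of_isMorph φ h1 h2).of_isMorph_id hft
    hgs).of_isMorph_id hft' hgs'⟩, hle.trans_lt hlt⟩

end ReducingCut

end XDigraph

theorem map_closure_symm_apply {G P : Type} [Group G] [Group P] (ψ : G ≃* G) {A : Set G}
    (i : (Subgroup.closure A).map ψ.toMonoidHom →* P) (I : G →* P)
    (h : ∀ a (ha : a ∈ A), I a = i ⟨ψ a, Subgroup.mem_map_of_mem _ (Subgroup.subset_closure ha)⟩)
    (k : (Subgroup.closure A).map ψ.toMonoidHom) : I (ψ.symm k) = i k := by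
  obtain ⟨_, a, ha, rfl⟩ := k
  have key : ∀ a (ha : a ∈ Subgroup.closure A), I a = i ⟨ψ a, Subgroup.mem_map_of_mem _ ha⟩ := by
    intro a ha
    induction ha using Subgroup.closure_induction with
    | mem a ha => exact h a ha
    | one =>
      rw [map_one, ← map_one i]
      exact congrArg i (Subtype.ext (map_one ψ).symm)
    | mul a b ha hb iha ihb =>
      rw [map_mul, iha, ihb, ← map_mul]
      exact congrArg i (Subtype.ext (map_mul ψ a b).symm)
    | inv a ha iha =>
      rw [map_inv, iha, ← map_inv]
      exact congrArg i (Subtype.ext (map_inv ψ a).symm)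
  simpa using key a ha

theorem isProperFreeFactor_map_closure {X : Type} (ψ : FreeGroup X ≃* FreeGroup X) (x : X) :
    IsProperFreeFactor ((Subgroup.closure (FreeGroup.of '' {y | y ≠ x})).map ψ.toMonoidHom) := by
  classical
  let A : Set (FreeGroup X) := FreeGroup.of '' {y | y ≠ x}
  let K := (Subgroup.closure A).map ψ.toMonoidHom
  let L := (Subgroup.closure {FreeGroup.of x}).map ψ.toMonoidHom
  have hK : ∀ y, y ≠ x → ψ (FreeGroup.of y) ∈ K := fun y hy =>
    Subgroup.mem_map_of_mem _ (Subgroup.subset_closure ⟨y, hy, rfl⟩)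
  have hL : ψ (FreeGroup.of x) ∈ L :=
    Subgroup.mem_map_of_mem _ (Subgroup.subset_closure rfl)
  let I : FreeGroup X →* Monoid.Coprod K L := FreeGroup.lift fun y =>
    if hy : y = x then Monoid.Coprod.inr ⟨_, hL⟩ else Monoid.Coprod.inl ⟨_, hK y hy⟩
  have hIx : I (FreeGroup.of x) = Monoid.Coprod.inr ⟨_, hL⟩ := by simp [I]
  have hIy : ∀ y (hy : y ≠ x), I (FreeGroup.of y) = Monoid.Coprod.inl ⟨_, hK y hy⟩ := by
    intro y hy
    simp [I, hy]
  refine ⟨L, fun h => ?_, ?_, fun g => ?_⟩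
  · rw [h, Subgroup.mem_bot] at hL
    exact FreeGroup.of_ne_one x ((map_eq_one_iff ψ ψ.injective).1 hL)
  · refine Function.LeftInverse.injective (g := fun g => I (ψ.symm g)) fun p => ?_
    have : ((I.comp ψ.symm.toMonoidHom).comp (Monoid.Coprod.lift K.subtype L.subtype)) =
        MonoidHom.id _ := by
      refine Monoid.Coprod.hom_ext (MonoidHom.ext fun k => ?_) (MonoidHom.ext fun l => ?_)
      · refine Eq.trans ?_ (map_closure_symm_apply ψ Monoid.Coprod.inl I ?_ k)
        · simp
        · rintro _ ⟨y, hy, rfl⟩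
          exact hIy y hy
      · refine Eq.trans ?_ (map_closure_symm_apply ψ Monoid.Coprod.inr I ?_ l)
        · simp
        · rintro _ rfl
          exact hIx
    exact DFunLike.congr_fun this p
  · refine ⟨I (ψ.symm g), ?_⟩
    have : (Monoid.Coprod.lift K.subtype L.subtype).comp I = ψ.toMonoidHom := by
      ext y
      by_cases hy : y = x
      · subst hy; simp [hIx]
      · simp [hIy y hy]
    exact (DFunLike.congr_fun this (ψ.symm g)).trans (ψ.apply_symm_apply g)

section

variable {X : Type}

theorem XDigraph.Run.mk_mem_closure {S : XDigraph X} {x : X} (hx : ∀ e, S.lab e ≠ x)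
    {u v : S.V} {l : List (X × Bool)} (h : S.Run u l v) :
    FreeGroup.mk l ∈ Subgroup.closure (FreeGroup.of '' {y | y ≠ x}) := by
  have hl : ∀ z ∈ l, z.1 ≠ x := fun z hz => by
    obtain ⟨d, rfl⟩ := h.exists_dart hz
    exact hx d.1
  clear h
  induction l with
  | nil => exact one_mem _
  | cons z l ih =>
    rw [← List.singleton_append, ← FreeGroup.mul_mk]
    refine mul_mem ?_ (ih fun w hw => hl w (List.mem_cons_of_mem _ hw))
    have hz : FreeGroup.of z.1 ∈ Subgroup.closure (FreeGroup.of '' {y | y ≠ x}) :=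
      Subgroup.subset_closure ⟨z.1, hl z List.mem_cons_self, rfl⟩
    obtain ⟨y, _ | _⟩ := z
    · exact inv_mem hz
    · exact hz

variable [DecidableEq X]

theorem CRep.exists_conj_mem {S : XDigraph X} {H : Subgroup (FreeGroup X)} (hS : CRep S H)
    {v : S.V} {l : List (X × Bool)} (hl : FreeGroup.IsCyclicallyReduced l) (h : S.Run v l v) :
    ∃ c, c * FreeGroup.mk l * c⁻¹ ∈ H := by
  have hw : (FreeGroup.mk l).toWord = l := by
    rw [FreeGroup.toWord_mk, hl.isReduced.reduce_eq]
  refine (hS.2.2.2 (FreeGroup.mk l) ((cyclRed_iff _).2 (hw.symm ▸ hl))).1 ⟨v, ?_⟩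
  rw [XDigraph.reads_iff, hw]
  exact h

theorem CRep.exists_run {S : XDigraph X} {H : Subgroup (FreeGroup X)} (hS : CRep S H)
    {l : List (X × Bool)} (hl : FreeGroup.IsCyclicallyReduced l)
    (h : ∃ c, c * FreeGroup.mk l * c⁻¹ ∈ H) : ∃ v, S.Run v l v := by
  have hw : (FreeGroup.mk l).toWord = l := by
    rw [FreeGroup.toWord_mk, hl.isReduced.reduce_eq]
  obtain ⟨v, hv⟩ := (hS.2.2.2 (FreeGroup.mk l) ((cyclRed_iff _).2 (hw.symm ▸ hl))).2 h
  rw [XDigraph.reads_iff, hw] at hv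
  exact ⟨v, hv⟩

/-- Two graphs representing the same conjugacy class of subgroups use the same letters. -/
theorem CRep.lab_ne {S T : XDigraph X} {H : Subgroup (FreeGroup X)} (hS : CRep S H)
    (hT : CRep T H) {x : X} (hx : ∀ e, S.lab e ≠ x) (e : T.E) : T.lab e ≠ x := by
  rintro rfl
  obtain ⟨l, hl, hrun, hmem⟩ := XDigraph.exists_cyclRed_through hT.1 hT.2.2.1 (e, true)
  obtain ⟨v, hv⟩ := hS.exists_run hl (hT.exists_conj_mem hl hrun)
  obtain ⟨d, hd⟩ := hv.exists_dart hmem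
  exact hx d.1 (congrArg Prod.fst hd)

theorem CRep.exists_crep_lt [Fintype X] {S : XDigraph X} {H K : Subgroup (FreeGroup X)}
    (hS : CRep S H) (hK : IsProperFreeFactor K) (φ : FreeGroup X ≃* FreeGroup X)
    (hHK : H ≤ K.map φ.toMonoidHom) (hx : ∀ x, ∃ e, S.lab e = x) :
    ∃ (ψ : FreeGroup X ≃* FreeGroup X) (T : XDigraph X),
      CRep T (H.map ψ.toMonoidHom) ∧ Fintype.card T.E < Fintype.card S.E := by
  obtain ⟨L, hL, hb⟩ := hK
  obtain ⟨Q, hQ⟩ := exists_isCutFunction hL hb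
  have : Nonempty S.E := by
    rcases isEmpty_or_nonempty X with hX | ⟨⟨x⟩⟩
    · exact (hL (Subsingleton.elim _ _)).elim
    · exact ⟨(hx x).choose⟩
  obtain ⟨A, B, hA, hB, hAB, h, huniq⟩ := XDigraph.exists_cut_vertex (hQ.map φ) hS.1 hS.2.2.1
    fun v l hl hrun => (hS.exists_conj_mem hl hrun).imp fun c hc => hHK hc
  obtain ⟨C, m, hC⟩ := XDigraph.exists_reducingCut hS.2.1 hx hA hB hAB h huniq
  exact hC.exists_crep_lt hS

theorem Subgroup.FG.map_of_fg {G G' : Type*} [Group G] [Group G'] {H : Subgroup G} (h : H.FG)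
    (f : G →* G') : (H.map f).FG := by
  classical
  obtain ⟨s, rfl⟩ := h
  exact ⟨s.image f, by rw [Finset.coe_image, ← MonoidHom.map_closure]⟩

theorem exists_minimal_crep [Fintype X] (H : Subgroup (FreeGroup X)) (hfg : H.FG) :
    ∃ (φ : FreeGroup X ≃* FreeGroup X) (S : XDigraph X), CRep S (H.map φ.toMonoidHom) ∧
      ∀ (ψ : FreeGroup X ≃* FreeGroup X) (T : XDigraph X),
        CRep T (H.map ψ.toMonoidHom) → Fintype.card S.E ≤ Fintype.card T.E := by
  classical
  have hex : ∃ (n : ℕ) (φ : FreeGroup X ≃* FreeGroup X) (S : XDigraph X),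
      CRep S (H.map φ.toMonoidHom) ∧ Fintype.card S.E = n := by
    obtain ⟨S, hS, -⟩ :=
      XDigraph.exists_stallings (H.map (MulEquiv.refl _).toMonoidHom) (hfg.map_of_fg _)
    exact ⟨_, _, S, hS, rfl⟩
  obtain ⟨φ, S, hS, hn⟩ := Nat.find_spec hex
  exact ⟨φ, S, hS, fun ψ T hT => hn.trans_le (Nat.find_min' hex ⟨ψ, T, hT, rfl⟩)⟩

end

/-- `H` is contained in a proper free factor of `F(X)` iff every minimal
automorphic image of the (cyclically reduced) Stallings graph of `H` omits some letter
of `X` from its edge labels. -/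
theorem contained_in_proper_free_factor_iff_minimal_images_omit_letter
    {X : Type} [Fintype X] [DecidableEq X]
    (H : Subgroup (FreeGroup X)) (hfg : H.FG) :
    (∃ K : Subgroup (FreeGroup X), IsProperFreeFactor K ∧ H ≤ K) ↔
      ∀ (phi : FreeGroup X ≃* FreeGroup X) (S : XDigraph X),
        CRep S (H.map phi.toMonoidHom) →
        (∀ (psi : FreeGroup X ≃* FreeGroup X) (T : XDigraph X),
          CRep T (H.map psi.toMonoidHom) → Fintype.card S.E ≤ Fintype.card T.E) →
        ∃ x : X, ∀ e : S.E, S.lab e ≠ x := by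
  constructor
  · rintro ⟨K, hK, hHK⟩ φ S hS hmin
    by_contra! hx
    obtain ⟨ψ, T, hT, hlt⟩ := hS.exists_crep_lt hK φ (Subgroup.map_mono hHK) hx
    rw [Subgroup.map_map] at hT
    exact (hmin (φ.trans ψ) T hT).not_gt hlt
  · intro hmin
    obtain ⟨φ, S, hS, hle⟩ := exists_minimal_crep H hfg
    obtain ⟨x, hx⟩ := hmin φ S hS hle
    obtain ⟨T, hT, v, c, hc⟩ := XDigraph.exists_stallings (H.map φ.toMonoidHom) (hfg.map_of_fg _)
    refine ⟨_, isProperFreeFactor_map_closure ((MulAut.conj c).symm.trans φ.symm) x,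
      fun h hh => ⟨c * φ h * c⁻¹, ?_, ?_⟩⟩
    · obtain ⟨l, hl, hrun⟩ := hc (φ h) (Subgroup.mem_map_of_mem _ hh)
      rw [← hl]
      exact hrun.mk_mem_closure (hS.lab_ne hT hx)
    · simp [mul_assoc]
end

section
/- In a free group F(X) of finite rank, every vertex subgroup of a nontrivial, very small, elementary cyclic segment splitting of F(X) is, up to automorphism of F(X), of the form ⟨A, b⟩ or ⟨B⟩, where X = A ⊔ B is a partition of the basis with #A ≥ 1 and #B ≥ 2, and b ∈ ⟨B⟩ is not a proper power. -/
namespace SegmentSplitting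

open FreeGroup (of mk invRev inv_mk mul_mk one_eq_mk IsReduced IsCyclicallyReduced reduce)
open List

/-- The inverse of a letter. -/
def bar {S : Type*} (x : S × Bool) : S × Bool := (x.1, !x.2)

@[simp] theorem bar_bar {S : Type*} (x : S × Bool) : bar (bar x) = x := by simp [bar]

theorem bar_ne {S : Type*} (x : S × Bool) : bar x ≠ x := by
  intro h
  have := congrArg Prod.snd h
  simp [bar] at this

theorem bar_eq_iff {S : Type*} {x y : S × Bool} : bar x = y ↔ x = bar y :=
  ⟨fun h => by rw [← h, bar_bar], fun h => by rw [h, bar_bar]⟩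

theorem mk_bar {S : Type*} (x : S × Bool) : mk [bar x] = (mk [x])⁻¹ := by
  simp [bar, inv_mk, invRev]

theorem mk_cons' {S : Type*} (x : S × Bool) (w : List (S × Bool)) : mk (x :: w) = mk [x] * mk w := by
  simp [mul_mk]

noncomputable section Whitehead

open scoped Classical

variable {S : Type*} (a : S × Bool) (A : Set (S × Bool))

/-- The power of the letter `a` a Whitehead automorphism inserts at the direction `x`. -/
def indPow (x : S × Bool) : FreeGroup S := if x ∈ A then mk [a] else 1

/-- The Whitehead endomorphism with multiplier `a` and cut `A`. -/
def whiteheadHom : FreeGroup S →* FreeGroup S :=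
  FreeGroup.lift fun s => if s = a.1 then of s else
    indPow a A (s, true) * of s * (indPow a A (s, false))⁻¹

/-- The inverse of `whiteheadHom`. -/
def whiteheadInv : FreeGroup S →* FreeGroup S :=
  FreeGroup.lift fun s => if s = a.1 then of s else
    (indPow a A (s, true))⁻¹ * of s * indPow a A (s, false)

theorem mk_singleton (x : S × Bool) : mk [x] = cond x.2 (of x.1) (of x.1)⁻¹ := by
  rcases x with ⟨s, _ | _⟩ <;> simp [of, inv_mk, invRev]

theorem whiteheadHom_self : whiteheadHom a A (mk [a]) = mk [a] := by
  rcases a with ⟨s, _ | _⟩ <;> simp [mk_singleton, whiteheadHom]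

theorem whiteheadInv_self : whiteheadInv a A (mk [a]) = mk [a] := by
  rcases a with ⟨s, _ | _⟩ <;> simp [mk_singleton, whiteheadInv]

theorem whiteheadHom_indPow (x : S × Bool) :
    whiteheadHom a A (indPow a A x) = indPow a A x := by
  unfold indPow; split_ifs <;> simp [whiteheadHom_self]

theorem whiteheadInv_indPow (x : S × Bool) :
    whiteheadInv a A (indPow a A x) = indPow a A x := by
  unfold indPow; split_ifs <;> simp [whiteheadInv_self]

/-- The Whitehead automorphism with multiplier `a` and cut `A`. -/
def whiteheadAut : FreeGroup S ≃* FreeGroup S :=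
  MonoidHom.toMulEquiv (whiteheadHom a A) (whiteheadInv a A)
    (by
      ext s
      by_cases h : s = a.1
      · simp [whiteheadHom, whiteheadInv, h]
      · have : whiteheadHom a A (of s) =
          indPow a A (s, true) * of s * (indPow a A (s, false))⁻¹ := by simp [whiteheadHom, h]
        simp only [MonoidHom.comp_apply, MonoidHom.id_apply, this, map_mul, map_inv,
          whiteheadInv_indPow]
        simp [whiteheadInv, h]; group)
    (by
      ext s
      by_cases h : s = a.1
      · simp [whiteheadHom, whiteheadInv, h]
      · have : whiteheadInv a A (of s) =
          (indPow a A (s, true))⁻¹ * of s * indPow a A (s, false) := by simp [whiteheadInv, h]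
        simp only [MonoidHom.comp_apply, MonoidHom.id_apply, this, map_mul, map_inv,
          whiteheadHom_indPow]
        simp [whiteheadHom, h]; group)

theorem whiteheadAut_apply (x : FreeGroup S) : whiteheadAut a A x = whiteheadHom a A x := rfl

/-- The trace of a letter in the image word: letters `a` and `a⁻¹` disappear. -/
def hatWord (x : S × Bool) : List (S × Bool) := if x = a ∨ x = bar a then [] else [x]

/-- The power of `a` left over between two consecutive letters. -/
def connWord (p n : S × Bool) : List (S × Bool) :=
  if p ∈ A then (if n ∈ A then [] else [bar a]) else (if n ∈ A then [a] else [])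

/-- The cyclic word representing the image of `w` under the Whitehead automorphism, where `z` is
the letter following `w`. -/
def whiteheadWord : List (S × Bool) → S × Bool → List (S × Bool)
  | [], _ => []
  | x :: w, z => hatWord a x ++ connWord a A (bar x) (w.headD z) ++ whiteheadWord w z

theorem mk_connWord (p n : S × Bool) :
    mk (connWord a A p n) = (indPow a A p)⁻¹ * indPow a A n := by
  unfold connWord indPow
  split_ifs <;> simp [mk_bar, ← one_eq_mk, -inv_mk]

theorem whiteheadHom_letter (ha : a ∈ A) (ha' : bar a ∉ A) (x : S × Bool) :
    whiteheadHom a A (mk [x]) =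
      indPow a A x * mk (hatWord a x) * (indPow a A (bar x))⁻¹ := by
  by_cases h1 : x = a
  · subst h1
    simp [whiteheadHom_self, indPow, hatWord, ha, ha', ← one_eq_mk]
  by_cases h2 : x = bar a
  · subst h2
    simp [mk_bar, whiteheadHom_self, indPow, hatWord, ha, ha', ← one_eq_mk, -inv_mk]
  have h3 : x.1 ≠ a.1 := by
    intro h
    rcases x with ⟨s, b⟩
    rcases a with ⟨t, c⟩
    simp only at h
    subst h
    cases b <;> cases c <;> simp_all [bar]
  rw [hatWord, if_neg (by tauto)]
  rcases x with ⟨s, _ | _⟩ <;> simp_all [mk_singleton, whiteheadHom, bar, mul_assoc]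

theorem mk_whiteheadWord (ha : a ∈ A) (ha' : bar a ∉ A) (w : List (S × Bool)) (z : S × Bool) :
    mk (whiteheadWord a A w z) =
      (indPow a A (w.headD z))⁻¹ * whiteheadHom a A (mk w) * indPow a A z := by
  induction w with
  | nil => simp [whiteheadWord, ← one_eq_mk]
  | cons x w ih =>
    rw [whiteheadWord, ← mul_mk, ← mul_mk, ih, mk_cons' x w, map_mul,
      whiteheadHom_letter a A ha ha', mk_connWord]
    simp only [headD_cons]
    group

/-- The indicator of the letter `a`. -/
def ind (x : S × Bool) : ℕ := if x = a then 1 else 0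

/-- The change in length of a Whitehead automorphism, distributed over consecutive letters. -/
def Slack (x n : S × Bool) : Prop :=
  (hatWord a x).length + (connWord a A (bar x) n).length + ind a x ≤
    1 + ind a n

/-- Strict version of `Slack`. -/
def StrictSlack (x n : S × Bool) : Prop :=
  (hatWord a x).length + (connWord a A (bar x) n).length + ind a x <
    1 + ind a n

theorem length_whiteheadWord_lt (w : List (S × Bool)) (y z : S × Bool)
    (h : List.IsChain (Slack a A) (w ++ [y, z])) (hs : StrictSlack a A y z) :
    (whiteheadWord a A (w ++ [y]) z).length + ind a ((w ++ [y]).headD z) <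
      (w ++ [y]).length + ind a z := by
  induction w with
  | nil =>
    unfold StrictSlack at hs
    simp [whiteheadWord]
    omega
  | cons x w ih =>
    have h1 : Slack a A x ((w ++ [y]).headD z) ∧ List.IsChain (Slack a A) (w ++ [y, z]) := by
      cases w <;> simpa [List.isChain_cons_cons] using h
    have h2 := ih h1.2
    have h3 := h1.1
    unfold Slack at h3
    simp only [whiteheadWord, length_append, headD_cons, length_cons, cons_append] at *
    omega

/-- A word is automorphically minimal if no automorphism takes it to a conjugate of a shorter
word. -/
def IsAutMinimal (w : List (S × Bool)) : Prop :=
  ∀ (φ : FreeGroup S ≃* FreeGroup S) (w' : List (S × Bool)),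
    IsConj (φ (mk w)) (mk w') → w.length ≤ w'.length

theorem IsAutMinimal.rotate {w w' : List (S × Bool)} (h : IsAutMinimal w) (hr : w ~r w') :
    IsAutMinimal w' := by
  obtain ⟨n, rfl⟩ := hr
  intro φ v hv
  rw [List.length_rotate]
  refine h φ v (IsConj.trans ?_ hv)
  rw [List.rotate_eq_drop_append_take_mod, ← mul_mk]
  nth_rw 1 [← List.take_append_drop (n % w.length) w]
  rw [← mul_mk, map_mul, map_mul, isConj_iff]
  exact ⟨(φ (mk (w.take (n % w.length))))⁻¹, by group⟩

theorem IsAutMinimal.isCyclicallyReduced {w : List (S × Bool)} (h : IsAutMinimal w) :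
    IsCyclicallyReduced w := by
  have hred : IsReduced w := by
    apply FreeGroup.IsReduced.of_reduce_eq
    have h1 := h (MulEquiv.refl _) (reduce w) (by rw [FreeGroup.reduce.self]; exact IsConj.refl _)
    exact (FreeGroup.Red.sublist FreeGroup.reduce.red).eq_of_length_le h1
  refine ⟨hred, ?_⟩
  intro x hx y hy hxy
  by_contra hne
  have hyx : y = bar x := by
    rcases x with ⟨s, b⟩; rcases y with ⟨t, c⟩
    simp only at hxy hne
    subst hxy
    cases b <;> cases c <;> simp_all [bar]
  clear hne hxy
  subst hyx
  obtain ⟨v, rfl⟩ : ∃ v, w = bar x :: v := by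
    cases w with
    | nil => simp at hy
    | cons z v => exact ⟨v, by rw [List.head?_cons, Option.mem_def, Option.some.injEq] at hy; rw [hy]⟩
  rcases List.eq_nil_or_concat v with rfl | ⟨u, z, rfl⟩
  · rw [List.getLast?_singleton, Option.mem_def, Option.some.injEq] at hx
    exact bar_ne x hx
  rw [List.concat_eq_append] at *
  have hz : z = x := by
    rw [← List.cons_append, List.getLast?_concat, Option.mem_def, Option.some.injEq] at hx
    exact hx
  subst hz
  have := h (MulEquiv.refl _) u (by
    simp only [MulEquiv.refl_apply]
    rw [isConj_iff, mk_cons', ← mul_mk, mk_bar]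
    exact ⟨mk [z], by group⟩)
  simp only [length_cons, length_append] at this
  omega

theorem IsAutMinimal.not_strictSlack {w : List (S × Bool)} (h : IsAutMinimal w)
    (ha : a ∈ A) (ha' : bar a ∉ A) (hc : Cycle.Chain (Slack a A) (w : Cycle (S × Bool)))
    {l : List (S × Bool)} {y z : S × Bool} (hr : w ~r (l ++ [y])) (hz : (l ++ [y]).head? = some z) :
    ¬ StrictSlack a A y z := by
  intro hs
  rw [Cycle.coe_eq_coe.mpr hr] at hc
  have h' := h.rotate hr
  have hchain : List.IsChain (Slack a A) (l ++ [y, z]) := by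
    cases l with
    | nil =>
      have : y = z := by simpa using hz
      subst this
      simpa using hc
    | cons x l =>
      have : x = z := by simpa using hz
      subst this
      rw [List.cons_append, Cycle.chain_coe_cons] at hc
      simpa using hc
  have hlt := length_whiteheadWord_lt a A l y z hchain hs
  have hd : (l ++ [y]).headD z = z := by
    rw [List.headD_eq_head?_getD, hz]; rfl
  have hle := h' (whiteheadAut a A) (whiteheadWord a A (l ++ [y]) z) (by
    rw [mk_whiteheadWord a A ha ha', hd, whiteheadAut_apply, isConj_iff]
    exact ⟨(indPow a A z)⁻¹, by group⟩)
  rw [hd] at hlt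
  omega

theorem chain_of_rotations {R : S × Bool → S × Bool → Prop} {w : List (S × Bool)}
    (h : ∀ l y z, w ~r (l ++ [y]) → (l ++ [y]).head? = some z → R y z) :
    Cycle.Chain R (w : Cycle (S × Bool)) := by
  cases w with
  | nil => exact Cycle.Chain.nil R
  | cons a l =>
    rw [Cycle.chain_coe_cons, List.isChain_iff_forall_rel_of_append_cons_cons]
    intro x n l₁ l₂ he
    rcases List.eq_nil_or_concat l₂ with rfl | ⟨u, z, rfl⟩
    · have he' : (a :: l) ++ [a] = (l₁ ++ [x]) ++ [n] := by simpa using he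
      obtain ⟨h1, h2⟩ := List.append_inj' he' rfl
      have h2 : a = n := by simpa using h2
      refine h l₁ x n (h1 ▸ List.IsRotated.refl _) ?_
      rw [← h1, ← h2]; rfl
    · have he' : (a :: l) ++ [a] = (l₁ ++ x :: n :: u) ++ [z] := by simpa using he
      obtain ⟨h1, -⟩ := List.append_inj' he' rfl
      refine h (n :: u ++ l₁) x n ?_ rfl
      have := List.isRotated_append (l := l₁ ++ [x]) (l' := n :: u)
      rw [h1]
      simpa using this

theorem rotations_of_chain {R : S × Bool → S × Bool → Prop} {w : List (S × Bool)}
    (h : Cycle.Chain R (w : Cycle (S × Bool))) {l : List (S × Bool)} {y z : S × Bool}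
    (hr : w ~r (l ++ [y])) (hz : (l ++ [y]).head? = some z) : R y z := by
  rw [Cycle.coe_eq_coe.mpr hr] at h
  cases l with
  | nil =>
    have : y = z := by simpa using hz
    subst this
    simpa using h
  | cons x l =>
    have : x = z := by simpa using hz
    subst this
    rw [List.cons_append, Cycle.chain_coe_cons] at h
    have : List.IsChain R ((x :: l) ++ [y, x]) := by simpa using h
    exact (List.isChain_pair).1 (this.right_of_append)

theorem exists_rotation_getLast {w : List (S × Bool)} {y : S × Bool} (h : y ∈ w) :
    ∃ l z, w ~r (l ++ [y]) ∧ (l ++ [y]).head? = some z := by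
  obtain ⟨s, t, rfl⟩ := List.append_of_mem h
  refine ⟨t ++ s, ((t ++ s) ++ [y]).head (by simp), ?_, List.head?_eq_some_head _⟩
  have := List.isRotated_append (l := s ++ [y]) (l' := t)
  simpa using this

theorem exists_rotation_head {w : List (S × Bool)} {z : S × Bool} (h : z ∈ w) :
    ∃ l y, w ~r (l ++ [y]) ∧ (l ++ [y]).head? = some z := by
  obtain ⟨s, t, rfl⟩ := List.append_of_mem h
  have := List.isRotated_append (l := s) (l' := z :: t)
  rcases List.eq_nil_or_concat (z :: t ++ s) with h0 | ⟨u, y, h1⟩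
  · simp at h0
  · rw [List.concat_eq_append] at h1
    refine ⟨u, y, by rwa [h1] at this, by rw [← h1]; rfl⟩

variable {a A}

/-- **Whitehead's cut vertex lemma** for an automorphically minimal word: deleting a letter from
its Whitehead graph leaves a connected graph. -/
theorem IsAutMinimal.no_cut {w : List (S × Bool)} (h : IsAutMinimal w) (ha : a ∉ A)
    (ha' : bar a ∉ A) (haw : a ∈ w ∨ bar a ∈ w) {b : S × Bool} (hb : b ∈ A)
    (hbw : b ∈ w ∨ bar b ∈ w)
    (hc : Cycle.Chain (fun x n => bar x ≠ a → n ≠ a → (bar x ∈ A ↔ n ∈ A))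
      (w : Cycle (S × Bool))) : False := by
  have hred := h.isCyclicallyReduced
  have hcan : ∀ l y z, w ~r (l ++ [y]) → (l ++ [y]).head? = some z → z ≠ bar y := by
    intro l y z hr hz hzy
    have h2 := (h.rotate hr).isCyclicallyReduced.2 y (by simp) z hz
    subst hzy
    have := h2 rfl
    simp [bar] at this
  have hslack : Cycle.Chain (Slack a (insert a A)) (w : Cycle (S × Bool)) := by
    refine hc.imp fun x n hxn => ?_
    have hne := bar_ne a
    unfold Slack hatWord connWord ind
    by_cases hx : x = a
    · subst hx
      by_cases hn : n = x <;> simp_all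
    · by_cases hx' : bar x = a
      · have hx2 : x = bar a := bar_eq_iff.1 hx'
        split_ifs <;> simp_all
      · by_cases hn : n = a
        · split_ifs <;> simp_all
        · have := hxn hx' hn
          split_ifs <;> simp_all
  have hc2 : Cycle.Chain (fun x n => (bar x ∈ A ↔ n ∈ A)) (w : Cycle (S × Bool)) := by
    apply chain_of_rotations
    intro l y z hr hz
    have h1 := h.not_strictSlack a (insert a A) (Set.mem_insert _ _)
      (by simp [ha', bar_ne]) hslack hr hz
    have h2 := rotations_of_chain hc hr hz
    have h3 := hcan l y z hr hz
    have hne := bar_ne a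
    by_cases hy : bar y = a
    · have hy2 : y = bar a := bar_eq_iff.1 hy
      rw [hy] at h2 ⊢
      refine iff_of_false ha fun hzA => h1 ?_
      unfold StrictSlack hatWord connWord ind
      subst hy2
      simp_all
    · by_cases hza : z = a
      · subst hza
        refine iff_of_false (fun hyA => h1 ?_) ha
        unfold StrictSlack hatWord connWord ind
        have hyz : y ≠ bar z := fun h => hy (bar_eq_iff.2 h)
        by_cases hyz2 : y = z <;> simp_all
      · exact h2 hy hza
  have hinv : ∀ d, (d ∈ w ∨ bar d ∈ w) → d ∈ A → bar d ∈ A := by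
    intro d hd hdA
    by_contra hdA'
    have hs : Cycle.Chain (Slack d A) (w : Cycle (S × Bool)) := by
      refine hc2.imp fun x n hxn => ?_
      unfold Slack hatWord connWord ind
      by_cases hx : x = d <;> split_ifs <;> simp_all
    rcases hd with hd | hd
    · obtain ⟨l, y, hr, hz⟩ := exists_rotation_head hd
      refine h.not_strictSlack d A hdA hdA' hs hr hz ?_
      have h2 := rotations_of_chain hc2 hr hz
      unfold StrictSlack hatWord connWord ind
      by_cases hx : y = d <;> split_ifs <;> simp_all
    · obtain ⟨l, z, hr, hz⟩ := exists_rotation_getLast hd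
      refine h.not_strictSlack d A hdA hdA' hs hr hz ?_
      have h2 := rotations_of_chain hc2 hr hz
      have := bar_ne d
      unfold StrictSlack hatWord connWord ind
      split_ifs <;> simp_all
  have hc3 : Cycle.Chain (fun x n => (x ∈ A ↔ n ∈ A)) (w : Cycle (S × Bool)) := by
    apply chain_of_rotations
    intro l y z hr hz
    rw [← rotations_of_chain hc2 hr hz]
    have hy : y ∈ w := hr.mem_iff.2 (by simp)
    exact ⟨hinv y (Or.inl hy), fun hyA => by
      simpa using hinv (bar y) (Or.inr (by simpa using hy)) hyA⟩
  have : IsTrans (S × Bool) (fun x n => (x ∈ A ↔ n ∈ A)) := ⟨fun _ _ _ h1 h2 => h1.trans h2⟩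
  rw [Cycle.chain_iff_pairwise] at hc3
  have hb' := hinv b hbw hb
  rcases haw with haw | haw <;> rcases hbw with hbw | hbw
  · exact ha ((hc3 a haw b hbw).2 hb)
  · exact ha ((hc3 a haw _ hbw).2 hb')
  · exact ha' ((hc3 _ haw b hbw).2 hb)
  · exact ha' ((hc3 _ haw _ hbw).2 hb')

theorem norm_mk_of_isReduced {L : List (S × Bool)} (h : IsReduced L) :
    (mk L).norm = L.length := by
  rw [FreeGroup.norm, FreeGroup.toWord_mk, h.reduce_eq]

theorem isReduced_append_flatten {L C : List (S × Bool)} (hC : IsCyclicallyReduced C)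
    (h : IsReduced (L ++ C)) (n : ℕ) : IsReduced (L ++ (List.replicate n C).flatten) := by
  rcases Nat.eq_zero_or_pos n with rfl | hn
  · simpa using h.infix (List.prefix_append L C).isInfix
  · simpa using FreeGroup.IsReduced.append_flatten_replicate_append (L₃ := []) hC
      (by simpa using h) hn.ne'

theorem mk_mul_pow (L C : List (S × Bool)) (n : ℕ) :
    mk L * mk C ^ n = mk (L ++ (List.replicate n C).flatten) := by
  rw [FreeGroup.pow_mk, mul_mk]

theorem norm_mul_pow {L C : List (S × Bool)} (hC : IsCyclicallyReduced C)
    (h : IsReduced (L ++ C)) (n : ℕ) :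
    (mk L * mk C ^ n).norm = L.length + n * C.length := by
  rw [mk_mul_pow, norm_mk_of_isReduced (isReduced_append_flatten hC h n)]
  simp

theorem IsAutMinimal.invRev {w : List (S × Bool)} (h : IsAutMinimal w) :
    IsAutMinimal (invRev w) := by
  intro φ v hv
  rw [FreeGroup.invRev_length, ← FreeGroup.invRev_length (L₁ := v)]
  refine h φ _ ?_
  rw [← inv_mk, map_inv] at hv
  rw [← inv_mk]
  obtain ⟨c, hc⟩ := isConj_iff.1 hv
  exact isConj_iff.2 ⟨c, by rw [← hc]; group⟩

theorem invRev_concat (l : List (S × Bool)) (y : S × Bool) :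
    invRev (l ++ [y]) = bar y :: invRev l := by
  rw [FreeGroup.invRev_append]; rfl

theorem not_isReduced_concat_bar (l : List (S × Bool)) (y : S × Bool) :
    ¬ IsReduced (l ++ [y] ++ [bar y]) := by
  intro h
  have := h.infix (L₁ := [y, bar y]) ⟨l, [], by simp⟩
  simp [bar] at this

theorem isReduced_concat {l : List (S × Bool)} {d x : S × Bool} (h : IsReduced (l ++ [d]))
    (hx : x ≠ bar d) : IsReduced (l ++ [d] ++ [x]) := by
  have h2 : IsReduced [d, x] := by
    rw [FreeGroup.isReduced_cons_cons]
    refine ⟨fun he => ?_, FreeGroup.IsReduced.singleton⟩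
    by_contra hne
    apply hx
    rcases d with ⟨s, b⟩; rcases x with ⟨t, c⟩
    simp only at he
    subst he
    cases b <;> cases c <;> simp_all [bar]
  exact h.append_overlap (L₃ := [x]) h2 (by simp)

/-- `x` or its inverse occurs in `w`. -/
def Occurs (w : List (S × Bool)) (x : S × Bool) : Prop := x ∈ w ∨ bar x ∈ w

theorem Occurs.bar {w : List (S × Bool)} {x : S × Bool} (h : Occurs w x) : Occurs w (bar x) := by
  unfold Occurs at *
  rw [bar_bar]
  exact h.symm

theorem occurs_of_mem_invRev {w : List (S × Bool)} {x : S × Bool} (h : x ∈ invRev w) :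
    Occurs w x := by
  obtain ⟨y, hy, rfl⟩ : ∃ y ∈ w, SegmentSplitting.bar y = x := by
    simpa [FreeGroup.invRev, SegmentSplitting.bar] using h
  exact Or.inr (by simpa using hy)

theorem Occurs.mono {w w' : List (S × Bool)} {x : S × Bool} (h : Occurs w x)
    (hw : ∀ y ∈ w, y ∈ w') : Occurs w' x :=
  h.imp (hw _) (hw _)

theorem finite_occurs (w : List (S × Bool)) : {x | Occurs w x}.Finite := by
  refine ((w ++ w.map SegmentSplitting.bar).toFinset.finite_toSet).subset fun x hx => ?_
  rcases hx with hx | hx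
  · simp [hx]
  · simp only [List.coe_toFinset, Set.mem_ofPred_eq, List.mem_append, List.mem_map]
    exact Or.inr ⟨_, hx, bar_bar x⟩

/-- `E` takes the value `ε` on all sufficiently long reduced words in the letters of `w` that
start with `L`. -/
def Reaches (E : FreeGroup S → ZMod 2) (w L : List (S × Bool)) (ε : ZMod 2) : Prop :=
  ∃ N, ∀ L', IsReduced (L ++ L') → (∀ x ∈ L', Occurs w x) → N ≤ L'.length → E (mk (L ++ L')) = ε

theorem Reaches.eventually {E : FreeGroup S → ZMod 2} {w L : List (S × Bool)} {ε : ZMod 2}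
    {x : S × Bool} (h : Reaches E w (L ++ [x]) ε) {C : List (S × Bool)}
    (hC : IsCyclicallyReduced (x :: C)) (hL : IsReduced (L ++ [x]))
    (hw : ∀ y ∈ x :: C, Occurs w y) :
    ∀ᶠ k : ℕ in Filter.atTop, E (mk L * mk (x :: C) ^ k) = ε := by
  obtain ⟨N, hN⟩ := h
  have hLC : IsReduced (L ++ x :: C) := by
    simpa using hL.append_overlap (L₃ := C) hC.isReduced (by simp)
  filter_upwards [Filter.eventually_ge_atTop (N + 1)] with k hk
  obtain ⟨j, rfl⟩ : ∃ j, k = j + 1 := ⟨k - 1, by omega⟩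
  rw [mk_mul_pow]
  have hred := isReduced_append_flatten hC hLC (j + 1)
  have heq : L ++ (List.replicate (j + 1) (x :: C)).flatten =
      L ++ [x] ++ (C ++ (List.replicate j (x :: C)).flatten) := by
    simp [List.replicate_succ]
  rw [heq] at hred ⊢
  refine hN _ hred ?_ ?_
  · intro y hy
    rw [List.mem_append] at hy
    rcases hy with hy | hy
    · exact hw y (List.mem_cons_of_mem _ hy)
    · rw [List.mem_flatten] at hy
      obtain ⟨D, hD, hy⟩ := hy
      rw [List.eq_of_mem_replicate hD] at hy
      exact hw y hy
  · simp only [length_append, length_flatten, map_replicate, length_cons, sum_replicate,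
      smul_eq_mul]
    nlinarith

/-- Almost invariance of `E` under right translation. -/
def AlmostInvariant {G : Type*} [Group G] (E : G → ZMod 2) : Prop :=
  ∀ g, {y | E (y * g) ≠ E y}.Finite

/-- The values of `E` at the two ends of the coset `g⟨u⟩` agree. -/
def EvenAt {G : Type*} [Group G] (E : G → ZMod 2) (u g : G) : Prop :=
  ∀ᶠ k : ℕ in Filter.atTop, E (g * u ^ k) = E (g * (u ^ k)⁻¹)

/-- The values of `E` at the two ends of the coset `g⟨u⟩` differ. -/
def OddAt {G : Type*} [Group G] (E : G → ZMod 2) (u g : G) : Prop :=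
  ∀ᶠ k : ℕ in Filter.atTop, E (g * u ^ k) ≠ E (g * (u ^ k)⁻¹)

theorem AlmostInvariant.eventually_eq {G : Type*} [Group G] {E : G → ZMod 2}
    (hE : AlmostInvariant E) (v : G) {f : ℕ → G} (hf : Function.Injective f) :
    ∀ᶠ k : ℕ in Filter.atTop, E (f k * v) = E (f k) := by
  have := (hE v).preimage (f := f) hf.injOn
  have h2 := this.eventually_cofinite_notMem
  rw [Nat.cofinite_eq_atTop] at h2
  filter_upwards [h2] with k hk
  by_contra h
  exact hk h

theorem EvenAt.conj {G : Type*} [Group G] {E : G → ZMod 2}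
    (hE : AlmostInvariant E) {u : G} (hu : Function.Injective fun k : ℕ => u ^ k) {y v : G}
    (h : EvenAt E u (y * v⁻¹)) : EvenAt E (v⁻¹ * u * v) y := by
  have h1 := hE.eventually_eq v (f := fun k : ℕ => y * v⁻¹ * u ^ k)
    (fun i j hij => hu (mul_left_cancel hij))
  have h2 := hE.eventually_eq v (f := fun k : ℕ => y * v⁻¹ * (u ^ k)⁻¹)
    (fun i j hij => hu (inv_injective (mul_left_cancel hij)))
  filter_upwards [h, h1, h2] with k hk hk1 hk2
  have : (v⁻¹ * u * v) ^ k = v⁻¹ * u ^ k * v := by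
    have := conj_pow (a := v⁻¹) (b := u) (i := k)
    simpa using this
  rw [this]
  have e1 : y * (v⁻¹ * u ^ k * v) = y * v⁻¹ * u ^ k * v := by group
  have e2 : y * (v⁻¹ * u ^ k * v)⁻¹ = y * v⁻¹ * (u ^ k)⁻¹ * v := by group
  rw [e1, e2, hk1, hk2, hk]

section Core

variable {w : List (S × Bool)} (hm : IsAutMinimal w) {E : FreeGroup S → ZMod 2}
  (hE : AlmostInvariant E) (heven : ∀ g, g ∉ Subgroup.zpowers (mk w) → EvenAt E (mk w) g)

include hm in
theorem IsAutMinimal.pow_injective (hw : w ≠ []) :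
    Function.Injective fun k : ℕ => mk w ^ k := by
  intro i j hij
  have h := fun n => norm_mul_pow (L := []) hm.isCyclicallyReduced hm.isCyclicallyReduced.1 n
  have h1 := h i
  have h2 := h j
  simp only at hij
  rw [hij, h2] at h1
  simpa [hw] using h1.symm

include hm in
theorem IsAutMinimal.eq_of_mk_mul_zpow {s t L : List (S × Bool)} (hw : w = s ++ t) (ht : t ≠ [])
    {z : S × Bool} (hz : (t ++ s).head? = some z) (hLz : IsReduced (L ++ [z]))
    {y : S × Bool} (hy : (t ++ s).getLast? = some y) (hLy : IsReduced (L ++ [bar y]))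
    {n : ℤ} (h : mk L * mk (t ++ s) ^ n = mk s) : L = s := by
  have hr : w ~r (t ++ s) := hw ▸ List.isRotated_append
  have hcyc : ∀ C : List (S × Bool), IsAutMinimal C → C.length = w.length →
      ∀ x, C.head? = some x → IsReduced (L ++ [x]) → ∀ m : ℕ, mk L * mk C ^ m = mk s → L = s := by
    intro C hC hlen x hx hLx m he
    obtain ⟨C', rfl⟩ : ∃ C', C = x :: C' := by
      cases C with
      | nil => simp at hx
      | cons u C' => exact ⟨C', by simpa using hx⟩
    have hLC : IsReduced (L ++ x :: C') := by
      simpa using hLx.append_overlap (L₃ := C') hC.isCyclicallyReduced.isReduced (by simp)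
    have hs : IsReduced s := hm.isCyclicallyReduced.isReduced.infix ⟨[], t, by simp [hw]⟩
    have hn := norm_mul_pow hC.isCyclicallyReduced hLC m
    rw [he, norm_mk_of_isReduced hs, hlen] at hn
    have hlt : s.length < w.length := by
      rw [hw, List.length_append]
      have := List.length_pos_of_ne_nil ht
      omega
    have hm0 : m = 0 := by
      by_contra hne
      have : 1 ≤ m := by omega
      nlinarith
    subst hm0
    have hL : IsReduced L := hLx.infix (List.prefix_append L [x]).isInfix
    have := congrArg FreeGroup.toWord he
    simpa [FreeGroup.toWord_mk, hL.reduce_eq, hs.reduce_eq] using this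
  obtain ⟨m, rfl | rfl⟩ := n.eq_nat_or_neg
  · exact hcyc _ (hm.rotate hr) hr.perm.length_eq.symm z hz hLz m (by simpa using h)
  · refine hcyc (FreeGroup.invRev (t ++ s)) (hm.rotate hr).invRev
      (by rw [FreeGroup.invRev_length, hr.perm.length_eq]) (bar y) ?_ hLy m ?_
    · obtain ⟨l, hl⟩ := List.getLast?_eq_some_iff.1 hy
      rw [hl, invRev_concat]; rfl
    · rw [← inv_mk, inv_pow, ← zpow_natCast, ← zpow_neg]; exact h

theorem exists_split_of_isRotated {w w' : List (S × Bool)} (hr : w ~r w') (hw : w ≠ []) :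
    ∃ s t, w = s ++ t ∧ w' = t ++ s ∧ t ≠ [] := by
  obtain ⟨n, hn⟩ := hr
  have hlen : n % w.length < w.length := Nat.mod_lt _ (List.length_pos_of_ne_nil hw)
  refine ⟨w.take (n % w.length), w.drop (n % w.length), by simp, ?_, ?_⟩
  · rw [← hn, ← List.rotate_mod, List.rotate_eq_drop_append_take hlen.le]
  · simpa using hlen

include hm in
theorem Reaches.eventually_pow {w' L : List (S × Bool)} {y z : S × Bool} {ε₁ ε₂ : ZMod 2}
    (hr : w ~r w') (hz : w'.head? = some z) (hy : w'.getLast? = some y)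
    (hLz : IsReduced (L ++ [z])) (hLy : IsReduced (L ++ [bar y]))
    (h₁ : Reaches E w (L ++ [z]) ε₁) (h₂ : Reaches E w (L ++ [bar y]) ε₂) :
    ∀ᶠ k : ℕ in Filter.atTop, E (mk L * mk w' ^ k) = ε₁ ∧ E (mk L * (mk w' ^ k)⁻¹) = ε₂ := by
  refine Filter.Eventually.and ?_ ?_
  · obtain ⟨C, rfl⟩ : ∃ C, w' = z :: C := by
      rw [List.head?_eq_some_iff] at hz; exact hz
    exact h₁.eventually (hm.rotate hr).isCyclicallyReduced hLz
      fun x hx => Or.inl (hr.mem_iff.2 hx)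
  · obtain ⟨l, rfl⟩ := List.getLast?_eq_some_iff.1 hy
    have hcr := (hm.rotate hr).invRev.isCyclicallyReduced
    have hocc : ∀ x ∈ FreeGroup.invRev (l ++ [y]), Occurs w x := fun x hx =>
      (occurs_of_mem_invRev hx).mono fun y hy => hr.mem_iff.2 hy
    simp_rw [← inv_pow, inv_mk]
    rw [invRev_concat] at hcr hocc ⊢
    exact h₂.eventually hcr hLy hocc

include hm hE heven in
theorem Reaches.eq_of_line {L s t : List (S × Bool)} {y z : S × Bool} (hw : w = s ++ t)
    (ht : t ≠ []) (hz : (t ++ s).head? = some z) (hy : (t ++ s).getLast? = some y)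
    (hLz : IsReduced (L ++ [z])) (hLy : IsReduced (L ++ [bar y]))
    (hne : L ≠ [] ∨ s ≠ []) {ε₁ ε₂ : ZMod 2} (h₁ : Reaches E w (L ++ [z]) ε₁)
    (h₂ : Reaches E w (L ++ [bar y]) ε₂) : ε₁ = ε₂ := by
  have hw0 : w ≠ [] := by simp [hw, ht]
  have hconj : mk (t ++ s) = (mk s)⁻¹ * mk w * mk s := by
    rw [hw, ← mul_mk, ← mul_mk]; group
  have hnot : mk L * (mk s)⁻¹ ∉ Subgroup.zpowers (mk w) := by
    rintro ⟨n, hn⟩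
    simp only at hn
    have hpow : mk (t ++ s) ^ n = (mk s)⁻¹ * mk w ^ n * mk s := by
      rw [hconj]
      have := conj_zpow (a := (mk s)⁻¹) (b := mk w) (i := n)
      simpa using this
    have hLs : L = s := by
      refine hm.eq_of_mk_mul_zpow hw ht hz hLz hy hLy (n := -n) ?_
      rw [zpow_neg, hpow, hn]; group
    subst hLs
    rcases List.eq_nil_or_concat' L with rfl | ⟨L', d, rfl⟩
    · simp at hne
    · have : d = y := by simpa using hy
      subst this
      exact not_isReduced_concat_bar _ _ hLy
  have hev := (heven _ hnot).conj hE (hm.pow_injective hw0)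
  rw [← hconj] at hev
  obtain ⟨k, hk, hk1, hk2⟩ := (hev.and (Reaches.eventually_pow hm
    (hw ▸ List.isRotated_append) hz hy hLz hLy h₁ h₂)).exists
  rw [← hk1, hk, hk2]

theorem exists_reaches_of_norm {N : ℕ}
    (hN : ∀ y : FreeGroup S, N ≤ y.norm → ∀ x, Occurs w x → E (y * mk [x]) = E y)
    {L : List (S × Bool)} (hL : N ≤ L.length) : Reaches E w L (E (mk L)) := by
  refine ⟨0, fun L' => ?_⟩
  induction L' using List.reverseRecOn with
  | nil => simp
  | append_singleton L' x ih =>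
    intro hred hocc _
    have hred' : IsReduced (L ++ L') := by
      rw [← List.append_assoc] at hred
      exact hred.infix (List.prefix_append _ _).isInfix
    rw [← List.append_assoc, ← mul_mk, hN _ _ _ (hocc x (by simp))]
    · exact ih hred' (fun y hy => hocc y (by simp [hy])) (Nat.zero_le _)
    · rw [norm_mk_of_isReduced hred']
      simp; omega

include hm hE heven in
theorem Reaches.of_branches {l : List (S × Bool)} {d : S × Bool} (hL : IsReduced (l ++ [d]))
    (hd : Occurs w d)
    (h : ∀ c, Occurs w c → c ≠ bar d → ∃ ε, Reaches E w (l ++ [d] ++ [c]) ε) :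
    ∃ ε, Reaches E w (l ++ [d]) ε := by
  have hw0 : w ≠ [] := by
    rintro rfl
    simp [Occurs] at hd
  have h' : ∀ c, ∃ ε, Occurs w c → c ≠ bar d → Reaches E w (l ++ [d] ++ [c]) ε := by
    intro c
    by_cases hc : Occurs w c ∧ c ≠ bar d
    · obtain ⟨ε, hε⟩ := h c hc.1 hc.2
      exact ⟨ε, fun _ _ => hε⟩
    · exact ⟨0, fun h1 h2 => absurd ⟨h1, h2⟩ hc⟩
  choose ε hε using h'
  have hconst : ∀ c, Occurs w c → c ≠ bar d → ε c = ε d := by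
    intro c hc hcd
    by_contra hne
    refine hm.no_cut (a := bar d) (A := {c | Occurs w c ∧ c ≠ bar d ∧ ε c ≠ ε d}) (b := c)
      (by simp) (by simp) hd.bar ⟨hc, hcd, hne⟩ hc ?_
    refine chain_of_rotations fun l' y z hr hz hy1 hz1 => ?_
    obtain ⟨s, t, hw, hw', ht⟩ := exists_split_of_isRotated hr hw0
    have hylast : (t ++ s).getLast? = some y := by rw [← hw']; simp
    have hzocc : Occurs w z := Or.inl (hr.mem_iff.2 (List.mem_of_head? hz))
    have hyocc : Occurs w (bar y) := Occurs.bar (Or.inl (hr.mem_iff.2 (by simp)))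
    have := Reaches.eq_of_line hm hE heven hw ht (hw' ▸ hz) hylast (isReduced_concat hL hz1)
      (isReduced_concat hL hy1) (Or.inl (by simp)) (hε z hzocc hz1) (hε _ hyocc hy1)
    simp [hzocc, hyocc, hy1, hz1, this]
  have h' : ∀ c, ∃ N, Occurs w c → c ≠ bar d → ∀ L', IsReduced (l ++ [d] ++ [c] ++ L') →
      (∀ x ∈ L', Occurs w x) → N ≤ L'.length → E (mk (l ++ [d] ++ [c] ++ L')) = ε d := by
    intro c
    by_cases hc : Occurs w c ∧ c ≠ bar d
    · obtain ⟨N, hN⟩ := hε c hc.1 hc.2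
      exact ⟨N, fun _ _ => hconst c hc.1 hc.2 ▸ hN⟩
    · exact ⟨0, fun h1 h2 => absurd ⟨h1, h2⟩ hc⟩
  choose N hN using h'
  obtain ⟨M, hM⟩ := ((finite_occurs w).image N).bddAbove
  refine ⟨ε d, M + 1, fun L' hred hocc hlen => ?_⟩
  cases L' with
  | nil => simp at hlen
  | cons c L' =>
    have hc : Occurs w c := hocc c (by simp)
    have hcd : c ≠ bar d := by
      rintro rfl
      exact not_isReduced_concat_bar l d (hred.infix ⟨[], L', by simp⟩)
    have := hN c hc hcd L' (by simpa using hred) (fun x hx => hocc x (by simp [hx]))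
      ((hM ⟨c, hc, rfl⟩).trans (by simpa using hlen))
    simpa using this

include hE in
theorem exists_norm_bound :
    ∃ N, ∀ y : FreeGroup S, N ≤ y.norm → ∀ x, Occurs w x → E (y * mk [x]) = E y := by
  obtain ⟨M, hM⟩ := ((((finite_occurs w).biUnion fun x _ => hE (mk [x]))).image
    FreeGroup.norm).bddAbove
  refine ⟨M + 1, fun y hy x hx => ?_⟩
  by_contra hne
  have := hM ⟨y, Set.mem_biUnion hx hne, rfl⟩
  omega

include hm hE heven in
theorem exists_reaches {L : List (S × Bool)} (hL : IsReduced L) (hL0 : L ≠ [])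
    (hocc : ∀ x ∈ L, Occurs w x) : ∃ ε, Reaches E w L ε := by
  obtain ⟨N, hN⟩ := exists_norm_bound (w := w) hE
  induction hn : N - L.length generalizing L with
  | zero => exact ⟨_, exists_reaches_of_norm hN (by omega)⟩
  | succ n ih =>
    obtain ⟨l, d, rfl⟩ := (List.eq_nil_or_concat' L).resolve_left hL0
    refine Reaches.of_branches hm hE heven hL (hocc d (by simp)) fun c hc hcd => ?_
    refine ih (isReduced_concat hL hcd) (by simp) ?_ ?_
    · intro x hx
      rw [List.mem_append, List.mem_singleton] at hx
      rcases hx with hx | rfl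
      · exact hocc x hx
      · exact hc
    · rw [List.length_append]
      simp only [List.length_singleton]
      omega

include hm hE heven in
theorem IsAutMinimal.exists_eq_singleton (hodd : OddAt E (mk w) 1) : ∃ x, w = [x] := by
  have hw0 : w ≠ [] := by
    rintro rfl
    obtain ⟨k, hk⟩ := hodd.exists
    simp [← one_eq_mk] at hk
  have h' : ∀ c, ∃ ε, Occurs w c → Reaches E w [c] ε := by
    intro c
    by_cases hc : Occurs w c
    · obtain ⟨ε, hε⟩ := exists_reaches hm hE heven (L := [c]) FreeGroup.IsReduced.singleton
        (by simp) (by simpa using hc)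
      exact ⟨ε, fun _ => hε⟩
    · exact ⟨0, fun h1 => absurd h1 hc⟩
  choose ε hε using h'
  obtain ⟨z, C, hzC⟩ := List.exists_cons_of_ne_nil hw0
  obtain ⟨l, y, hly⟩ := (List.eq_nil_or_concat' w).resolve_left hw0
  have hz : w.head? = some z := by simp [hzC]
  have hy : w.getLast? = some y := by simp [hly]
  have hzw : z ∈ w := List.mem_of_head? hz
  have hyw : y ∈ w := List.mem_of_getLast? hy
  have hne : ε z ≠ ε (bar y) := by
    obtain ⟨k, hk, hk1, hk2⟩ := (hodd.and (Reaches.eventually_pow (L := []) hm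
      (List.IsRotated.refl w) hz hy FreeGroup.IsReduced.singleton FreeGroup.IsReduced.singleton
      (hε z (Or.inl hzw)) (hε (bar y) (Occurs.bar (Or.inl hyw))))).exists
    simp only [← one_eq_mk] at hk1 hk2
    rwa [hk1, hk2] at hk
  have hedge : ∀ s t y' z', w = s ++ t → t ≠ [] → s ≠ [] → (t ++ s).head? = some z' →
      (t ++ s).getLast? = some y' → ε z' = ε (bar y') := by
    intro s t y' z' hw ht hs hz' hy'
    have hr : w ~r (t ++ s) := hw ▸ List.isRotated_append
    exact Reaches.eq_of_line (L := []) hm hE heven hw ht hz' hy' FreeGroup.IsReduced.singleton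
      FreeGroup.IsReduced.singleton (Or.inr hs)
      (hε z' (Or.inl (hr.mem_iff.2 (List.mem_of_head? hz'))))
      (hε (bar y') (Occurs.bar (Or.inl (hr.mem_iff.2 (List.mem_of_getLast? hy')))))
  have hcut : ∀ a, (a = z ∨ a = bar y) → ∀ c, Occurs w c → c ≠ a → ε c = ε (bar a) := by
    intro a ha c hc hca
    by_contra hne
    refine hm.no_cut (a := a) (A := {c | Occurs w c ∧ c ≠ a ∧ ε c ≠ ε (bar a)}) (b := c)
      (by simp) (by simp) ?_ ⟨hc, hca, hne⟩ hc ?_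
    · rcases ha with rfl | rfl
      · exact Or.inl hzw
      · exact Occurs.bar (Or.inl hyw)
    refine chain_of_rotations fun l' y' z' hr hz' hy1 hz1 => ?_
    obtain ⟨s, t, hw, hw', ht⟩ := exists_split_of_isRotated hr hw0
    have hylast : (t ++ s).getLast? = some y' := by rw [← hw']; simp
    have hzocc : Occurs w z' := Or.inl (hr.mem_iff.2 (List.mem_of_head? hz'))
    have hyocc : Occurs w (bar y') := Occurs.bar (Or.inl (hr.mem_iff.2 (by simp)))
    have hs : s ≠ [] := by
      rintro rfl
      rw [List.append_nil] at hw'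
      rw [List.nil_append] at hw
      rw [hw', ← hw, hz, Option.some_inj] at hz'
      rw [List.append_nil, ← hw, hy, Option.some_inj] at hylast
      rcases ha with rfl | rfl
      · exact hz1 hz'.symm
      · exact hy1 (by rw [hylast])
    have := hedge s t y' z' hw ht hs (hw' ▸ hz') hylast
    simp [hzocc, hyocc, hy1, hz1, this]
  have h1 := hcut z (Or.inl rfl)
  have h2 := hcut (bar y) (Or.inr rfl)
  have honly : ∀ c, Occurs w c → c = z ∨ c = bar y := by
    intro c hc
    by_contra! hcc
    have hzy : z ≠ bar y := fun h => hne (by rw [h])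
    apply hne
    rw [h2 z (Or.inl hzw) hzy, h1 (bar y) (Occurs.bar (Or.inl hyw)) hzy.symm,
      ← h1 c hc hcc.1, ← h2 c hc hcc.2]
  have hyz : y = z := by
    have := (honly (bar z) (Occurs.bar (Or.inl hzw))).resolve_left (bar_ne z)
    rw [bar_eq_iff, bar_bar] at this
    exact this.symm
  refine ⟨z, ?_⟩
  rw [hzC]
  cases C with
  | nil => rfl
  | cons x C =>
    exfalso
    have hx : x = z := by
      refine (honly x (Or.inl (by simp [hzC]))).resolve_right ?_
      rintro rfl
      refine not_isReduced_concat_bar [] z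
        (hm.isCyclicallyReduced.isReduced.infix ⟨[], C, ?_⟩)
      simp [hzC, hyz]
    apply hne
    rw [hyz]
    refine hedge [z] (x :: C) z z (by simp [hzC]) (by simp) (by simp) (by simp [hx]) ?_
    rw [List.getLast?_append]; simp

end Core

end Whitehead

theorem AlmostInvariant.comp_mulEquiv {G H : Type*} [Group G] [Group H] {E : G → ZMod 2}
    (hE : AlmostInvariant E) (θ : H ≃* G) : AlmostInvariant fun y => E (θ y) := by
  intro g
  refine ((hE (θ g)).preimage (f := θ) θ.injective.injOn).subset fun y hy => ?_
  simpa using hy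

/-- The automorphism of a free group that inverts every basis element. -/
def invertBasis (S : Type*) : FreeGroup S ≃* FreeGroup S :=
  MonoidHom.toMulEquiv (FreeGroup.lift fun t => (of t)⁻¹) (FreeGroup.lift fun t => (of t)⁻¹)
    (by ext; simp) (by ext; simp)

theorem exists_basis_of_almostInvariant {S G : Type*} [Group G] (ψ : FreeGroup S ≃* G) {c : G}
    {E : G → ZMod 2} (hE : AlmostInvariant E) (hodd : OddAt E c 1)
    (heven : ∀ g, g ∉ Subgroup.zpowers c → EvenAt E c g) :
    ∃ (s : S) (θ : FreeGroup S ≃* G), θ (of s) = c := by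
  classical
  have hex : ∃ n, ∃ (w : List (S × Bool)) (θ : FreeGroup S ≃* G), θ (mk w) = c ∧ w.length = n :=
    ⟨_, (ψ.symm c).toWord, ψ, by rw [FreeGroup.mk_toWord]; simp, rfl⟩
  obtain ⟨w, θ, hθ, hlen⟩ := Nat.find_spec hex
  have hm : IsAutMinimal w := by
    intro φ w' hconj
    obtain ⟨u, hu⟩ := isConj_iff.1 hconj
    rw [hlen]
    refine Nat.find_min' hex ⟨w', (φ.trans (MulAut.conj u)).symm.trans θ, ?_, rfl⟩
    rw [MulEquiv.trans_apply, ← hθ]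
    congr 1
    rw [MulEquiv.symm_apply_eq, ← hu]
    rfl
  obtain ⟨⟨s, b⟩, rfl⟩ := hm.exists_eq_singleton (hE.comp_mulEquiv θ)
    (fun g hg => by
      have : θ g ∉ Subgroup.zpowers c := by
        rintro ⟨n, hn⟩
        refine hg ⟨n, θ.injective ?_⟩
        simpa [hθ] using hn
      simpa only [EvenAt, map_mul, map_pow, map_inv, hθ] using heven _ this)
    (by simpa only [OddAt, map_mul, map_pow, map_inv, map_one, hθ] using hodd)
  cases b with
  | true => exact ⟨s, θ, hθ⟩
  | false =>
    refine ⟨s, (invertBasis S).trans θ, ?_⟩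
    rw [← hθ]
    simp [invertBasis, mk_singleton]

theorem exists_optionBasis_of_almostInvariant {S : Type*} {G : Type*} [Group G]
    (ψ : FreeGroup S ≃* G) {c : G}
    {E : G → ZMod 2} (hE : AlmostInvariant E) (hodd : OddAt E c 1)
    (heven : ∀ g, g ∉ Subgroup.zpowers c → EvenAt E c g) :
    ∃ (s : S) (θ : FreeGroup (Option {t // t ≠ s}) ≃* G), θ (of none) = c := by
  classical
  obtain ⟨s, θ, hθ⟩ := exists_basis_of_almostInvariant ψ hE hodd heven
  exact ⟨s, (FreeGroup.freeGroupCongr (Equiv.optionSubtypeNe s)).trans θ, by simpa using hθ⟩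

section Wreath

variable {Γ M : Type*} [Group Γ] [CommGroup M]

variable (Γ M) in
/-- The action of a group on functions by right translation of the argument. -/
def translate : Γ →* MulAut (Γ → M) where
  toFun g :=
    { toFun := fun m y => m (y * g)
      invFun := fun m y => m (y * g⁻¹)
      left_inv := fun m => by ext y; simp
      right_inv := fun m => by ext y; simp
      map_mul' := fun m n => rfl }
  map_one' := by ext m y; simp
  map_mul' g g' := by ext m y; simp [mul_assoc]

theorem translate_apply (g : Γ) (m : Γ → M) (y : Γ) : translate Γ M g m y = m (y * g) := rfl

variable (Γ M) in
/-- The normal subgroup of finitely supported functions in the unrestricted wreath product. -/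
def finitelySupported : Subgroup ((Γ → M) ⋊[translate Γ M] Γ) where
  carrier := {u | u.right = 1 ∧ {y | u.left y ≠ 1}.Finite}
  one_mem' := by simp
  mul_mem' := by
    rintro u v ⟨hu, hu'⟩ ⟨hv, hv'⟩
    refine ⟨by simp [hu, hv], (hu'.union hv').subset fun y hy => ?_⟩
    by_contra hcon
    simp only [Set.mem_union, Set.mem_ofPred_eq, not_or, not_not] at hcon
    exact hy (by simp [hu, hcon])
  inv_mem' := by
    rintro u ⟨hu, hu'⟩
    refine ⟨by simp [hu], hu'.subset fun y hy => ?_⟩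
    simpa [hu] using hy

theorem div_mem_finitelySupported {u v : (Γ → M) ⋊[translate Γ M] Γ} :
    u / v ∈ finitelySupported Γ M ↔ u.right = v.right ∧ {y | u.left y ≠ v.left y}.Finite := by
  change (u / v).right = 1 ∧ {y | (u / v).left y ≠ 1}.Finite ↔ _
  rw [div_eq_mul_inv, SemidirectProduct.mul_right, SemidirectProduct.inv_right, mul_inv_eq_one]
  refine and_congr_right fun h => ?_
  have : {y | (u * v⁻¹).left y ≠ 1} = {y | u.left y ≠ v.left y} := by
    ext y
    simp [h, mul_inv_eq_one]
  rw [this]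

instance : (finitelySupported Γ M).Normal where
  conj_mem := by
    rintro k ⟨hk, hk'⟩ u
    refine ⟨by simp [hk], (hk'.preimage (f := fun y => y * u.right)
      (mul_left_injective _).injOn).subset fun y hy => ?_⟩
    simpa [translate_apply, hk] using hy

variable (Γ M) in
/-- The projection of the wreath product modulo finitely supported functions. -/
def quotientRight : ((Γ → M) ⋊[translate Γ M] Γ) ⧸ finitelySupported Γ M →* Γ :=
  QuotientGroup.lift _ SemidirectProduct.rightHom fun _ hu => hu.1

theorem exists_primitive {X : Type*} (ψ : FreeGroup X ≃* Γ)
    (Φ : Γ →* ((Γ → M) ⋊[translate Γ M] Γ) ⧸ finitelySupported Γ M)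
    (hΦ : (quotientRight Γ M).comp Φ = MonoidHom.id Γ) :
    ∃ h : Γ → M, ∀ y u, Φ y = QuotientGroup.mk' _ u → {x | h (x * y) ≠ h x * u.left x}.Finite := by
  choose s hs using fun x => QuotientGroup.mk'_surjective _ (Φ (ψ (of x)))
  let σ : Γ →* (Γ → M) ⋊[translate Γ M] Γ := (FreeGroup.lift s).comp ψ.symm.toMonoidHom
  have hσ : ∀ y, QuotientGroup.mk' _ (σ y) = Φ y := by
    have : ((QuotientGroup.mk' _).comp (FreeGroup.lift s)) = Φ.comp ψ.toMonoidHom := by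
      ext x
      simpa using hs x
    intro y
    have := DFunLike.congr_fun this (ψ.symm y)
    simpa [σ] using this
  have hright : ∀ y, (σ y).right = y := by
    intro y
    have := DFunLike.congr_fun hΦ y
    rw [MonoidHom.comp_apply, ← hσ] at this
    exact this
  refine ⟨fun y => (σ y).left 1, fun y u hu => ?_⟩
  have hfin := (div_mem_finitelySupported.1
    (QuotientGroup.eq_iff_div_mem.1 ((hσ y).trans hu))).2
  refine hfin.subset fun x hx hne => hx ?_
  simp [hright, translate_apply, hne]

end Wreath

/-- Vanishing of the obstruction to gluing almost invariant functions over a free amalgam. -/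
theorem exists_almostInvariant_mul {X ι H M : Type*} [Nonempty ι] {G : ι → Type*}
    [∀ i, Group (G i)] [Group H] [CommGroup M] {φ : ∀ i, H →* G i}
    (ψ : FreeGroup X ≃* Monoid.PushoutI φ) (F : ι → Monoid.PushoutI φ → M)
    (hF : ∀ i h, {y | F i (y * Monoid.PushoutI.base φ h) ≠ F i y}.Finite) :
    ∃ h : Monoid.PushoutI φ → M, ∀ i (g : G i),
      {y | h (y * Monoid.PushoutI.of i g) * F i (y * Monoid.PushoutI.of i g) ≠
        h y * F i y}.Finite := by
  let s : ∀ i, Monoid.PushoutI φ →* (Monoid.PushoutI φ → M) ⋊[translate (Monoid.PushoutI φ) M]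
      Monoid.PushoutI φ := fun i =>
    (MulAut.conj (SemidirectProduct.inl (F i))).toMonoidHom.comp SemidirectProduct.inr
  have hs : ∀ i y x, (s i y).left x = F i x * (F i (x * y))⁻¹ := by
    intro i y x
    simp [s, translate_apply]
  have hsr : ∀ i y, (s i y).right = y := by
    intro i y
    simp [s]
  let Φ := Monoid.PushoutI.lift (φ := φ)
    (fun i => (QuotientGroup.mk' (finitelySupported _ M)).comp ((s i).comp (Monoid.PushoutI.of i)))
    ((QuotientGroup.mk' (finitelySupported _ M)).comp
      (SemidirectProduct.inr.comp (Monoid.PushoutI.base φ))) (by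
      intro i
      ext h
      refine (QuotientGroup.eq_iff_div_mem).2 (div_mem_finitelySupported.2 ⟨?_, ?_⟩)
      · rw [MonoidHom.comp_apply, hsr, Monoid.PushoutI.of_apply_eq_base]
        rfl
      · refine (hF i h).subset fun y hy hne => hy ?_
        rw [MonoidHom.comp_apply, hs, Monoid.PushoutI.of_apply_eq_base, hne]
        simp)
  have hΦ : ∀ i (g : G i), Φ (Monoid.PushoutI.of i g) =
      QuotientGroup.mk' _ (s i (Monoid.PushoutI.of i g)) := fun i g =>
    Monoid.PushoutI.lift_of _ _ _ _
  obtain ⟨h, hh⟩ := exists_primitive ψ Φ (by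
    refine Monoid.PushoutI.hom_ext_nonempty fun i => ?_
    ext g
    rw [MonoidHom.comp_apply, MonoidHom.comp_apply, hΦ]
    exact hsr i (Monoid.PushoutI.of i g))
  refine ⟨h, fun i g => (hh _ _ (hΦ i g)).subset fun y hy hne => hy ?_⟩
  rw [hs] at hne
  rw [hne, mul_assoc, inv_mul_cancel_right]

section Ends

variable {G : Type*} [Group G] {E : G → ZMod 2} {u : G}

theorem eventually_const_of_step (hu : Function.Injective fun k : ℕ => u ^ k)
    (h : {y | E (y * u) ≠ E y}.Finite) (g : G) :
    ∃ ε, ∀ᶠ k : ℕ in Filter.atTop, E (g * u ^ k) = ε := by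
  have h2 := ((h.preimage (f := fun k : ℕ => g * u ^ k)
    (Function.Injective.injOn fun i j hij => hu (mul_left_cancel hij)))).eventually_cofinite_notMem
  rw [Nat.cofinite_eq_atTop, Filter.eventually_atTop] at h2
  obtain ⟨N, hN⟩ := h2
  refine ⟨E (g * u ^ N), Filter.eventually_atTop.2 ⟨N, fun k hk => ?_⟩⟩
  induction k, hk using Nat.le_induction with
  | base => rfl
  | succ k hk ih =>
    rw [← ih, pow_succ, ← mul_assoc]
    by_contra hne
    exact hN k hk hne

theorem finite_step_inv (h : {y | E (y * u) ≠ E y}.Finite) :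
    {y | E (y * u⁻¹) ≠ E y}.Finite := by
  refine (h.preimage (f := fun y => y * u⁻¹) (mul_left_injective _).injOn).subset fun y hy h => ?_
  exact hy (by simpa using h.symm)

theorem oddAt_or_evenAt (hu : Function.Injective fun k : ℕ => u ^ k)
    (h : {y | E (y * u) ≠ E y}.Finite) (g : G) : OddAt E u g ∨ EvenAt E u g := by
  obtain ⟨ε₁, h₁⟩ := eventually_const_of_step hu h g
  obtain ⟨ε₂, h₂⟩ := eventually_const_of_step (u := u⁻¹)
    (fun i j hij => hu (by simpa using hij)) (finite_step_inv h) g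
  by_cases hε : ε₁ = ε₂
  · right
    filter_upwards [h₁, h₂] with k hk hk'
    rw [← inv_pow, hk, hk', hε]
  · left
    filter_upwards [h₁, h₂] with k hk hk'
    rw [← inv_pow, hk, hk']
    exact hε

theorem OddAt.exists_step {g : G} (h : OddAt E u g) : ∃ n : ℤ, E (g * u ^ n * u) ≠ E (g * u ^ n) := by
  by_contra! hcon
  obtain ⟨k, hk⟩ := h.exists
  apply hk
  have : ∀ n : ℤ, E (g * u ^ n) = E g := by
    intro n
    induction n with
    | zero => simp
    | succ n ih => rw [zpow_add_one, ← mul_assoc, hcon, ih]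
    | pred n ih => rw [← ih, ← hcon, mul_assoc, ← zpow_add_one, sub_add_cancel]
  rw [← zpow_natCast, this, ← zpow_neg, this]

/-- The function with values in a multiplicative group of order two that singles out the
nonnegative powers of `u`. -/
noncomputable def halfLine (u : G) (y : G) : Multiplicative (ZMod 2) :=
  open scoped Classical in if ∃ k : ℕ, y = u ^ k then Multiplicative.ofAdd 1 else 1

theorem finite_halfLine_mul_zpow (u : G) (n : ℤ) :
    {y | halfLine u (y * u ^ n) ≠ halfLine u y}.Finite := by
  refine ((Set.finite_Icc (-|n|) |n|).image fun m : ℤ => u ^ m).subset fun y hy => ?_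
  by_contra hcon
  apply hy
  have : (∃ k : ℕ, y * u ^ n = u ^ k) ↔ ∃ k : ℕ, y = u ^ k := by
    constructor
    · rintro ⟨k, hk⟩
      have hy' : y = u ^ ((k : ℤ) - n) := by
        rw [zpow_sub, zpow_natCast, ← hk, mul_inv_cancel_right]
      by_cases h0 : 0 ≤ (k : ℤ) - n
      · lift (k : ℤ) - n to ℕ using h0 with j hj
        exact ⟨j, by simpa using hy'⟩
      · exact absurd ⟨_, ⟨by have := neg_abs_le n; have := le_abs_self n; omega,
          by have := neg_abs_le n; have := le_abs_self n; omega⟩, hy'.symm⟩ hcon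
    · rintro ⟨k, hk⟩
      by_cases h0 : 0 ≤ (k : ℤ) + n
      · lift (k : ℤ) + n to ℕ using h0 with j hj
        exact ⟨j, by rw [hk, ← zpow_natCast, ← zpow_natCast, hj, zpow_add]⟩
      · exact absurd ⟨k, ⟨by have := neg_abs_le n; have := le_abs_self n; omega,
          by have := neg_abs_le n; have := le_abs_self n; omega⟩, by simpa using hk.symm⟩ hcon
  classical exact if_congr this rfl rfl

end Ends

theorem exists_length {ι H : Type*} {G : ι → Type*} [∀ i, Group (G i)] [Group H]
    {φ : ∀ i, H →* G i} (hφ : ∀ i, Function.Injective (φ i)) :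
    ∃ (ℓ : Monoid.PushoutI φ → ℕ) (σ : Monoid.PushoutI φ → Option ι),
      (∀ y h, ℓ (y * Monoid.PushoutI.base φ h) = ℓ y) ∧
      (∀ h, σ (Monoid.PushoutI.base φ h) = none) ∧
      ∀ y j (q : G j), σ y ≠ some j → q ∉ (φ j).range → ℓ (y * Monoid.PushoutI.of j q) = ℓ y + 1 := by
  classical
  obtain ⟨d⟩ := Monoid.PushoutI.NormalWord.transversal_nonempty φ hφ
  refine ⟨fun y => (y⁻¹ • (Monoid.PushoutI.NormalWord.empty (d := d))).toList.length,
    fun y => (y⁻¹ • (Monoid.PushoutI.NormalWord.empty (d := d))).fstIdx, ?_, ?_, ?_⟩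
  · intro y h
    simp only [mul_inv_rev, mul_smul, ← map_inv]
    rw [Monoid.PushoutI.NormalWord.base_smul_def]
  · intro h
    simp only [← map_inv]
    rw [Monoid.PushoutI.NormalWord.base_smul_def]
    rfl
  · intro y j q hσ hq
    simp only [mul_inv_rev, mul_smul]
    rw [← map_inv, ← Monoid.PushoutI.NormalWord.cons_eq_smul _ _ hσ (by simpa using hq)]
    rfl


theorem range_eq_zpowers {G : Type*} [Group G] (f : Multiplicative ℤ →* G) :
    f.range = Subgroup.zpowers (f (Multiplicative.ofAdd 1)) := by
  ext x
  constructor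
  · rintro ⟨n, rfl⟩
    exact ⟨Multiplicative.toAdd n, by simp [← map_zpow, ← ofAdd_zsmul]⟩
  · rintro ⟨n, rfl⟩
    exact ⟨Multiplicative.ofAdd 1 ^ n, map_zpow _ _ _⟩

theorem zpow_injective_of_injective {G : Type*} [Group G] {f : Multiplicative ℤ →* G}
    (hf : Function.Injective f) :
    Function.Injective fun n : ℤ => f (Multiplicative.ofAdd 1) ^ n := by
  intro m n hmn
  have h : f (Multiplicative.ofAdd 1 ^ m) = f (Multiplicative.ofAdd 1 ^ n) := by simpa using hmn
  simpa [← ofAdd_zsmul] using hf h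

theorem pow_injective_of_injective {G : Type*} [Group G] {f : Multiplicative ℤ →* G}
    (hf : Function.Injective f) :
    Function.Injective fun n : ℕ => f (Multiplicative.ofAdd 1) ^ n := by
  intro m n hmn
  exact_mod_cast zpow_injective_of_injective hf (a₁ := (m : ℤ)) (a₂ := n) (by simpa using hmn)

section Side

variable {X : Type*} {G : Fin 2 → Type*} [∀ i, Group (G i)] {f : ∀ i, Multiplicative ℤ →* G i}

theorem exists_pair_almostInvariant (hinj : ∀ i, Function.Injective (f i))
    (ψ : FreeGroup X ≃* Monoid.PushoutI f) :
    ∃ E : Fin 2 → Monoid.PushoutI f → ZMod 2,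
      (∀ i (g : G i), {y | E i (y * Monoid.PushoutI.of i g) ≠ E i y}.Finite) ∧
      (∀ y, y ∉ Subgroup.zpowers (Monoid.PushoutI.base f (Multiplicative.ofAdd 1)) →
        E 0 y = E 1 y) ∧
      (∀ k : ℕ, E 1 (Monoid.PushoutI.base f (Multiplicative.ofAdd 1) ^ k) =
        E 0 (Monoid.PushoutI.base f (Multiplicative.ofAdd 1) ^ k) + 1) ∧
      ∀ k : ℕ, 1 ≤ k → E 1 (Monoid.PushoutI.base f (Multiplicative.ofAdd 1) ^ k)⁻¹ =
        E 0 (Monoid.PushoutI.base f (Multiplicative.ofAdd 1) ^ k)⁻¹ := by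
  set c := Monoid.PushoutI.base f (Multiplicative.ofAdd 1) with hc
  obtain ⟨h, hh⟩ := exists_almostInvariant_mul ψ ![fun _ => 1, halfLine c] (by
    intro i n
    fin_cases i
    · simp
    · have := finite_halfLine_mul_zpow c (Multiplicative.toAdd n)
      rw [hc, ← map_zpow, ← ofAdd_zsmul] at this
      simpa using this)
  refine ⟨fun i y => Multiplicative.toAdd (h y * ![fun _ => 1, halfLine c] i y), fun i g => ?_,
    ?_, ?_, ?_⟩
  · exact hh i g
  · intro y hy
    have : ¬ ∃ k : ℕ, y = c ^ k := fun ⟨k, hk⟩ => hy ⟨k, by simp [hk]⟩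
    simp [halfLine, this]
  · intro k
    have : ∃ j : ℕ, c ^ k = c ^ j := ⟨k, rfl⟩
    simp [halfLine, this]
  · intro k hk
    have : ¬ ∃ j : ℕ, (c ^ k)⁻¹ = c ^ j := by
      rintro ⟨j, hj⟩
      have := zpow_injective_of_injective (Monoid.PushoutI.base_injective hinj)
        (a₁ := -(k : ℤ)) (a₂ := j) (by simpa using hj)
      omega
    simp [halfLine, this]

/-- One of the two vertex groups carries an almost invariant function separating the ends of the
edge group and of no other coset of it. -/
theorem exists_side_almostInvariant (hinj : ∀ i, Function.Injective (f i))
    (ψ : FreeGroup X ≃* Monoid.PushoutI f) :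
    ∃ i, ∃ E : G i → ZMod 2, AlmostInvariant E ∧ OddAt E (f i (Multiplicative.ofAdd 1)) 1 ∧
      ∀ g, g ∉ Subgroup.zpowers (f i (Multiplicative.ofAdd 1)) →
        EvenAt E (f i (Multiplicative.ofAdd 1)) g := by
  obtain ⟨E, hE, hE01, hpos, hneg⟩ := exists_pair_almostInvariant hinj ψ
  obtain ⟨ℓ, σ, hℓ, hσ, hℓσ⟩ := exists_length hinj
  set c := Monoid.PushoutI.base f (Multiplicative.ofAdd 1) with hc
  have hof : ∀ i, Monoid.PushoutI.of i (f i (Multiplicative.ofAdd 1)) = c := fun i =>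
    Monoid.PushoutI.of_apply_eq_base f i _
  have hcinj : Function.Injective fun k : ℕ => c ^ k :=
    pow_injective_of_injective (Monoid.PushoutI.base_injective hinj)
  have hEc : ∀ i, {y | E i (y * c) ≠ E i y}.Finite := fun i => by
    have := hE i (f i (Multiplicative.ofAdd 1))
    rwa [hof] at this
  have hbound : ∃ N, ∀ i y, OddAt (E i) c y → ℓ y ≤ N := by
    obtain ⟨N, hN⟩ := ((Set.finite_iUnion hEc).image ℓ).bddAbove
    refine ⟨N, fun i y hy => ?_⟩
    obtain ⟨n, hn⟩ := hy.exists_step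
    have := hN ⟨y * c ^ n, Set.mem_iUnion.2 ⟨i, hn⟩, rfl⟩
    rwa [hc, ← map_zpow, hℓ] at this
  have hone : ∃ i, OddAt (E i) c 1 := by
    by_contra! hcon
    have h0 := (oddAt_or_evenAt hcinj (hEc 0) 1).resolve_left (hcon 0)
    have h1 := (oddAt_or_evenAt hcinj (hEc 1) 1).resolve_left (hcon 1)
    obtain ⟨k, hk0, hk1, hk⟩ := (h0.and (h1.and (Filter.eventually_ge_atTop 1))).exists
    rw [one_mul, one_mul] at hk0 hk1
    rw [hpos, hneg k hk, hk0] at hk1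
    simp at hk1
  have hswap : ∀ i j y, y ∉ Subgroup.zpowers c → OddAt (E i) c y → OddAt (E j) c y := by
    have hij : ∀ i j y, y ∉ Subgroup.zpowers c → E i y = E j y := by
      intro i j y hy
      have := hE01 y hy
      fin_cases i <;> fin_cases j <;> simp [this]
    intro i j y hy hodd
    filter_upwards [hodd] with k hk
    rwa [hij j i, hij j i]
    · rwa [Subgroup.mul_mem_cancel_right]
      exact inv_mem (pow_mem (Subgroup.mem_zpowers c) k)
    · rwa [Subgroup.mul_mem_cancel_right]
      exact pow_mem (Subgroup.mem_zpowers c) k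
  obtain ⟨y, i, hy, hmax⟩ : ∃ y i, OddAt (E i) c y ∧ ∀ y' i', OddAt (E i') c y' → ℓ y' ≤ ℓ y := by
    classical
    obtain ⟨N, hN⟩ := hbound
    obtain ⟨i₁, hi₁⟩ := hone
    have hspec := Nat.findGreatest_spec (P := fun n => ∃ y i, OddAt (E i) c y ∧ ℓ y = n)
      (hN _ _ hi₁) ⟨1, i₁, hi₁, rfl⟩
    obtain ⟨y, i, hy, hyl⟩ := hspec
    refine ⟨y, i, hy, fun y' i' hy' => ?_⟩
    rw [hyl]
    exact Nat.le_findGreatest (hN _ _ hy') ⟨y', i', hy', rfl⟩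
  obtain ⟨j, hj, hσj⟩ : ∃ j, OddAt (E j) c y ∧ σ y ≠ some j := by
    by_cases hs : σ y = some i
    · have hyc : y ∉ Subgroup.zpowers c := by
        rintro ⟨n, rfl⟩
        simp only [hc, ← map_zpow, hσ] at hs
        simp at hs
      refine ⟨1 - i, hswap i _ y hyc hy, ?_⟩
      rw [hs, Ne, Option.some_inj]
      fin_cases i <;> simp
    · exact ⟨i, hy, hs⟩
  refine ⟨j, fun q => E j (y * Monoid.PushoutI.of j q), ?_, ?_, ?_⟩
  · intro g
    refine ((hE j g).preimage (f := fun q => y * Monoid.PushoutI.of j q) ?_).subset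
      fun q hq => ?_
    · exact fun a _ b _ hab => Monoid.PushoutI.of_injective hinj j (mul_left_cancel hab)
    · simpa [mul_assoc] using hq
  · simpa only [OddAt, map_mul, map_one, map_inv, map_pow, hof, one_mul] using hj
  · intro q hq
    have hnot : ¬ OddAt (E j) c (y * Monoid.PushoutI.of j q) := by
      intro hodd
      have := hmax _ _ hodd
      rw [hℓσ y j q hσj (by rwa [range_eq_zpowers])] at this
      omega
    have := (oddAt_or_evenAt hcinj (hEc j) _).resolve_left hnot
    simpa only [EvenAt, map_mul, map_inv, map_pow, hof, mul_assoc] using this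

end Side

section Assembly

theorem exists_freeGroup_mulEquiv {X G : Type} [Group G] (φ : G →* FreeGroup X)
    (hφ : Function.Injective φ) : ∃ S : Type, Nonempty (FreeGroup S ≃* G) :=
  ⟨_, ⟨(IsFreeGroup.mulEquiv φ.range).trans (MonoidHom.ofInjective hφ).symm⟩⟩

theorem exists_hom_family {K : Type*} [Group K] {G : Fin 2 → Type*} [∀ i, Group (G i)]
    {i j : Fin 2} (hij : i ≠ j) (α : G i →* K) (β : G j →* K) :
    ∃ γ : ∀ k, G k →* K, γ i = α ∧ γ j = β :=
  ⟨Function.update (Function.update (fun _ => 1) j β) i α, by simp,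
    by rw [Function.update_of_ne hij.symm, Function.update_self]⟩

variable {ι κ H : Type*} {G : Fin 2 → Type*} [∀ i, Group (G i)] {f : ∀ i, Multiplicative ℤ →* G i}
  {i j : Fin 2}

/-- An amalgam of two free groups along a cyclic group generated by a basis element of one of
them is free. -/
theorem exists_pushout_mulEquiv (hij : i ≠ j) (θ : FreeGroup (Option ι) ≃* G i)
    (hθ : θ (of none) = f i (Multiplicative.ofAdd 1)) (η : FreeGroup κ ≃* G j) :
    ∃ Ψ : Monoid.PushoutI f ≃* FreeGroup (ι ⊕ κ),
      (∀ a, Ψ (Monoid.PushoutI.of i (θ (of (some a)))) = of (Sum.inl a)) ∧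
      ∀ x, Ψ (Monoid.PushoutI.of j (η x)) = FreeGroup.map Sum.inr x := by
  have hcases : ∀ k, k = i ∨ k = j := by omega
  let β : G j →* FreeGroup (ι ⊕ κ) := (FreeGroup.map Sum.inr).comp η.symm.toMonoidHom
  let α : G i →* FreeGroup (ι ⊕ κ) := (FreeGroup.lift fun o : Option ι =>
    o.elim (β (f j (Multiplicative.ofAdd 1))) fun a => of (Sum.inl a)).comp θ.symm.toMonoidHom
  have hαθ : ∀ o, α (θ (of o)) = o.elim (β (f j (Multiplicative.ofAdd 1)))
      fun a => of (Sum.inl a) := fun o => by simp [α]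
  have hβη : ∀ x, β (η x) = FreeGroup.map Sum.inr x := fun x => by simp [β]
  obtain ⟨γ, hγi, hγj⟩ := exists_hom_family hij α β
  let Φ : Monoid.PushoutI f →* FreeGroup (ι ⊕ κ) := Monoid.PushoutI.lift γ (β.comp (f j)) (by
    intro k
    rcases hcases k with rfl | rfl
    · ext
      rw [hγi, MonoidHom.comp_apply, ← hθ, hαθ]
      rfl
    · rw [hγj])
  have hΦi : ∀ x, Φ (Monoid.PushoutI.of i x) = α x := fun x => by
    rw [Monoid.PushoutI.lift_of, hγi]
  have hΦj : ∀ x, Φ (Monoid.PushoutI.of j x) = β x := fun x => by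
    rw [Monoid.PushoutI.lift_of, hγj]
  let Λ : FreeGroup (ι ⊕ κ) →* Monoid.PushoutI f := FreeGroup.lift
    (Sum.elim (fun a => Monoid.PushoutI.of i (θ (of (some a))))
      fun k => Monoid.PushoutI.of j (η (of k)))
  have hΛβ : ∀ x, Λ (β x) = Monoid.PushoutI.of j x := by
    have : (Λ.comp (FreeGroup.map Sum.inr)) = (Monoid.PushoutI.of j).comp η.toMonoidHom := by
      ext k
      simp [Λ]
    intro x
    simpa [β] using DFunLike.congr_fun this (η.symm x)
  have hΛα : ∀ x, Λ (α x) = Monoid.PushoutI.of i x := by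
    have : (Λ.comp (α.comp θ.toMonoidHom)) = (Monoid.PushoutI.of i).comp θ.toMonoidHom := by
      ext o
      change Λ (α (θ (of o))) = Monoid.PushoutI.of i (θ (of o))
      rw [hαθ]
      cases o with
      | none =>
        rw [hθ, Option.elim_none, hΛβ, Monoid.PushoutI.of_apply_eq_base,
          Monoid.PushoutI.of_apply_eq_base]
      | some a => simp [Λ]
    intro x
    simpa using DFunLike.congr_fun this (θ.symm x)
  refine ⟨MonoidHom.toMulEquiv Φ Λ ?_ ?_, fun a => ?_, fun x => ?_⟩
  · refine Monoid.PushoutI.hom_ext_nonempty fun k => ?_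
    rcases hcases k with rfl | rfl
    · ext x
      change Λ (Φ (Monoid.PushoutI.of k x)) = Monoid.PushoutI.of k x
      rw [hΦi, hΛα]
    · ext x
      change Λ (Φ (Monoid.PushoutI.of k x)) = Monoid.PushoutI.of k x
      rw [hΦj, hΛβ]
  · ext s
    change Φ (Λ (of s)) = of s
    rcases s with a | k
    · simp [Λ, hΦi, hαθ]
    · simp [Λ, hΦj, hβη]
  · exact (hΦi _).trans (hαθ _)
  · exact (hΦj _).trans (hβη _)

/-- A group whose maximal cyclic subgroup `f.range` is proper is not cyclic. -/
theorem ne_top_of_forall_ne_pow [Group H] {f : Multiplicative ℤ →* H}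
    (hinj : Function.Injective f) (hsurj : ¬ Function.Surjective f)
    (hpow : ∀ (g : H) (n : ℕ), 2 ≤ n → f (Multiplicative.ofAdd 1) ≠ g ^ n) (g : H) :
    Subgroup.zpowers g ≠ ⊤ := by
  intro htop
  have key : ∀ (g : H) (n : ℕ), Subgroup.zpowers g = ⊤ →
      f (Multiplicative.ofAdd 1) ≠ g ^ n := by
    intro g n htop hn
    rcases Nat.lt_or_ge n 2 with h | h
    · interval_cases n
      · have : Multiplicative.ofAdd (1 : ℤ) = 1 := hinj (by rw [hn, pow_zero, map_one])
        exact one_ne_zero (Multiplicative.ofAdd.injective this)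
      · refine hsurj (MonoidHom.range_eq_top.1 ?_)
        rw [range_eq_zpowers, hn, pow_one, htop]
    · exact hpow g n h hn
  obtain ⟨n, hn⟩ := Subgroup.mem_zpowers_iff.1 (htop ▸ Subgroup.mem_top (f (Multiplicative.ofAdd 1)))
  obtain ⟨m, rfl | rfl⟩ := n.eq_nat_or_neg
  · exact key g m htop (by rw [← hn, zpow_natCast])
  · exact key g⁻¹ m (by rwa [Subgroup.zpowers_inv])
      (by rw [← hn, zpow_neg, zpow_natCast, inv_pow])

theorem exists_zpowers_eq_top_of_subsingleton [Group H] [Subsingleton κ] (η : FreeGroup κ ≃* H) :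
    ∃ g : H, Subgroup.zpowers g = ⊤ := by
  rcases isEmpty_or_nonempty κ with hκ | ⟨⟨k⟩⟩
  · refine ⟨1, (Subgroup.eq_top_iff' _).2 fun x => ?_⟩
    rw [← η.apply_symm_apply x, Subsingleton.elim (η.symm x) 1, map_one]
    exact one_mem _
  · refine ⟨η (of k), ?_⟩
    have h : Subgroup.zpowers (of k) = ⊤ := by
      rw [Subgroup.zpowers_eq_closure, ← FreeGroup.closure_range_of]
      congr
      ext x
      constructor
      · rintro rfl
        exact ⟨k, rfl⟩
      · rintro ⟨l, rfl⟩
        rw [Subsingleton.elim l k]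
        rfl
    rw [← MulEquiv.coe_toMonoidHom, ← MonoidHom.map_zpowers, h]
    exact Subgroup.map_top_of_surjective _ η.surjective

theorem zpowers_eq_top_of_isEmpty [Group H] [IsEmpty ι] (θ : FreeGroup (Option ι) ≃* H) :
    Subgroup.zpowers (θ (of none)) = ⊤ := by
  have h : Subgroup.zpowers (of (none : Option ι)) = ⊤ := by
    rw [Subgroup.zpowers_eq_closure, ← FreeGroup.closure_range_of]
    congr
    ext x
    constructor
    · rintro rfl
      exact ⟨none, rfl⟩
    · rintro ⟨l, rfl⟩
      rw [Subsingleton.elim l none]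
      rfl
  rw [← MulEquiv.coe_toMonoidHom, ← MonoidHom.map_zpowers, h]
  exact Subgroup.map_top_of_surjective _ θ.surjective

theorem range_eq_closure_image_of {K S : Type*} [Group H] [Group K] (θ : FreeGroup S ≃* H)
    (φ : H →* K) : φ.range = Subgroup.closure (Set.range fun s => φ (θ (of s))) := by
  have h : φ.comp θ.toMonoidHom = FreeGroup.lift fun s => φ (θ (of s)) := by
    ext s
    simp
  rw [← FreeGroup.range_lift_eq_closure, ← h, MonoidHom.range_comp,
    MonoidHom.range_eq_top (f := θ.toMonoidHom) |>.2 θ.surjective, ← MonoidHom.range_eq_map]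

theorem map_ne_pow {κ' : Type*} [Group H] {v : κ → κ'} (hv : Function.Injective v)
    (η : FreeGroup κ ≃* H) {h : H} (hpow : ∀ (g : H) (n : ℕ), 2 ≤ n → h ≠ g ^ n)
    (c : FreeGroup κ') {n : ℕ} (hn : 2 ≤ n) : FreeGroup.map v (η.symm h) ≠ c ^ n := by
  intro hc
  let r : FreeGroup κ' →* H := FreeGroup.lift (Function.extend v (fun k => η (of k)) 1)
  have hr : r.comp (FreeGroup.map v) = η.toMonoidHom := by
    ext k
    simp [r, hv.extend_apply]
  refine hpow (r c) n hn ?_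
  rw [← map_pow, ← hc, ← MonoidHom.comp_apply, hr]
  simp

end Assembly

end SegmentSplitting

open SegmentSplitting

/-- in a nontrivial, very small, elementary cyclic segment splitting
`F(X) ≅ G 0 ∗_ℤ G 1`, each vertex subgroup is, up to automorphism of `F(X)`, of the form
`⟨A, b⟩` or `⟨B⟩` for a partition `X = A ⊔ B` with `#A ≥ 1`, `#B ≥ 2` and `b ∈ ⟨B⟩`
not a proper power. -/
theorem segment_splitting_vertex_subgroups
    {X : Type} [Fintype X] [DecidableEq X]
    (G : Fin 2 → Type) [inst : ∀ i, Group (G i)]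
    (f : ∀ i, Multiplicative ℤ →* G i)
    (hinj : ∀ i, Function.Injective (f i))
    (hnontriv : ∀ i, ¬ Function.Surjective (f i))
    (hvs : ∀ (i : Fin 2) (g : G i) (n : ℕ), 2 ≤ n → f i (Multiplicative.ofAdd 1) ≠ g ^ n)
    (e : FreeGroup X ≃* Monoid.PushoutI f) (i : Fin 2) :
    ∃ (theta : FreeGroup X ≃* FreeGroup X) (A B : Finset X) (b : FreeGroup X),
      Disjoint A B ∧ A ∪ B = Finset.univ ∧ 1 ≤ A.card ∧ 2 ≤ B.card ∧
      b ∈ Subgroup.closure (FreeGroup.of '' (B : Set X)) ∧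
      (∀ (c : FreeGroup X) (n : ℕ), 2 ≤ n → b ≠ c ^ n) ∧
      (Subgroup.map theta.toMonoidHom
          (Subgroup.map (e.symm.toMonoidHom.comp (Monoid.PushoutI.of (φ := f) i)) ⊤) =
            Subgroup.closure ((FreeGroup.of '' (A : Set X)) ∪ {b}) ∨
        Subgroup.map theta.toMonoidHom
          (Subgroup.map (e.symm.toMonoidHom.comp (Monoid.PushoutI.of (φ := f) i)) ⊤) =
            Subgroup.closure (FreeGroup.of '' (B : Set X))) := by
  classical
  obtain ⟨i₀, E, hE, hodd, heven⟩ := exists_side_almostInvariant hinj e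
  have hfree : ∀ k, ∃ S : Type, Nonempty (FreeGroup S ≃* G k) := fun k =>
    exists_freeGroup_mulEquiv (e.symm.toMonoidHom.comp (Monoid.PushoutI.of (φ := f) k))
      (e.symm.injective.comp (Monoid.PushoutI.of_injective hinj k))
  obtain ⟨S, ⟨ψ⟩⟩ := hfree i₀
  obtain ⟨s, θ, hθ⟩ := exists_optionBasis_of_almostInvariant ψ hE hodd heven
  obtain ⟨j, hij, hcases⟩ : ∃ j : Fin 2, i₀ ≠ j ∧ ∀ k, k = i₀ ∨ k = j :=
    ⟨1 - i₀, by omega, by omega⟩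
  obtain ⟨κ, ⟨η⟩⟩ := hfree j
  obtain ⟨Ψ, hΨi, hΨj⟩ := exists_pushout_mulEquiv hij θ hθ η
  let σ := Equiv.ofFreeGroupEquiv (e.trans Ψ)
  let u := fun a => σ.symm (Sum.inl a)
  let v := fun k => σ.symm (Sum.inr k)
  have hv : Function.Injective v := σ.symm.injective.comp Sum.inr_injective
  let τ := Ψ.trans (FreeGroup.freeGroupCongr σ.symm)
  have hτi : ∀ a, τ (Monoid.PushoutI.of i₀ (θ (FreeGroup.of (some a)))) = FreeGroup.of (u a) :=
    fun a => by simp [τ, u, hΨi]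
  have hτj : ∀ x, τ (Monoid.PushoutI.of j (η x)) = FreeGroup.map v x := fun x => by
    simp [τ, v, hΨj, FreeGroup.map.comp, Function.comp_def]
  have hbase : Monoid.PushoutI.of (φ := f) i₀ (f i₀ (Multiplicative.ofAdd 1)) =
      Monoid.PushoutI.of j (f j (Multiplicative.ofAdd 1)) := by
    rw [Monoid.PushoutI.of_apply_eq_base, Monoid.PushoutI.of_apply_eq_base]
  have hb : τ (Monoid.PushoutI.of j (f j (Multiplicative.ofAdd 1))) =
      FreeGroup.map v (η.symm (f j (Multiplicative.ofAdd 1))) := by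
    rw [← hτj, η.apply_symm_apply]
  have himage : ∀ k, Subgroup.map (e.trans τ).toMonoidHom
      (Subgroup.map (e.symm.toMonoidHom.comp (Monoid.PushoutI.of (φ := f) k)) ⊤) =
        (τ.toMonoidHom.comp (Monoid.PushoutI.of (φ := f) k)).range := by
    intro k
    rw [Subgroup.map_map, MonoidHom.range_eq_map]
    congr 1
    ext x
    simp
  have hrange : (τ.toMonoidHom.comp (Monoid.PushoutI.of (φ := f) j)).range =
      Subgroup.closure (FreeGroup.of '' Set.range v) := by
    rw [range_eq_closure_image_of η, ← Set.range_comp]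
    congr 2
    ext k
    simp [hτj]
  refine ⟨e.trans τ, Finset.univ.filter (· ∈ Set.range u), Finset.univ.filter (· ∈ Set.range v),
    FreeGroup.map v (η.symm (f j (Multiplicative.ofAdd 1))), ?_, ?_, ?_, ?_, ?_,
    fun c n hn => map_ne_pow hv η (hvs j) c hn, ?_⟩
  · rw [Finset.disjoint_filter]
    rintro _ - ⟨a, rfl⟩ ⟨k, hk⟩
    simpa using σ.symm.injective hk
  · refine Finset.eq_univ_iff_forall.2 fun x => ?_
    rw [Finset.mem_union, Finset.mem_filter_univ, Finset.mem_filter_univ]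
    rcases h : σ x with a | k
    · exact Or.inl ⟨a, by simp [u, ← h]⟩
    · exact Or.inr ⟨k, by simp [v, ← h]⟩
  · rw [Nat.one_le_iff_ne_zero, Finset.card_ne_zero]
    rcases isEmpty_or_nonempty {t // t ≠ s} with h | ⟨⟨a⟩⟩
    · exact absurd (hθ ▸ zpowers_eq_top_of_isEmpty θ)
        (ne_top_of_forall_ne_pow (hinj i₀) (hnontriv i₀) (hvs i₀) _)
    · exact ⟨u a, (Finset.mem_filter_univ _).2 ⟨a, rfl⟩⟩
  · rw [Nat.succ_le_iff, Finset.one_lt_card]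
    rcases subsingleton_or_nontrivial κ with h | ⟨k, l, hkl⟩
    · obtain ⟨g, hg⟩ := exists_zpowers_eq_top_of_subsingleton η
      exact absurd hg (ne_top_of_forall_ne_pow (hinj j) (hnontriv j) (hvs j) g)
    · exact ⟨v k, by simp, v l, by simp, hv.ne hkl⟩
  · rw [Finset.coe_filter_univ, Set.ofPred_mem_eq, ← hrange, ← hb]
    exact ⟨_, rfl⟩
  · rw [himage]
    rcases hcases i with rfl | rfl
    · left
      rw [range_eq_closure_image_of θ]
      congr 1
      ext x
      simp [Option.exists, hτi, hθ, hbase, hb, or_comm, eq_comm]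
    · right
      rw [hrange, Finset.coe_filter_univ, Set.ofPred_mem_eq]
end
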